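/- There exist constants C, ν₀, ε₁ > 0 depending only on V such that the following holds. Let 0 < ν ≤ ν₀, νk² ≤ sup_{[0,1]}∂_yV, |o(ν,k)| ≤ ε₁(νk²)^{1/3}, let F be C¹ on [0,1], and let (w_{Na},φ_{Na}) solve the Orr–Sommerfeld equation with Navier-slip boundary conditions and forcing F. Then (1+|k(λ−V(0))|)|c₁| + (1+|k(λ−V(1))|)|c₂| ≤ C ν^{−1/12}|k|^{−5/3}‖F‖_{H¹_k}, where c₁ = ∫₀¹ (sinh(k(1−y))/sinh k) w_{Na}(y) dy and c₂ = ∫₀¹ (sinh(ky)/sinh k) w_{Na}(y) dy. -/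

import Mathlib

open MeasureTheory Set

noncomputable section

/-- Derivative within the interval `[0,1]` (complex-valued functions). -/
def dI (f : ℝ → ℂ) (y : ℝ) : ℂ := derivWithin f (Set.Icc 0 1) y

/-- Derivative within the interval `[0,1]` (real-valued functions). -/
def dIR (f : ℝ → ℝ) (y : ℝ) : ℝ := derivWithin f (Set.Icc 0 1) y

/-- `L²(0,1)` norm. -/
def L2 (g : ℝ → ℂ) : ℝ := Real.sqrt (∫ y in Set.Ioo (0:ℝ) 1, ‖g y‖ ^ 2)

/-- `H¹_k` norm on `(0,1)`: `‖g‖² = ‖∂_y g‖² + k²‖g‖²`. -/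
def H1k (k : ℤ) (g : ℝ → ℂ) : ℝ :=
  Real.sqrt (∫ y in Set.Ioo (0:ℝ) 1, ‖dI g y‖ ^ 2 + (k : ℝ) ^ 2 * ‖g y‖ ^ 2)

/-- The boundary-layer weight `ρ_k` with parameter `L = ν^{-1/3}|k|^{1/3}`. -/
def rhoW (L y : ℝ) : ℝ :=
  if y ≤ L⁻¹ then L * y else if y ≤ 1 - L⁻¹ then 1 else L * (1 - y)

/-- Weighted `L²` norm `‖ρ_k^{1/2} g‖_{L²}`. -/
def L2rho (L : ℝ) (g : ℝ → ℂ) : ℝ :=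
  Real.sqrt (∫ y in Set.Ioo (0:ℝ) 1, rhoW L y * ‖g y‖ ^ 2)

/-- The shear profile `V ∈ C⁴([0,1])`, strictly monotone with `∂_yV ≥ c₀ > 0`,
and strictly convex or strictly concave on `(0,1)`. -/
def GoodShear (V : ℝ → ℝ) : Prop :=
  ContDiffOn ℝ 4 V (Set.Icc 0 1) ∧
  (∃ c₀ > (0:ℝ), ∀ y ∈ Set.Icc (0:ℝ) 1, c₀ ≤ dIR V y) ∧
  ((∀ y ∈ Set.Ioo (0:ℝ) 1, 0 < dIR (dIR V) y) ∨
    (∀ y ∈ Set.Ioo (0:ℝ) 1, dIR (dIR V) y < 0))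

/-- `sup_{[0,1]} ∂_y V`. -/
def supDV (V : ℝ → ℝ) : ℝ := sSup (dIR V '' Set.Icc 0 1)

/-- `(w,φ)` solves the Orr–Sommerfeld equation with no-slip boundary conditions
and forcing `F`. -/
def OSNoSlip (ν lam : ℝ) (k : ℤ) (o : ℂ) (V : ℝ → ℝ) (w φ F : ℝ → ℂ) : Prop :=
  ContDiffOn ℝ 2 w (Set.Icc 0 1) ∧ ContDiffOn ℝ 2 φ (Set.Icc 0 1) ∧
  (∀ y ∈ Set.Ioo (0:ℝ) 1,
    -(ν : ℂ) * (dI (dI w) y - (k : ℂ) ^ 2 * w y)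
      + Complex.I * (k : ℂ) * ((V y - lam : ℝ) : ℂ) * w y
      - Complex.I * (k : ℂ) * ((dIR (dIR V) y : ℝ) : ℂ) * φ y
      + o * w y = F y) ∧
  (∀ y ∈ Set.Ioo (0:ℝ) 1, dI (dI φ) y - (k : ℂ) ^ 2 * φ y = w y) ∧
  φ 0 = 0 ∧ φ 1 = 0 ∧ dI φ 0 = 0 ∧ dI φ 1 = 0

/-- `(w,φ)` solves the Orr–Sommerfeld equation with Navier-slip boundary conditions
and forcing `F`. -/
def OSNavier (ν lam : ℝ) (k : ℤ) (o : ℂ) (V : ℝ → ℝ) (w φ F : ℝ → ℂ) : Prop :=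
  ContDiffOn ℝ 2 w (Set.Icc 0 1) ∧ ContDiffOn ℝ 2 φ (Set.Icc 0 1) ∧
  (∀ y ∈ Set.Ioo (0:ℝ) 1,
    -(ν : ℂ) * (dI (dI w) y - (k : ℂ) ^ 2 * w y)
      + Complex.I * (k : ℂ) * ((V y - lam : ℝ) : ℂ) * w y
      - Complex.I * (k : ℂ) * ((dIR (dIR V) y : ℝ) : ℂ) * φ y
      + o * w y = F y) ∧
  (∀ y ∈ Set.Ioo (0:ℝ) 1, dI (dI φ) y - (k : ℂ) ^ 2 * φ y = w y) ∧
  φ 0 = 0 ∧ φ 1 = 0 ∧ w 0 = 0 ∧ w 1 = 0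

/-- The `H⁻¹_k` bound hypothesis: `|⟨F,φ⟩| ≤ M ‖φ‖_{H¹_k}` for all `C¹` test
functions vanishing at the endpoints. -/
def Hm1Bound (k : ℤ) (F : ℝ → ℂ) (M : ℝ) : Prop :=
  0 ≤ M ∧ ∀ φ : ℝ → ℂ, ContDiffOn ℝ 1 φ (Set.Icc 0 1) → φ 0 = 0 → φ 1 = 0 →
    ‖∫ y in Set.Ioo (0:ℝ) 1, F y * (starRingEnd ℂ) (φ y)‖ ≤ M * H1k k φ

/-- `L^∞` norm over `[0,1]`. -/
def supI (g : ℝ → ℂ) : ℝ := ⨆ y : Set.Icc (0:ℝ) 1, ‖g (y : ℝ)‖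

/-- The set `E_δ = {y ∈ [0,1] : λ - δ < V(y) < λ + δ}`. -/
def ED (V : ℝ → ℝ) (lam δ : ℝ) : Set ℝ :=
  {y | y ∈ Set.Icc (0:ℝ) 1 ∧ lam - δ < V y ∧ V y < lam + δ}

/-- The cutoff function `χ_δ`. -/
def chiD (V : ℝ → ℝ) (lam δ : ℝ) (y : ℝ) : ℝ :=
  if lam - δ < V y ∧ V y < lam + δ then
    2 * (V y - lam) ^ 2 / δ ^ 2 - (V y - lam) ^ 4 / δ ^ 4
  else 1

/-- The function `f · χ_δ / (V - λ)`. -/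
def chiQuot (V : ℝ → ℝ) (lam δ : ℝ) (f : ℝ → ℂ) : ℝ → ℂ :=
  fun y => f y * ((chiD V lam δ y / (V y - lam) : ℝ) : ℂ)

/-- The coefficient `c₁ = ∫₀¹ sinh(k(1-y))/sinh(k) · w(y) dy`. -/
def coefA (k : ℤ) (w : ℝ → ℂ) : ℂ :=
  ∫ y in Set.Ioo (0:ℝ) 1,
    ((Real.sinh ((k : ℝ) * (1 - y)) / Real.sinh (k : ℝ) : ℝ) : ℂ) * w y

/-- The coefficient `c₂ = ∫₀¹ sinh(ky)/sinh(k) · w(y) dy`. -/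
def coefB (k : ℤ) (w : ℝ → ℂ) : ℂ :=
  ∫ y in Set.Ioo (0:ℝ) 1,
    ((Real.sinh ((k : ℝ) * y) / Real.sinh (k : ℝ) : ℝ) : ℂ) * w y

namespace OSP

lemma le_sq {a b : ℝ} (h : a ^ 2 ≤ b ^ 2) (hb : 0 ≤ b) : a ≤ b :=
  (le_abs_self a).trans (abs_le_of_sq_le_sq h hb)

section basic
set_option linter.unusedSectionVars false
variable {E : Type*} [NormedAddCommGroup E] [NormedSpace ℝ E]

/-- Integral over `[0,1]`. -/
def J (f : ℝ → E) : E := ∫ y in (0:ℝ)..1, f y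

lemma J_congr {f g : ℝ → E} (h : ∀ y ∈ Icc (0:ℝ) 1, f y = g y) : J f = J g := by
  unfold J
  apply intervalIntegral.integral_congr
  intro y hy
  rw [uIcc_of_le zero_le_one] at hy
  exact h y hy

lemma J_add {f g : ℝ → E} (hf : Continuous f) (hg : Continuous g) :
    J (fun y => f y + g y) = J f + J g :=
  intervalIntegral.integral_add (hf.intervalIntegrable _ _) (hg.intervalIntegrable _ _)

lemma J_sub {f g : ℝ → E} (hf : Continuous f) (hg : Continuous g) :
    J (fun y => f y - g y) = J f - J g :=
  intervalIntegral.integral_sub (hf.intervalIntegrable _ _) (hg.intervalIntegrable _ _)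

lemma J_cmul (c : ℝ) (f : ℝ → ℝ) : J (fun y => c * f y) = c * J f :=
  intervalIntegral.integral_const_mul _ _

lemma J_cmulC (c : ℂ) (f : ℝ → ℂ) : J (fun y => c * f y) = c * J f :=
  intervalIntegral.integral_const_mul _ _

lemma J_neg (f : ℝ → E) : J (fun y => - f y) = - J f :=
  intervalIntegral.integral_neg

lemma J_const (c : ℝ) : J (fun _ => c) = c := by simp [J]

lemma J_mono {f g : ℝ → ℝ} (hf : Continuous f) (hg : Continuous g)
    (h : ∀ y ∈ Icc (0:ℝ) 1, f y ≤ g y) : J f ≤ J g :=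
  intervalIntegral.integral_mono_on zero_le_one (hf.intervalIntegrable _ _)
    (hg.intervalIntegrable _ _) h

lemma J_nonneg {f : ℝ → ℝ} (h : ∀ y ∈ Icc (0:ℝ) 1, 0 ≤ f y) : 0 ≤ J f :=
  intervalIntegral.integral_nonneg zero_le_one h

lemma norm_J_le (f : ℝ → E) : ‖J f‖ ≤ J (fun y => ‖f y‖) :=
  intervalIntegral.norm_integral_le_integral_norm zero_le_one

lemma norm_J_le_of {f : ℝ → E} {g : ℝ → ℝ} (hf : Continuous f) (hg : Continuous g)
    (h : ∀ y ∈ Icc (0:ℝ) 1, ‖f y‖ ≤ g y) : ‖J f‖ ≤ J g :=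
  (norm_J_le f).trans (J_mono hf.norm hg h)

lemma J_ofReal (f : ℝ → ℝ) : J (fun y => ((f y : ℝ) : ℂ)) = ((J f : ℝ) : ℂ) :=
  intervalIntegral.integral_ofReal

lemma J_re {f : ℝ → ℂ} (hf : Continuous f) : (J f).re = J (fun y => (f y).re) := by
  have := (Complex.reCLM).intervalIntegral_comp_comm (hf.intervalIntegrable (μ := volume) 0 1)
  simpa [J] using this.symm

lemma J_im {f : ℝ → ℂ} (hf : Continuous f) : (J f).im = J (fun y => (f y).im) := by
  have := (Complex.imCLM).intervalIntegral_comp_comm (hf.intervalIntegrable (μ := volume) 0 1)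
  simpa [J] using this.symm

lemma J_conj (f : ℝ → ℂ) :
    J (fun y => (starRingEnd ℂ) (f y)) = (starRingEnd ℂ) (J f) := by
  unfold J
  rw [intervalIntegral.integral_of_le zero_le_one, intervalIntegral.integral_of_le zero_le_one]
  exact integral_conj

/-- `L²(0,1)` norm. -/
def n2 (f : ℝ → E) : ℝ := Real.sqrt (J (fun y => ‖f y‖ ^ 2))

lemma n2_nonneg (f : ℝ → E) : 0 ≤ n2 f := Real.sqrt_nonneg _

lemma n2_sq (f : ℝ → E) : n2 f ^ 2 = J (fun y => ‖f y‖ ^ 2) :=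
  Real.sq_sqrt (J_nonneg fun _ _ => by positivity)

lemma n2_eq {f : ℝ → E} {F : Type*} [NormedAddCommGroup F] [NormedSpace ℝ F] {g : ℝ → F}
    (h : ∀ y ∈ Icc (0:ℝ) 1, ‖f y‖ = ‖g y‖) : n2 f = n2 g := by
  unfold n2
  rw [J_congr (f := fun y => ‖f y‖ ^ 2) (g := fun y => ‖g y‖ ^ 2)]
  intro y hy
  simp only [h y hy]

lemma cs0 {f g : ℝ → ℝ} (hf : Continuous f) (hg : Continuous g) :
    (J (fun y => f y * g y)) ^ 2 ≤ J (fun y => f y ^ 2) * J (fun y => g y ^ 2) := by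
  have key : ∀ t : ℝ, 0 ≤ J (fun y => g y ^ 2) * (t * t)
      + (-2 * J (fun y => f y * g y)) * t + J (fun y => f y ^ 2) := by
    intro t
    have h1 : J (fun y => (f y - t * g y) ^ 2) =
        J (fun y => f y ^ 2) + (-2 * t) * J (fun y => f y * g y)
          + (t * t) * J (fun y => g y ^ 2) := by
      rw [← J_cmul, ← J_cmul, ← J_add (by fun_prop) (by fun_prop),
        ← J_add (by fun_prop) (by fun_prop)]
      apply J_congr
      intro y _
      ring
    have h2 : 0 ≤ J (fun y => (f y - t * g y) ^ 2) := J_nonneg fun _ _ => by positivity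
    rw [h1] at h2
    linarith
  have h := discrim_le_zero key
  unfold discrim at h
  nlinarith

lemma cs {E' : Type*} [NormedAddCommGroup E'] [NormedSpace ℝ E'] {f : ℝ → E} {g : ℝ → E'}
    (hf : Continuous f) (hg : Continuous g) :
    J (fun y => ‖f y‖ * ‖g y‖) ≤ n2 f * n2 g := by
  refine le_sq ?_ (mul_nonneg (n2_nonneg f) (n2_nonneg g))
  rw [mul_pow, n2_sq, n2_sq]
  exact cs0 hf.norm hg.norm

lemma norm_J_mul_le {f g : ℝ → ℂ} (hf : Continuous f) (hg : Continuous g) :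
    ‖J (fun y => f y * g y)‖ ≤ n2 f * n2 g := by
  refine (norm_J_le _).trans (le_trans (le_of_eq ?_) (cs hf hg))
  simp only [norm_mul]

lemma n2_le_add {E1 E2 : Type*} [NormedAddCommGroup E1] [NormedSpace ℝ E1]
    [NormedAddCommGroup E2] [NormedSpace ℝ E2] {f : ℝ → E} {g : ℝ → E1} {h : ℝ → E2}
    (hf : Continuous f) (hg : Continuous g) (hh : Continuous h) {α β : ℝ} (hα : 0 ≤ α) (hβ : 0 ≤ β)
    (H : ∀ y ∈ Icc (0:ℝ) 1, ‖f y‖ ≤ α * ‖g y‖ + β * ‖h y‖) : n2 f ≤ α * n2 g + β * n2 h := by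
  have hg0 := n2_nonneg g
  have hh0 := n2_nonneg h
  refine le_sq ?_ (by positivity)
  have h1 : n2 f ^ 2 ≤ J (fun y => α ^ 2 * ‖g y‖ ^ 2 + (2 * α * β) * (‖g y‖ * ‖h y‖)
      + β ^ 2 * ‖h y‖ ^ 2) := by
    rw [n2_sq]
    refine J_mono (by fun_prop) (by fun_prop) fun y hy => ?_
    have := H y hy
    have h0 := norm_nonneg (f y)
    nlinarith [pow_le_pow_left₀ h0 this 2]
  rw [J_add (by fun_prop) (by fun_prop), J_add (by fun_prop) (by fun_prop), J_cmul, J_cmul, J_cmul,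
    ← n2_sq, ← n2_sq] at h1
  have h2 := cs hg hh
  have : 2 * α * β * J (fun y => ‖g y‖ * ‖h y‖) ≤ 2 * α * β * (n2 g * n2 h) := by gcongr
  nlinarith

lemma n2_le_mul {E1 : Type*} [NormedAddCommGroup E1] [NormedSpace ℝ E1]
    {f : ℝ → E} {g : ℝ → E1}
    (hf : Continuous f) (hg : Continuous g) {α : ℝ} (hα : 0 ≤ α)
    (H : ∀ y ∈ Icc (0:ℝ) 1, ‖f y‖ ≤ α * ‖g y‖) : n2 f ≤ α * n2 g := by
  have := n2_le_add (β := 0) hf hg hg hα le_rfl (fun y hy => by simpa using H y hy)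
  simpa using this

lemma n2_const (c : ℝ) : n2 (fun _ : ℝ => c) = |c| := by
  unfold n2
  rw [J_const (‖c‖ ^ 2), Real.sqrt_sq (norm_nonneg c)]
  rfl

lemma n2_le_const {f : ℝ → E} (hf : Continuous f) {c : ℝ} (hc : 0 ≤ c)
    (H : ∀ y ∈ Icc (0:ℝ) 1, ‖f y‖ ≤ c) : n2 f ≤ c := by
  have := n2_le_mul (g := fun _ : ℝ => (1:ℝ)) hf continuous_const hc (fun y hy => by simpa using H y hy)
  simpa [n2_const] using this

/-- `f` is continuous, with continuous derivative `f'` on `(0,1)`. -/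
structure D1 (f f' : ℝ → E) : Prop where
  c : Continuous f
  c' : Continuous f'
  d : ∀ x ∈ Ioo (0:ℝ) 1, HasDerivAt f (f' x) x

lemma D1.ftc' [CompleteSpace E] {f f' : ℝ → E} (h : D1 f f') {p q : ℝ} (hp : 0 ≤ p) (hpq : p ≤ q)
    (hq : q ≤ 1) : ∫ y in p..q, f' y = f q - f p :=
  intervalIntegral.integral_eq_sub_of_hasDerivAt_of_le hpq h.c.continuousOn
    (fun x hx => h.d x ⟨lt_of_le_of_lt hp hx.1, lt_of_lt_of_le hx.2 hq⟩)
    (h.c'.intervalIntegrable _ _)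

lemma D1.ftc [CompleteSpace E] {f f' : ℝ → E} (h : D1 f f') : J f' = f 1 - f 0 :=
  h.ftc' le_rfl zero_le_one le_rfl

lemma D1.add {f f' g g' : ℝ → E} (hf : D1 f f') (hg : D1 g g') :
    D1 (fun y => f y + g y) (fun y => f' y + g' y) :=
  ⟨hf.c.add hg.c, hf.c'.add hg.c', fun x hx => (hf.d x hx).add (hg.d x hx)⟩

lemma D1.sub {f f' g g' : ℝ → E} (hf : D1 f f') (hg : D1 g g') :
    D1 (fun y => f y - g y) (fun y => f' y - g' y) :=
  ⟨hf.c.sub hg.c, hf.c'.sub hg.c', fun x hx => (hf.d x hx).sub (hg.d x hx)⟩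

lemma D1.const (c : E) : D1 (fun _ => c) (fun _ => 0) :=
  ⟨continuous_const, continuous_const, fun x _ => hasDerivAt_const x c⟩

lemma D1.id : D1 (fun y : ℝ => y) (fun _ => 1) :=
  ⟨continuous_id, continuous_const, fun x _ => hasDerivAt_id x⟩

lemma D1.mul {A : Type*} [NormedRing A] [NormedAlgebra ℝ A] {f f' g g' : ℝ → A} (hf : D1 f f')
    (hg : D1 g g') : D1 (fun y => f y * g y) (fun y => f' y * g y + f y * g' y) :=
  ⟨hf.c.mul hg.c, (hf.c'.mul hg.c).add (hf.c.mul hg.c'), fun x hx => (hf.d x hx).mul (hg.d x hx)⟩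

lemma D1.ofReal {f f' : ℝ → ℝ} (hf : D1 f f') :
    D1 (fun y => ((f y : ℝ) : ℂ)) (fun y => ((f' y : ℝ) : ℂ)) :=
  ⟨Complex.continuous_ofReal.comp hf.c, Complex.continuous_ofReal.comp hf.c',
    fun x hx => (hf.d x hx).ofReal_comp⟩

lemma D1.conj {f f' : ℝ → ℂ} (hf : D1 f f') :
    D1 (fun y => (starRingEnd ℂ) (f y)) (fun y => (starRingEnd ℂ) (f' y)) :=
  ⟨Complex.continuous_conj.comp hf.c, Complex.continuous_conj.comp hf.c',
    fun x hx => (hf.d x hx).star⟩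

lemma D1.inv {f f' : ℝ → ℝ} (hf : D1 f f') (h0 : ∀ y, f y ≠ 0) :
    D1 (fun y => (f y)⁻¹) (fun y => - f' y / f y ^ 2) := by
  refine ⟨hf.c.inv₀ h0, hf.c'.neg.div (hf.c.pow 2) fun y => pow_ne_zero 2 (h0 y), ?_⟩
  intro x hx
  exact (hf.d x hx).inv (h0 x)

lemma D1.log {f f' : ℝ → ℝ} (hf : D1 f f') (h0 : ∀ y, f y ≠ 0) :
    D1 (fun y => Real.log (f y)) (fun y => f' y / f y) :=
  ⟨hf.c.log h0, hf.c'.div hf.c h0, fun x hx => (hf.d x hx).log (h0 x)⟩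

lemma D1.congr' {f f' g' : ℝ → E} (hf : D1 f f') (h : ∀ y, f' y = g' y) : D1 f g' := by
  rwa [← funext h]

lemma D1.congr {f f' g g' : ℝ → E} (hf : D1 f f') (h : ∀ y, f y = g y) (h' : ∀ y, f' y = g' y) :
    D1 g g' := by
  rwa [← funext h, ← funext h']

lemma J_sub_le {f : ℝ → ℝ} (hf : Continuous f) (h0 : ∀ y ∈ Icc (0:ℝ) 1, 0 ≤ f y) {p q : ℝ}
    (hp : 0 ≤ p) (hpq : p ≤ q) (hq : q ≤ 1) : ∫ y in p..q, f y ≤ J f := by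
  unfold J
  apply intervalIntegral.integral_mono_interval hp hpq hq _ (hf.intervalIntegrable _ _)
  rw [Filter.EventuallyLE, ae_restrict_iff' measurableSet_Ioc]
  exact Filter.Eventually.of_forall fun y hy => h0 y ⟨hy.1.le, hy.2⟩

/-- Hölder bound. -/
lemma D1.holder0 [CompleteSpace E] {f f' : ℝ → E} (h : D1 f f') {p q : ℝ} (hp : 0 ≤ p)
    (hpq : p ≤ q) (hq : q ≤ 1) : ‖f q - f p‖ ^ 2 ≤ (q - p) * n2 f' ^ 2 := by
  have h1 : ‖f q - f p‖ ≤ ∫ y in p..q, ‖f' y‖ := by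
    rw [← h.ftc' hp hpq hq]
    exact intervalIntegral.norm_integral_le_integral_norm hpq
  have hc := h.c'
  have ii : ∀ g : ℝ → ℝ, Continuous g → IntervalIntegrable g volume p q :=
    fun g hg => hg.intervalIntegrable _ _
  set B := ∫ y in p..q, ‖f' y‖ with hB
  set A := ∫ y in p..q, ‖f' y‖ ^ 2 with hA
  have hA2 : A ≤ n2 f' ^ 2 := by
    rw [n2_sq]
    exact J_sub_le (by fun_prop) (fun _ _ => by positivity) hp hpq hq
  have hB0 : 0 ≤ B := intervalIntegral.integral_nonneg hpq fun _ _ => norm_nonneg _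
  have key : ∀ t : ℝ, 0 ≤ (q - p) * (t * t) + (-2 * B) * t + A := by
    intro t
    have h2 : 0 ≤ ∫ y in p..q, (‖f' y‖ - t) ^ 2 :=
      intervalIntegral.integral_nonneg hpq fun _ _ => by positivity
    have h3 : ∫ y in p..q, (‖f' y‖ - t) ^ 2 = A + (-2 * t) * B + (q - p) * (t * t) := by
      rw [hA, hB, ← intervalIntegral.integral_const_mul,
        ← intervalIntegral.integral_add (ii _ (by fun_prop)) (ii _ (by fun_prop))]
      rw [← smul_eq_mul (q - p), ← intervalIntegral.integral_const,
        ← intervalIntegral.integral_add (ii _ (by fun_prop)) (ii _ (by fun_prop))]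
      apply intervalIntegral.integral_congr
      intro y _
      ring_nf
    rw [h3] at h2
    linarith
  have h := discrim_le_zero key
  unfold discrim at h
  have h4 : B ^ 2 ≤ (q - p) * A := by nlinarith
  calc ‖f q - f p‖ ^ 2 ≤ B ^ 2 := by gcongr
    _ ≤ (q - p) * A := h4
    _ ≤ _ := mul_le_mul_of_nonneg_left hA2 (by linarith)

lemma D1.holder [CompleteSpace E] {f f' : ℝ → E} (h : D1 f f') {p q : ℝ} (hp : p ∈ Icc (0:ℝ) 1)
    (hq : q ∈ Icc (0:ℝ) 1) : ‖f q - f p‖ ^ 2 ≤ |q - p| * n2 f' ^ 2 := by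
  rcases le_total p q with h1 | h1
  · rw [abs_of_nonneg (by linarith)]
    exact h.holder0 hp.1 h1 hq.2
  · rw [abs_of_nonpos (by linarith), norm_sub_rev, neg_sub]
    exact h.holder0 hq.1 h1 hp.2

end basic

lemma D1.normSq {f f' : ℝ → ℂ} (hf : D1 f f') :
    D1 (fun y => ‖f y‖ ^ 2) (fun y => 2 * (f' y * (starRingEnd ℂ) (f y)).re) := by
  have hc := hf.c
  have hc' := hf.c'
  refine ⟨by fun_prop, ?_, ?_⟩
  · exact continuous_const.mul (Complex.continuous_re.comp (hc'.mul (Complex.continuous_conj.comp hc)))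
  · intro x hx
    have := (hf.d x hx).norm_sq
    refine this.congr_deriv ?_
    rw [Complex.inner]

/-- Sup bounds. -/
lemma D1.sup_diff {f f' : ℝ → ℂ} (h : D1 f f') {p q : ℝ} (hp : p ∈ Icc (0:ℝ) 1)
    (hq : q ∈ Icc (0:ℝ) 1) : ‖f q‖ ^ 2 ≤ ‖f p‖ ^ 2 + 2 * (n2 f * n2 f') := by
  have hs := h.normSq
  have hc := h.c
  have hc' := h.c'
  have key : ∀ a b : ℝ, 0 ≤ a → a ≤ b → b ≤ 1 →
      |‖f b‖ ^ 2 - ‖f a‖ ^ 2| ≤ 2 * (n2 f * n2 f') := by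
    intro a b ha hab hb
    rw [← hs.ftc' ha hab hb]
    have h1 := intervalIntegral.norm_integral_le_integral_norm (μ := volume)
      (f := fun y => 2 * (f' y * (starRingEnd ℂ) (f y)).re) hab
    rw [Real.norm_eq_abs] at h1
    refine h1.trans ?_
    have h2 : ∫ y in a..b, ‖2 * (f' y * (starRingEnd ℂ) (f y)).re‖ ≤
        ∫ y in a..b, 2 * (‖f y‖ * ‖f' y‖) := by
      apply intervalIntegral.integral_mono_on hab (hs.c'.norm.intervalIntegrable _ _)
        ((by fun_prop : Continuous fun y => 2 * (‖f y‖ * ‖f' y‖)).intervalIntegrable _ _)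
      intro y _
      rw [norm_mul, Real.norm_eq_abs, Real.norm_eq_abs]
      have := Complex.abs_re_le_norm (f' y * (starRingEnd ℂ) (f y))
      rw [norm_mul, RCLike.norm_conj] at this
      rw [abs_of_pos (by norm_num : (0:ℝ) < 2)]
      linarith
    refine h2.trans ((J_sub_le (by fun_prop) (fun _ _ => by positivity) ha hab hb).trans ?_)
    rw [J_cmul]
    have := cs hc hc'
    linarith
  rcases le_total p q with h1 | h1
  · have := (abs_le.1 (key p q hp.1 h1 hq.2)).2
    linarith
  · have := (abs_le.1 (key q p hq.1 h1 hp.2)).1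
    linarith

lemma D1.sup0 {f f' : ℝ → ℂ} (h : D1 f f') (h0 : f 0 = 0) {q : ℝ}
    (hq : q ∈ Icc (0:ℝ) 1) : ‖f q‖ ^ 2 ≤ 2 * (n2 f * n2 f') := by
  have := h.sup_diff (p := 0) ⟨le_rfl, zero_le_one⟩ hq
  simpa [h0] using this

lemma D1.sup {f f' : ℝ → ℂ} (h : D1 f f') {q : ℝ}
    (hq : q ∈ Icc (0:ℝ) 1) : ‖f q‖ ^ 2 ≤ n2 f ^ 2 + 2 * (n2 f * n2 f') := by
  have hc := h.c
  have h1 : J (fun _ => ‖f q‖ ^ 2) ≤ J (fun p => ‖f p‖ ^ 2 + 2 * (n2 f * n2 f')) :=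
    J_mono (by fun_prop) (by fun_prop) fun p hp => h.sup_diff hp hq
  rwa [J_const, J_add (by fun_prop) (by fun_prop), J_const, ← n2_sq] at h1

end OSP

namespace OSP

/-- Quantitative data of the shear profile. -/
structure Shear (c₀ M : ℝ) (V V1 V2 V3 : ℝ → ℝ) : Prop where
  c0 : 0 < c₀
  c1 : c₀ ≤ 1
  M1 : 1 ≤ M
  d0 : D1 V V1
  d1 : D1 V1 V2
  d2 : D1 V2 V3
  lo : ∀ y, c₀ ≤ V1 y
  b1 : ∀ y, |V1 y| ≤ M
  b2 : ∀ y, |V2 y| ≤ M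
  b3 : ∀ y, |V3 y| ≤ M
  vlo : ∀ y, V 0 ≤ V y
  vhi : ∀ y, V y ≤ V 1

/-- `1/((V-λ)²+δ²)`. -/
def rr (V : ℝ → ℝ) (lam δ : ℝ) (y : ℝ) : ℝ := ((V y - lam) ^ 2 + δ ^ 2)⁻¹

/-- `(V-λ)/((V-λ)²+δ²)`. -/
def mm (V : ℝ → ℝ) (lam δ : ℝ) (y : ℝ) : ℝ := (V y - lam) * rr V lam δ y

/-- Derivative of `mm`. -/
def mm1 (V V1 : ℝ → ℝ) (lam δ : ℝ) (y : ℝ) : ℝ :=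
  V1 y * rr V lam δ y * (1 - 2 * ((V y - lam) ^ 2 * rr V lam δ y))

section kernel
variable {V V1 V2 V3 : ℝ → ℝ} {c₀ M lam δ : ℝ}

lemma den_pos (hδ : 0 < δ) (y : ℝ) : 0 < (V y - lam) ^ 2 + δ ^ 2 := by positivity

lemma rr_pos (hδ : 0 < δ) (y : ℝ) : 0 < rr V lam δ y := inv_pos.2 (den_pos hδ y)

lemma rr_mul (hδ : 0 < δ) (y : ℝ) : ((V y - lam) ^ 2 + δ ^ 2) * rr V lam δ y = 1 :=
  mul_inv_cancel₀ (den_pos hδ y).ne'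

lemma mm_one (hδ : 0 < δ) (y : ℝ) : (V y - lam) * mm V lam δ y + δ ^ 2 * rr V lam δ y = 1 := by
  have := rr_mul (V := V) (lam := lam) hδ y
  unfold mm
  linarith

lemma rr_le (hδ : 0 < δ) (y : ℝ) : δ ^ 2 * rr V lam δ y ≤ 1 := by
  have := rr_mul (V := V) (lam := lam) hδ y
  have h := rr_pos (V := V) (lam := lam) hδ y
  nlinarith [mul_nonneg (sq_nonneg (V y - lam)) h.le]

lemma xr_le (hδ : 0 < δ) (y : ℝ) : (V y - lam) ^ 2 * rr V lam δ y ≤ 1 := by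
  have := rr_mul (V := V) (lam := lam) hδ y
  have h := rr_pos (V := V) (lam := lam) hδ y
  nlinarith [mul_nonneg (sq_nonneg δ) h.le]

lemma mm_sq (hδ : 0 < δ) (y : ℝ) : mm V lam δ y ^ 2 ≤ rr V lam δ y := by
  have := xr_le (V := V) (lam := lam) hδ y
  have h := rr_pos (V := V) (lam := lam) hδ y
  unfold mm
  nlinarith

lemma mm_le (hδ : 0 < δ) (y : ℝ) : δ * |mm V lam δ y| ≤ 1 := by
  refine le_sq ?_ zero_le_one
  rw [mul_pow, sq_abs]
  have := mm_sq (V := V) (lam := lam) hδ y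
  have := rr_le (V := V) (lam := lam) hδ y
  nlinarith [sq_nonneg δ]

lemma mm1_le (hS : Shear c₀ M V V1 V2 V3) (hδ : 0 < δ) (y : ℝ) :
    |mm1 V V1 lam δ y| ≤ M * rr V lam δ y := by
  have h1 := xr_le (V := V) (lam := lam) hδ y
  have h := rr_pos (V := V) (lam := lam) hδ y
  have h2 : 0 ≤ (V y - lam) ^ 2 * rr V lam δ y := by positivity
  unfold mm1
  rw [abs_mul, abs_mul, abs_of_pos h]
  have h3 : |1 - 2 * ((V y - lam) ^ 2 * rr V lam δ y)| ≤ 1 := abs_le.2 ⟨by linarith, by linarith⟩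
  calc |V1 y| * rr V lam δ y * |1 - 2 * ((V y - lam) ^ 2 * rr V lam δ y)|
      ≤ M * rr V lam δ y * 1 := by
        have := hS.b1 y
        have hp : 0 ≤ M * rr V lam δ y := mul_nonneg (by linarith [hS.M1]) h.le
        gcongr
    _ = _ := by ring

lemma D1_den (hS : Shear c₀ M V V1 V2 V3) :
    D1 (fun y => (V y - lam) ^ 2 + δ ^ 2) (fun y => 2 * (V y - lam) * V1 y) := by
  have h := hS.d0.sub (D1.const lam)
  exact ((h.mul h).add (D1.const (δ ^ 2))).congr (fun y => by ring) (fun y => by ring)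

lemma D1_rr (hS : Shear c₀ M V V1 V2 V3) (hδ : 0 < δ) :
    D1 (rr V lam δ) (fun y => - (2 * (V y - lam) * V1 y) * rr V lam δ y ^ 2) := by
  refine ((D1_den (lam := lam) (δ := δ) hS).inv fun y => (den_pos hδ y).ne').congr (fun y => rfl) ?_
  intro y
  unfold rr
  rw [inv_pow, div_eq_mul_inv]

lemma D1_mm (hS : Shear c₀ M V V1 V2 V3) (hδ : 0 < δ) :
    D1 (mm V lam δ) (mm1 V V1 lam δ) := by
  refine ((hS.d0.sub (D1.const lam)).mul (D1_rr (lam := lam) hS hδ)).congr (fun y => rfl) ?_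
  intro y
  unfold mm1
  ring

lemma J_rr (hS : Shear c₀ M V V1 V2 V3) (hδ : 0 < δ) : J (rr V lam δ) ≤ Real.pi / (c₀ * δ) := by
  have hc0 := hS.c0
  have hcr := (D1_rr (lam := lam) hS hδ).c
  have hV1 := hS.d0.c'
  have hD : D1 (fun y => Real.arctan ((V y - lam) / δ)) (fun y => δ * (V1 y * rr V lam δ y)) := by
    refine ⟨Real.continuous_arctan.comp ((hS.d0.c.sub continuous_const).div_const _), by fun_prop, ?_⟩
    intro x hx
    have h1 := (((hS.d0.d x hx).sub_const lam).div_const δ).arctan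
    refine h1.congr_deriv ?_
    unfold rr
    have := den_pos (V := V) (lam := lam) hδ x
    field_simp
    ring
  have h2 := hD.ftc
  rw [J_cmul] at h2
  have h3 := Real.arctan_lt_pi_div_two ((V 1 - lam) / δ)
  have h4 := Real.neg_pi_div_two_lt_arctan ((V 0 - lam) / δ)
  have h5 : c₀ * J (rr V lam δ) ≤ J (fun y => V1 y * rr V lam δ y) := by
    rw [← J_cmul]
    refine J_mono (by fun_prop) (by fun_prop) fun y _ => ?_
    exact mul_le_mul_of_nonneg_right (hS.lo y) (rr_pos hδ y).le
  rw [le_div_iff₀ (by positivity)]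
  nlinarith [mul_le_mul_of_nonneg_left h5 hδ.le]

/-- `yc` is the critical point. -/
structure Crit (V : ℝ → ℝ) (c₀ lam yc : ℝ) : Prop where
  mem : yc ∈ Icc (0:ℝ) 1
  lo : ∀ y ∈ Icc (0:ℝ) 1, c₀ * |y - yc| ≤ |V y - lam|
  mid : V 0 ≤ lam → lam ≤ V 1 → V yc = lam
  left : lam ≤ V 0 → yc = 0
  right : V 1 ≤ lam → yc = 1

lemma Shear.growth (hS : Shear c₀ M V V1 V2 V3) {p q : ℝ} (hp : 0 ≤ p) (hpq : p ≤ q) (hq : q ≤ 1) :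
    c₀ * (q - p) ≤ V q - V p := by
  rw [← hS.d0.ftc' hp hpq hq]
  have h1 : ∫ y in p..q, c₀ ≤ ∫ y in p..q, V1 y :=
    intervalIntegral.integral_mono_on hpq (continuous_const.intervalIntegrable _ _)
      (hS.d0.c'.intervalIntegrable _ _) fun y _ => hS.lo y
  simp only [intervalIntegral.integral_const, smul_eq_mul] at h1
  linarith

lemma Shear.lip0 (hS : Shear c₀ M V V1 V2 V3) {p q : ℝ} (hp : 0 ≤ p) (hpq : p ≤ q) (hq : q ≤ 1) :
    V q - V p ≤ M * (q - p) := by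
  rw [← hS.d0.ftc' hp hpq hq]
  have h1 : ∫ y in p..q, V1 y ≤ ∫ y in p..q, M :=
    intervalIntegral.integral_mono_on hpq (hS.d0.c'.intervalIntegrable _ _)
      (continuous_const.intervalIntegrable _ _) fun y _ => (le_abs_self _).trans (hS.b1 y)
  simp only [intervalIntegral.integral_const, smul_eq_mul] at h1
  linarith

lemma Shear.lip (hS : Shear c₀ M V V1 V2 V3) {p q : ℝ} (hp : p ∈ Icc (0:ℝ) 1)
    (hq : q ∈ Icc (0:ℝ) 1) : |V q - V p| ≤ M * |q - p| := by
  have hc := hS.c0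
  rcases le_total p q with h | h
  · have h1 := hS.growth hp.1 h hq.2
    have h2 := hS.lip0 hp.1 h hq.2
    have h3 : 0 ≤ c₀ * (q - p) := mul_nonneg hc.le (by linarith)
    rw [abs_of_nonneg (by linarith), abs_of_nonneg (by linarith)]
    exact h2
  · have h1 := hS.growth hq.1 h hp.2
    have h2 := hS.lip0 hq.1 h hp.2
    have h3 : 0 ≤ c₀ * (p - q) := mul_nonneg hc.le (by linarith)
    rw [abs_of_nonpos (by linarith), abs_of_nonpos (by linarith)]
    linarith

lemma Shear.growth_abs (hS : Shear c₀ M V V1 V2 V3) {p q : ℝ} (hp : p ∈ Icc (0:ℝ) 1)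
    (hq : q ∈ Icc (0:ℝ) 1) : c₀ * |q - p| ≤ |V q - V p| := by
  rcases le_total p q with h | h
  · have h1 := hS.growth hp.1 h hq.2
    rw [abs_of_nonneg (by linarith : (0:ℝ) ≤ q - p)]
    exact h1.trans (le_abs_self _)
  · have h1 := hS.growth hq.1 h hp.2
    rw [abs_of_nonpos (by linarith : q - p ≤ 0)]
    have := neg_le_abs (V q - V p)
    linarith

lemma exists_crit (hS : Shear c₀ M V V1 V2 V3) (lam : ℝ) : ∃ yc, Crit V c₀ lam yc := by
  have hc := hS.c0
  have m0 : (0:ℝ) ∈ Icc (0:ℝ) 1 := ⟨le_rfl, zero_le_one⟩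
  have m1 : (1:ℝ) ∈ Icc (0:ℝ) 1 := ⟨zero_le_one, le_rfl⟩
  have h01 := hS.growth le_rfl zero_le_one le_rfl
  rcases le_total lam (V 0) with h | h
  · refine ⟨0, m0, ?_, fun h1 _ => le_antisymm h1 h, fun _ => rfl, fun h1 => by linarith⟩
    intro y hy
    have h1 := hS.growth le_rfl hy.1 hy.2
    rw [abs_of_nonneg (by linarith [hy.1])]
    exact le_trans (by linarith) (le_abs_self _)
  rcases le_total (V 1) lam with h' | h'
  · refine ⟨1, m1, ?_, fun _ h1 => le_antisymm h' h1, fun h1 => by linarith, fun _ => rfl⟩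
    intro y hy
    have h1 := hS.growth hy.1 hy.2 le_rfl
    rw [abs_of_nonpos (by linarith [hy.2])]
    exact le_trans (by linarith) (neg_le_abs _)
  · obtain ⟨yc, hyc, hV⟩ := intermediate_value_Icc zero_le_one hS.d0.c.continuousOn ⟨h, h'⟩
    refine ⟨yc, hyc, ?_, fun _ _ => hV, ?_, ?_⟩
    · intro y hy
      rw [← hV]
      exact hS.growth_abs hyc hy
    · intro h1
      have := hS.growth le_rfl hyc.1 hyc.2
      nlinarith [hyc.1]
    · intro h1
      have := hS.growth hyc.1 hyc.2 le_rfl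
      nlinarith [hyc.2]

lemma n2_mm (hS : Shear c₀ M V V1 V2 V3) (hδ : 0 < δ) :
    n2 (mm V lam δ) ^ 2 ≤ Real.pi / (c₀ * δ) := by
  have h1 := (D1_mm (lam := lam) hS hδ).c
  rw [n2_sq]
  refine le_trans (J_mono (by fun_prop) (D1_rr hS hδ).c fun y _ => ?_) (J_rr (lam := lam) hS hδ)
  rw [Real.norm_eq_abs, sq_abs]
  exact mm_sq hδ y

lemma J_rr_dist (hS : Shear c₀ M V V1 V2 V3) (hδ : 0 < δ) {yc : ℝ} (hC : Crit V c₀ lam yc) :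
    c₀ * J (fun y => rr V lam δ y * |y - yc|) ≤ Real.sqrt (Real.pi / (c₀ * δ)) := by
  have h1 := (D1_mm (lam := lam) hS hδ).c
  have h2 := (D1_rr (lam := lam) hS hδ).c
  have h3 : J (fun y => c₀ * (rr V lam δ y * |y - yc|)) ≤ J (fun y => ‖mm V lam δ y‖ * ‖(1:ℝ)‖) := by
    refine J_mono (by fun_prop) (by fun_prop) fun y hy => ?_
    have h4 := rr_pos (V := V) (lam := lam) hδ y
    have h5 := hC.lo y hy
    rw [norm_one, mul_one, Real.norm_eq_abs]
    unfold mm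
    rw [abs_mul, abs_of_pos h4]
    nlinarith
  rw [J_cmul] at h3
  have h4 := cs h1 (continuous_const (y := (1:ℝ)))
  rw [n2_const, abs_one, mul_one] at h4
  refine h3.trans (h4.trans ?_)
  exact Real.le_sqrt_of_sq_le (n2_mm hS hδ)

end kernel

/-- The localized equation `(V-λ)w = H - iσδ³(w''-a²w) + i o w`. -/
structure Loc (M : ℝ) (V : ℝ → ℝ) (lam δ a σ ε : ℝ) (o : ℂ) (w w1 w2 H H1 : ℝ → ℂ) : Prop where
  hδ : 0 < δ
  ha : 1 ≤ a
  hκ : a * δ ≤ M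
  hσ : |σ| = 1
  hε0 : 0 ≤ ε
  hε1 : ε ≤ 1
  ho : ‖o‖ ≤ ε * δ
  dw : D1 w w1
  dw1 : D1 w1 w2
  dH : D1 H H1
  w0 : w 0 = 0
  w1 : w 1 = 0
  eq : ∀ y, ((V y - lam : ℝ) : ℂ) * w y
    = H y - Complex.I * σ * δ ^ 3 * (w2 y - a ^ 2 * w y) + Complex.I * o * w y

section weak
variable {V V1 V2 V3 : ℝ → ℝ} {c₀ M lam δ a σ ε : ℝ} {o : ℂ} {w w1 w2 H H1 : ℝ → ℂ}

lemma weak_id (hS : Shear c₀ M V V1 V2 V3) (hL : Loc M V lam δ a σ ε o w w1 w2 H H1)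
    {f f1 : ℝ → ℂ} (hf : D1 f f1) (f0 : f 0 = 0) (f1' : f 1 = 0) :
    J (fun y => w y * f y) = J (fun y => (mm V lam δ y : ℂ) * (f y * H y))
      + J (fun y => ((δ ^ 2 * rr V lam δ y : ℝ) : ℂ) * (w y * f y))
      + Complex.I * σ * δ ^ 3 * J (fun y => (mm1 V V1 lam δ y : ℂ) * (f y * w1 y)
          + (mm V lam δ y : ℂ) * (f1 y * w1 y))
      + (Complex.I * σ * δ ^ 3 * a ^ 2 + Complex.I * o)
          * J (fun y => (mm V lam δ y : ℂ) * (f y * w y)) := by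
  have hm := (D1_mm (lam := lam) hS hL.hδ)
  have hmC := hm.ofReal
  have hr := (D1_rr (lam := lam) hS hL.hδ).c
  have hm' := hm.c
  have c1 := hmC.c
  have c2 := hmC.c'
  have c3 := hf.c
  have c4 := hf.c'
  have c5 := hL.dw.c
  have c6 := hL.dw.c'
  have c7 := hL.dw1.c'
  have c8 := hL.dH.c
  have hP := ((hmC.mul hf).mul hL.dw1).ftc
  simp only [f0, f1', mul_zero, zero_mul, sub_zero] at hP
  have hP2 : J (fun y => (mm1 V V1 lam δ y : ℂ) * (f y * w1 y)
          + (mm V lam δ y : ℂ) * (f1 y * w1 y)) + J (fun y => (mm V lam δ y : ℂ) * (f y * w2 y)) = 0 := by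
    rw [← hP, ← J_add (by fun_prop) (by fun_prop)]
    apply J_congr
    intro y _
    ring
  have hsplit : J (fun y => w y * f y) = J (fun y => (mm V lam δ y : ℂ) * (f y * H y))
      + J (fun y => ((δ ^ 2 * rr V lam δ y : ℝ) : ℂ) * (w y * f y))
      + (-(Complex.I * σ * δ ^ 3)) * J (fun y => (mm V lam δ y : ℂ) * (f y * w2 y))
      + (Complex.I * σ * δ ^ 3 * a ^ 2 + Complex.I * o)
          * J (fun y => (mm V lam δ y : ℂ) * (f y * w y)) := by
    rw [← J_cmulC, ← J_cmulC, ← J_add (by fun_prop) (by fun_prop),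
      ← J_add (by fun_prop) (by fun_prop), ← J_add (by fun_prop) (by fun_prop)]
    apply J_congr
    intro y _
    have h1 := hL.eq y
    have h2 : (((V y - lam : ℝ) : ℂ) * (mm V lam δ y : ℂ) + ((δ ^ 2 * rr V lam δ y : ℝ) : ℂ)) = 1 := by
      rw [← Complex.ofReal_mul, ← Complex.ofReal_add, mm_one hL.hδ y, Complex.ofReal_one]
    linear_combination (-(w y * f y)) * h2 + (mm V lam δ y : ℂ) * f y * h1
  rw [hsplit]
  linear_combination (-(Complex.I * σ * δ ^ 3)) * hP2

/-- Weighted square norm. -/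
def wA (V : ℝ → ℝ) (lam δ : ℝ) (f : ℝ → ℂ) : ℝ := J (fun y => rr V lam δ y * ‖f y‖ ^ 2)

lemma wA_nonneg (hδ : 0 < δ) (f : ℝ → ℂ) : 0 ≤ wA V lam δ f :=
  J_nonneg fun y _ => mul_nonneg (rr_pos hδ y).le (by positivity)

lemma cs_rr (hS : Shear c₀ M V V1 V2 V3) (hδ : 0 < δ) {f g : ℝ → ℂ} (hf : Continuous f)
    (hg : Continuous g) :
    J (fun y => Real.sqrt (rr V lam δ y) * (‖f y‖ * ‖g y‖)) ≤ Real.sqrt (wA V lam δ f) * n2 g := by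
  have hr := (D1_rr (lam := lam) hS hδ).c
  have h := cs (f := fun y => Real.sqrt (rr V lam δ y) * ‖f y‖) (g := g) (by fun_prop) hg
  have h2 : n2 (fun y => Real.sqrt (rr V lam δ y) * ‖f y‖) = Real.sqrt (wA V lam δ f) := by
    unfold n2 wA
    congr 1
    apply J_congr
    intro y _
    rw [Real.norm_eq_abs, sq_abs, mul_pow, Real.sq_sqrt (rr_pos hδ y).le]
  rw [h2] at h
  refine le_trans (le_of_eq ?_) h
  apply J_congr
  intro y _
  rw [Real.norm_eq_abs, abs_of_nonneg (by positivity)]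
  ring

lemma sqrt_rr_le (hδ : 0 < δ) (y : ℝ) : δ * Real.sqrt (rr V lam δ y) ≤ 1 := by
  refine le_sq ?_ zero_le_one
  rw [mul_pow, Real.sq_sqrt (rr_pos hδ y).le]
  simpa using rr_le hδ y

lemma mm_le_sqrt (hδ : 0 < δ) (y : ℝ) : |mm V lam δ y| ≤ Real.sqrt (rr V lam δ y) :=
  Real.abs_le_sqrt (mm_sq hδ y)

lemma weak_est (hS : Shear c₀ M V V1 V2 V3) (hL : Loc M V lam δ a σ ε o w w1 w2 H H1)
    {f f1 : ℝ → ℂ} (hf : D1 f f1) (f0 : f 0 = 0) (f1' : f 1 = 0) :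
    ‖J (fun y => w y * f y) - J (fun y => (mm V lam δ y : ℂ) * (f y * H y))‖
      ≤ (2 + M + M ^ 2) * δ * ((n2 w + δ * n2 w1) * (Real.sqrt (wA V lam δ f) + n2 f1)) := by
  have hδ := hL.hδ
  have hm := (D1_mm (lam := lam) hS hL.hδ)
  have hr := (D1_rr (lam := lam) hS hL.hδ).c
  have c1 := hm.c
  have c1C := hm.ofReal.c
  have c2C := hm.ofReal.c'
  have hrC := (D1_rr (lam := lam) hS hL.hδ).ofReal.c
  have c3 := hf.c
  have c4 := hf.c'
  have c5 := hL.dw.c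
  have c6 := hL.dw.c'
  have hM := hS.M1
  rw [weak_id hS hL hf f0 f1']
  set A := Real.sqrt (wA V lam δ f) with hA
  have hA0 : 0 ≤ A := Real.sqrt_nonneg _
  have hX := n2_nonneg w
  have hY := n2_nonneg w1
  have hf1 := n2_nonneg f1
  have e1 : ‖J (fun y => ((δ ^ 2 * rr V lam δ y : ℝ) : ℂ) * (w y * f y))‖ ≤ δ * (A * n2 w) := by
    have h := norm_J_le_of (f := fun y => ((δ ^ 2 * rr V lam δ y : ℝ) : ℂ) * (w y * f y))
      (g := fun y => δ * (Real.sqrt (rr V lam δ y) * (‖f y‖ * ‖w y‖))) (by fun_prop)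
      (by fun_prop) ?_
    · rw [J_cmul] at h
      exact h.trans (mul_le_mul_of_nonneg_left (cs_rr hS hδ c3 c5) hδ.le)
    · intro y _
      rw [norm_mul, norm_mul, Complex.norm_real, Real.norm_eq_abs,
        abs_of_nonneg (mul_nonneg (sq_nonneg δ) (rr_pos hδ y).le)]
      have h1 := sqrt_rr_le (V := V) (lam := lam) hδ y
      have h2 := Real.mul_self_sqrt (rr_pos (V := V) (lam := lam) hδ y).le
      have h3 : δ ^ 2 * rr V lam δ y ≤ δ * Real.sqrt (rr V lam δ y) := by
        have h4 : 0 ≤ δ * Real.sqrt (rr V lam δ y) := by positivity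
        have h5 : δ ^ 2 * rr V lam δ y =
            (δ * Real.sqrt (rr V lam δ y)) * (δ * Real.sqrt (rr V lam δ y)) := by
          rw [mul_mul_mul_comm, h2]; ring
        nlinarith
      calc δ ^ 2 * rr V lam δ y * (‖w y‖ * ‖f y‖)
          ≤ δ * Real.sqrt (rr V lam δ y) * (‖w y‖ * ‖f y‖) := by gcongr
        _ = _ := by ring
  have e2 : ‖J (fun y => (mm1 V V1 lam δ y : ℂ) * (f y * w1 y)
          + (mm V lam δ y : ℂ) * (f1 y * w1 y))‖ * δ ≤ M * (A * n2 w1) + n2 f1 * n2 w1 := by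
    have h := norm_J_le_of (f := fun y => (δ : ℂ) * ((mm1 V V1 lam δ y : ℂ) * (f y * w1 y)
          + (mm V lam δ y : ℂ) * (f1 y * w1 y)))
      (g := fun y => M * (Real.sqrt (rr V lam δ y) * (‖f y‖ * ‖w1 y‖)) + ‖f1 y‖ * ‖w1 y‖)
      (by fun_prop) (by fun_prop) ?_
    · have hJ : J (fun y => M * (Real.sqrt (rr V lam δ y) * (‖f y‖ * ‖w1 y‖)) + ‖f1 y‖ * ‖w1 y‖) =
          M * J (fun y => Real.sqrt (rr V lam δ y) * (‖f y‖ * ‖w1 y‖))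
          + J (fun y => ‖f1 y‖ * ‖w1 y‖) := by
        rw [J_add (by fun_prop) (by fun_prop), J_cmul]
      rw [J_cmulC, norm_mul, hJ, Complex.norm_real,
        Real.norm_eq_abs, abs_of_pos hδ, mul_comm] at h
      exact h.trans (add_le_add (mul_le_mul_of_nonneg_left (cs_rr hS hδ c3 c6) (by linarith))
        (cs c4 c6))
    · intro y _
      rw [norm_mul, Complex.norm_real, Real.norm_eq_abs, abs_of_pos hδ]
      have h0 := norm_add_le ((mm1 V V1 lam δ y : ℂ) * (f y * w1 y)) ((mm V lam δ y : ℂ) * (f1 y * w1 y))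
      rw [norm_mul, norm_mul, norm_mul, norm_mul, Complex.norm_real, Real.norm_eq_abs,
        Complex.norm_real, Real.norm_eq_abs] at h0
      have h1 := mm1_le (lam := lam) hS hδ y
      have h2 := mm_le (V := V) (lam := lam) hδ y
      have h3 := sqrt_rr_le (V := V) (lam := lam) hδ y
      have h4 := Real.mul_self_sqrt (rr_pos (V := V) (lam := lam) hδ y).le
      have h5 := Real.sqrt_nonneg (rr V lam δ y)
      have h6 : δ * |mm1 V V1 lam δ y| ≤ M * Real.sqrt (rr V lam δ y) := by
        calc δ * |mm1 V V1 lam δ y| ≤ δ * (M * rr V lam δ y) := by gcongr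
          _ = M * (δ * Real.sqrt (rr V lam δ y)) * Real.sqrt (rr V lam δ y) := by
            linear_combination (-(δ * M)) * h4
          _ ≤ M * 1 * Real.sqrt (rr V lam δ y) := by gcongr
          _ = _ := by ring
      calc δ * ‖(mm1 V V1 lam δ y : ℂ) * (f y * w1 y) + (mm V lam δ y : ℂ) * (f1 y * w1 y)‖
          ≤ δ * (|mm1 V V1 lam δ y| * (‖f y‖ * ‖w1 y‖) + |mm V lam δ y| * (‖f1 y‖ * ‖w1 y‖)) := by
            gcongr
        _ = (δ * |mm1 V V1 lam δ y|) * (‖f y‖ * ‖w1 y‖)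
            + (δ * |mm V lam δ y|) * (‖f1 y‖ * ‖w1 y‖) := by ring
        _ ≤ (M * Real.sqrt (rr V lam δ y)) * (‖f y‖ * ‖w1 y‖) + 1 * (‖f1 y‖ * ‖w1 y‖) := by
            gcongr
        _ = _ := by ring
  have e3 : ‖J (fun y => (mm V lam δ y : ℂ) * (f y * w y))‖ ≤ A * n2 w := by
    refine (norm_J_le_of (g := fun y => Real.sqrt (rr V lam δ y) * (‖f y‖ * ‖w y‖))
      (by fun_prop) (by fun_prop) ?_).trans (cs_rr hS hδ c3 c5)
    intro y _
    rw [norm_mul, norm_mul, Complex.norm_real, Real.norm_eq_abs]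
    have := mm_le_sqrt (V := V) (lam := lam) hδ y
    gcongr
  have e4 : ‖Complex.I * σ * δ ^ 3 * a ^ 2 + Complex.I * o‖ ≤ (M ^ 2 + 1) * δ := by
    refine (norm_add_le _ _).trans ?_
    have h1 : ‖Complex.I * (σ:ℂ) * (δ:ℂ) ^ 3 * (a:ℂ) ^ 2‖ = (a * δ) ^ 2 * δ := by
      simp only [norm_mul, norm_pow, Complex.norm_I, Complex.norm_real, Real.norm_eq_abs, hL.hσ,
        abs_of_pos hδ, abs_of_pos (lt_of_lt_of_le one_pos hL.ha)]
      ring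
    have h2 : ‖Complex.I * o‖ ≤ δ := by
      rw [norm_mul, Complex.norm_I, one_mul]
      exact hL.ho.trans (by nlinarith [hL.hε1])
    rw [h1]
    have h3 : 0 ≤ a * δ := mul_nonneg (by linarith [hL.ha]) hδ.le
    have h4 : (a * δ) ^ 2 ≤ M ^ 2 := by gcongr; exact hL.hκ
    nlinarith
  have e5 : ‖Complex.I * (σ:ℂ) * (δ:ℂ) ^ 3‖ = δ ^ 3 := by
    simp only [norm_mul, norm_pow, Complex.norm_I, Complex.norm_real, Real.norm_eq_abs, hL.hσ,
        abs_of_pos hδ]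
    ring
  set Q1 := J (fun y => ((δ ^ 2 * rr V lam δ y : ℝ) : ℂ) * (w y * f y))
  set Q2 := J (fun y => (mm1 V V1 lam δ y : ℂ) * (f y * w1 y) + (mm V lam δ y : ℂ) * (f1 y * w1 y))
  set Q3 := J (fun y => (mm V lam δ y : ℂ) * (f y * w y))
  set Q0 := J (fun y => (mm V lam δ y : ℂ) * (f y * H y))
  have e6 : ‖Q0 + Q1 + Complex.I * σ * δ ^ 3 * Q2
      + (Complex.I * σ * δ ^ 3 * a ^ 2 + Complex.I * o) * Q3 - Q0‖ ≤
      ‖Q1‖ + δ ^ 3 * ‖Q2‖ + (M ^ 2 + 1) * δ * ‖Q3‖ := by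
    have : Q0 + Q1 + Complex.I * σ * δ ^ 3 * Q2
      + (Complex.I * σ * δ ^ 3 * a ^ 2 + Complex.I * o) * Q3 - Q0 =
      Q1 + Complex.I * σ * δ ^ 3 * Q2
      + (Complex.I * σ * δ ^ 3 * a ^ 2 + Complex.I * o) * Q3 := by ring
    rw [this]
    refine (norm_add₃_le).trans ?_
    rw [norm_mul (Complex.I * (σ:ℂ) * (δ:ℂ) ^ 3), e5, norm_mul _ Q3]
    gcongr
  refine e6.trans ?_
  have e7 : δ ^ 3 * ‖Q2‖ ≤ δ ^ 2 * (M * (A * n2 w1) + n2 f1 * n2 w1) := by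
    calc δ ^ 3 * ‖Q2‖ = δ ^ 2 * (‖Q2‖ * δ) := by ring
      _ ≤ _ := by gcongr
  have e8 : (M ^ 2 + 1) * δ * ‖Q3‖ ≤ (M ^ 2 + 1) * δ * (A * n2 w) := by gcongr
  have hM2 : 0 ≤ M ^ 2 := sq_nonneg M
  have p1 : 0 ≤ δ * (A * n2 w) := by positivity
  have p2 : 0 ≤ δ * (n2 f1 * n2 w) := by positivity
  have p3 : 0 ≤ δ ^ 2 * (A * n2 w1) := by positivity
  have p4 : 0 ≤ δ ^ 2 * (n2 f1 * n2 w1) := by positivity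
  have : (2 + M + M ^ 2) * δ * ((n2 w + δ * n2 w1) * (A + n2 f1)) =
    (2 + M + M ^ 2) * (δ * (A * n2 w) + δ * (n2 f1 * n2 w) + δ ^ 2 * (A * n2 w1)
      + δ ^ 2 * (n2 f1 * n2 w1)) := by ring
  rw [this]
  nlinarith [mul_nonneg hM2 p1, mul_nonneg hM2 p2, mul_nonneg hM2 p3, mul_nonneg hM2 p4,
    mul_nonneg (by linarith : (0:ℝ) ≤ M) p1, mul_nonneg (by linarith : (0:ℝ) ≤ M) p2,
    mul_nonneg (by linarith : (0:ℝ) ≤ M) p3, mul_nonneg (by linarith : (0:ℝ) ≤ M) p4]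

end weak

end OSP

namespace OSP

section mult
variable {V V1 V2 V3 : ℝ → ℝ} {c₀ M lam δ a σ ε : ℝ} {o : ℂ} {w w1 w2 H H1 : ℝ → ℂ}

lemma mul_conj_norm (z : ℂ) : z * (starRingEnd ℂ) z = ((‖z‖ ^ 2 : ℝ) : ℂ) := by
  rw [Complex.mul_conj, Complex.normSq_eq_norm_sq]

/-- Energy identity with a real multiplier. -/
lemma mult_id (_hVc : Continuous V) (hL : Loc M V lam δ a σ ε o w w1 w2 H H1) {t t1 : ℝ → ℝ}
    (ht : D1 t t1) :
    ((J (fun y => t y * ((V y - lam) * ‖w y‖ ^ 2)) : ℝ) : ℂ) =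
      J (fun y => (t y : ℂ) * (H y * (starRingEnd ℂ) (w y)))
      + Complex.I * σ * δ ^ 3 * (((J (fun y => t y * ‖w1 y‖ ^ 2) : ℝ) : ℂ)
        + J (fun y => (t1 y : ℂ) * (w1 y * (starRingEnd ℂ) (w y)))
        + a ^ 2 * ((J (fun y => t y * ‖w y‖ ^ 2) : ℝ) : ℂ))
      + Complex.I * o * ((J (fun y => t y * ‖w y‖ ^ 2) : ℝ) : ℂ) := by
  have c5 := hL.dw.c
  have c6 := hL.dw.c'
  have c7 := hL.dw1.c'
  have c8 := hL.dH.c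
  have c1 := ht.c
  have c2 := ht.c'
  have c3 : Continuous fun y => (starRingEnd ℂ) (w y) := Complex.continuous_conj.comp c5
  have c4 : Continuous fun y => (starRingEnd ℂ) (w1 y) := Complex.continuous_conj.comp c6
  have hP := ((ht.ofReal.mul hL.dw1).mul hL.dw.conj).ftc
  simp only [hL.w0, hL.w1, map_zero, mul_zero, sub_zero] at hP
  have hP2 : J (fun y => ((t y * ‖w1 y‖ ^ 2 : ℝ) : ℂ))
      + J (fun y => (t1 y : ℂ) * (w1 y * (starRingEnd ℂ) (w y)))
      + J (fun y => (t y : ℂ) * (w2 y * (starRingEnd ℂ) (w y))) = 0 := by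
    rw [← hP, ← J_add (by fun_prop) (by fun_prop), ← J_add (by fun_prop) (by fun_prop)]
    apply J_congr
    intro y _
    have := mul_conj_norm (w1 y)
    push_cast at this ⊢
    linear_combination (-(t y : ℂ)) * this
  rw [← J_ofReal, ← J_ofReal, ← J_ofReal]
  have hs : J (fun y => ((t y * ((V y - lam) * ‖w y‖ ^ 2) : ℝ) : ℂ)) =
      J (fun y => (t y : ℂ) * (H y * (starRingEnd ℂ) (w y)))
      + (-(Complex.I * σ * δ ^ 3)) * J (fun y => (t y : ℂ) * (w2 y * (starRingEnd ℂ) (w y)))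
      + (Complex.I * σ * δ ^ 3 * a ^ 2 + Complex.I * o) * J (fun y => ((t y * ‖w y‖ ^ 2 : ℝ) : ℂ)) := by
    rw [← J_cmulC, ← J_cmulC, ← J_add (by fun_prop) (by fun_prop), ← J_add (by fun_prop) (by fun_prop)]
    apply J_congr
    intro y _
    have h1 := hL.eq y
    have := mul_conj_norm (w y)
    push_cast at this h1 ⊢
    rw [← this]
    linear_combination (t y : ℂ) * (starRingEnd ℂ) (w y) * h1
  rw [hs]
  linear_combination (-(Complex.I * σ * δ ^ 3)) * hP2

lemma mult_im (hVc : Continuous V) (hL : Loc M V lam δ a σ ε o w w1 w2 H H1) {t t1 : ℝ → ℝ}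
    (ht : D1 t t1) :
    (J (fun y => (t y : ℂ) * (H y * (starRingEnd ℂ) (w y)))).im
      + σ * δ ^ 3 * (J (fun y => t y * ‖w1 y‖ ^ 2)
        + (J (fun y => (t1 y : ℂ) * (w1 y * (starRingEnd ℂ) (w y)))).re
        + a ^ 2 * J (fun y => t y * ‖w y‖ ^ 2))
      + o.re * J (fun y => t y * ‖w y‖ ^ 2) = 0 := by
  have h := congrArg Complex.im (mult_id hVc hL ht)
  simp only [← Complex.ofReal_pow, Complex.add_im, Complex.mul_im, Complex.mul_re, Complex.I_re,
    Complex.I_im, Complex.ofReal_re, Complex.ofReal_im, Complex.add_re] at h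
  ring_nf at h ⊢
  linarith

lemma mult_re (hVc : Continuous V) (hL : Loc M V lam δ a σ ε o w w1 w2 H H1) {t t1 : ℝ → ℝ}
    (ht : D1 t t1) :
    J (fun y => t y * ((V y - lam) * ‖w y‖ ^ 2)) =
      (J (fun y => (t y : ℂ) * (H y * (starRingEnd ℂ) (w y)))).re
      - σ * δ ^ 3 * (J (fun y => (t1 y : ℂ) * (w1 y * (starRingEnd ℂ) (w y)))).im
      - o.im * J (fun y => t y * ‖w y‖ ^ 2) := by
  have h := congrArg Complex.re (mult_id hVc hL ht)
  simp only [← Complex.ofReal_pow, Complex.add_im, Complex.mul_im, Complex.mul_re, Complex.I_re,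
    Complex.I_im, Complex.ofReal_re, Complex.ofReal_im, Complex.add_re] at h
  linear_combination h

/-- The `H¹_a` norm. -/
def nH (a : ℝ) (H H1 : ℝ → ℂ) : ℝ := Real.sqrt (n2 H1 ^ 2 + a ^ 2 * n2 H ^ 2)

lemma nH_nonneg (a : ℝ) (H H1 : ℝ → ℂ) : 0 ≤ nH a H H1 := Real.sqrt_nonneg _

lemma nH_sq (a : ℝ) (H H1 : ℝ → ℂ) : nH a H H1 ^ 2 = n2 H1 ^ 2 + a ^ 2 * n2 H ^ 2 :=
  Real.sq_sqrt (by positivity)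

lemma n2_le_nH (a : ℝ) (H H1 : ℝ → ℂ) : n2 H1 ≤ nH a H H1 :=
  le_sq (by rw [nH_sq]; nlinarith [sq_nonneg (a * n2 H)]) (nH_nonneg _ _ _)

lemma an2_le_nH {a : ℝ} (H H1 : ℝ → ℂ) : a * n2 H ≤ nH a H H1 :=
  le_sq (by rw [nH_sq]; nlinarith [sq_nonneg (n2 H1)]) (nH_nonneg _ _ _)

lemma sup_nH {a : ℝ} (ha : 1 ≤ a) {H H1 : ℝ → ℂ} (hH : D1 H H1) {q : ℝ} (hq : q ∈ Icc (0:ℝ) 1) :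
    ‖H q‖ ≤ 2 * (nH a H H1 / Real.sqrt a) := by
  have h0 := nH_nonneg a H H1
  have h1 := n2_le_nH a H H1
  have h2 := an2_le_nH (a := a) H H1
  have h3 := hH.sup hq
  have h4 := n2_nonneg H
  have h5 := n2_nonneg H1
  refine le_sq ?_ (by positivity)
  rw [mul_pow, div_pow, Real.sq_sqrt (by linarith), ← mul_div_assoc, le_div_iff₀ (by linarith)]
  have h6 : n2 H ≤ nH a H H1 := by nlinarith
  have h7 : (a * n2 H) * n2 H ≤ nH a H H1 * nH a H H1 := mul_le_mul h2 h6 h4 h0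
  have h8 : (a * n2 H) * n2 H1 ≤ nH a H H1 * nH a H H1 := mul_le_mul h2 h1 h5 h0
  nlinarith

end mult

/-- `1/(δ²+y²(1-y)²)` bound. -/
lemma J_bump {δ : ℝ} (hδ : 0 < δ) :
    J (rr (fun y => y * (1 - y)) 0 δ) ≤ 4 * Real.pi / δ := by
  have hD : ∀ x₀ : ℝ, J (fun y => ((y - x₀) ^ 2 + δ ^ 2)⁻¹) =
      (Real.arctan ((1 - x₀) / δ) - Real.arctan ((0 - x₀) / δ)) / δ := by
    intro x₀
    have hd : ∀ y : ℝ, (y - x₀) ^ 2 + δ ^ 2 ≠ 0 := fun y => by positivity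
    have h : D1 (fun y => Real.arctan ((y - x₀) / δ)) (fun y => δ * ((y - x₀) ^ 2 + δ ^ 2)⁻¹) := by
      refine ⟨by fun_prop, by fun_prop (disch := exact hd), ?_⟩
      intro x hx
      have h1 := (((hasDerivAt_id x).sub_const x₀).div_const δ).arctan
      refine h1.congr_deriv ?_
      have := hd x
      simp only [id]
      field_simp
      ring
    have h2 := h.ftc
    rw [J_cmul] at h2
    rw [← h2]
    field_simp
  have hc : ∀ x₀ : ℝ, Continuous (fun y : ℝ => ((y - x₀) ^ 2 + δ ^ 2)⁻¹) := by
    intro x₀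
    have hd : ∀ y : ℝ, (y - x₀) ^ 2 + δ ^ 2 ≠ 0 := fun y => by positivity
    fun_prop (disch := exact hd)
  have hcr : Continuous (rr (fun y => y * (1 - y)) 0 δ) := by
    unfold rr
    have hd : ∀ y : ℝ, (y * (1 - y) - 0) ^ 2 + δ ^ 2 ≠ 0 := fun y => by positivity
    fun_prop (disch := exact hd)
  have c0 := hc 0
  have c1 := hc 1
  have h1 : J (rr (fun y => y * (1 - y)) 0 δ) ≤
      J (fun y => 4 * ((y - 0) ^ 2 + δ ^ 2)⁻¹ + 4 * ((y - 1) ^ 2 + δ ^ 2)⁻¹) := by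
    refine J_mono hcr (by fun_prop) fun y hy => ?_
    have p0 : 0 < ((y - 0) ^ 2 + δ ^ 2)⁻¹ := by positivity
    have p1 : 0 < ((y - 1) ^ 2 + δ ^ 2)⁻¹ := by positivity
    have hy0 := hy.1
    have hy1 := hy.2
    rcases le_total y (1 / 2) with h | h
    · have : rr (fun y => y * (1 - y)) 0 δ y ≤ 4 * ((y - 0) ^ 2 + δ ^ 2)⁻¹ := by
        have hh : ((y - 0) ^ 2 + δ ^ 2) / 4 ≤ (y * (1 - y) - 0) ^ 2 + δ ^ 2 := by
          have : y / 2 ≤ y * (1 - y) := by nlinarith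
          nlinarith
        have := inv_anti₀ (by positivity) hh
        rw [inv_div, div_eq_mul_inv] at this
        exact this
      linarith
    · have : rr (fun y => y * (1 - y)) 0 δ y ≤ 4 * ((y - 1) ^ 2 + δ ^ 2)⁻¹ := by
        have hh : ((y - 1) ^ 2 + δ ^ 2) / 4 ≤ (y * (1 - y) - 0) ^ 2 + δ ^ 2 := by
          have : (1 - y) / 2 ≤ y * (1 - y) := by nlinarith
          nlinarith
        have := inv_anti₀ (by positivity) hh
        rw [inv_div, div_eq_mul_inv] at this
        exact this
      linarith
  rw [J_add (by fun_prop) (by fun_prop), J_cmul, J_cmul, hD, hD] at h1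
  refine h1.trans ?_
  rw [← mul_div_assoc, ← mul_div_assoc, ← add_div]
  have a1 := Real.arctan_lt_pi_div_two ((1 - 0) / δ)
  have a3 := Real.neg_pi_div_two_lt_arctan ((0 - 1) / δ)
  simp only [sub_self, zero_div, Real.arctan_zero]
  gcongr
  linarith

/-- Cutoff near the boundary. -/
def zc (δ : ℝ) (y : ℝ) : ℝ := 1 - δ ^ 2 * rr (fun y => y * (1 - y)) 0 δ y

/-- Derivative of the cutoff. -/
def zc1 (δ : ℝ) (y : ℝ) : ℝ :=
  δ ^ 2 * (2 * (y * (1 - y)) * (1 - 2 * y) * rr (fun y => y * (1 - y)) 0 δ y ^ 2)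

lemma zc_D1 {δ : ℝ} (hδ : 0 < δ) : D1 (zc δ) (zc1 δ) := by
  have hp : D1 (fun y : ℝ => y * (1 - y)) (fun y => 1 - 2 * y) :=
    (D1.id.mul ((D1.const (1:ℝ)).sub D1.id)).congr (fun y => rfl) (fun y => by ring)
  have h := (hp.mul hp).add (D1.const (δ ^ 2))
  have hd : ∀ y : ℝ, y * (1 - y) * (y * (1 - y)) + δ ^ 2 ≠ 0 := fun y => by
    have := mul_self_nonneg (y * (1 - y))
    positivity
  refine ((D1.const (1:ℝ)).sub ((D1.const (δ ^ 2)).mul (h.inv hd))).congr ?_ ?_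
  · intro y
    unfold zc rr
    ring_nf
  · intro y
    unfold zc1 rr
    rw [inv_pow, div_eq_mul_inv]
    ring_nf

lemma zc_0 {δ : ℝ} (hδ : 0 < δ) : zc δ 0 = 0 := by
  unfold zc rr
  have : δ ≠ 0 := hδ.ne'
  simp [this]

lemma zc_1 {δ : ℝ} (hδ : 0 < δ) : zc δ 1 = 0 := by
  unfold zc rr
  have : δ ≠ 0 := hδ.ne'
  simp [this]

lemma zc_abs {δ : ℝ} (hδ : 0 < δ) (y : ℝ) : |zc δ y| ≤ 1 := by
  have h1 := rr_le (V := fun y => y * (1 - y)) (lam := 0) hδ y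
  have h2 := rr_pos (V := fun y => y * (1 - y)) (lam := 0) hδ y
  have h3 : 0 ≤ δ ^ 2 * rr (fun y => y * (1 - y)) 0 δ y := by positivity
  unfold zc
  rw [abs_le]
  constructor <;> linarith

lemma n2_one_sub_zc {δ : ℝ} (hδ : 0 < δ) : n2 (fun y => 1 - zc δ y) ≤ 4 * Real.sqrt δ := by
  have hz := (zc_D1 hδ).c
  have hcr : Continuous (rr (fun y => y * (1 - y)) 0 δ) := by
    unfold rr
    have hd : ∀ y : ℝ, (y * (1 - y) - 0) ^ 2 + δ ^ 2 ≠ 0 := fun y => by positivity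
    fun_prop (disch := exact hd)
  refine le_sq ?_ (by positivity)
  rw [n2_sq, mul_pow, Real.sq_sqrt hδ.le]
  have h1 : J (fun y => ‖1 - zc δ y‖ ^ 2) ≤ J (fun y => δ ^ 2 * rr (fun y => y * (1 - y)) 0 δ y) := by
    refine J_mono (by fun_prop) (by fun_prop) fun y _ => ?_
    have h1 := rr_le (V := fun y => y * (1 - y)) (lam := 0) hδ y
    have h2 := rr_pos (V := fun y => y * (1 - y)) (lam := 0) hδ y
    have h3 : 0 ≤ δ ^ 2 * rr (fun y => y * (1 - y)) 0 δ y := by positivity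
    unfold zc
    rw [Real.norm_eq_abs, sq_abs]
    nlinarith
  rw [J_cmul] at h1
  have h2 := J_bump hδ
  rw [le_div_iff₀ hδ] at h2
  have := Real.pi_le_four
  nlinarith

lemma n2_zc1 {δ : ℝ} (hδ : 0 < δ) : n2 (zc1 δ) ≤ 4 / Real.sqrt δ := by
  have hz := (zc_D1 hδ).c'
  have hcr : Continuous (rr (fun y => y * (1 - y)) 0 δ) := by
    unfold rr
    have hd : ∀ y : ℝ, (y * (1 - y) - 0) ^ 2 + δ ^ 2 ≠ 0 := fun y => by positivity
    fun_prop (disch := exact hd)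
  refine le_sq ?_ (by positivity)
  rw [n2_sq, div_pow, Real.sq_sqrt hδ.le, le_div_iff₀ hδ]
  have h1 : J (fun y => ‖zc1 δ y‖ ^ 2) ≤ J (rr (fun y => y * (1 - y)) 0 δ) := by
    refine J_mono (by fun_prop) (by fun_prop) fun y hy => ?_
    have h1 := rr_mul (V := fun y => y * (1 - y)) (lam := 0) hδ y
    have h2 := rr_pos (V := fun y => y * (1 - y)) (lam := 0) hδ y
    simp only [sub_zero] at h1
    unfold zc1
    rw [Real.norm_eq_abs, sq_abs]
    set r := rr (fun y => y * (1 - y)) 0 δ y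
    set p := y * (1 - y)
    have h3 : δ ^ 2 * r ≤ 1 := by nlinarith [mul_nonneg (sq_nonneg p) h2.le]
    have h4 : (2 * δ * p * r) ^ 2 ≤ 1 := by
      have h5 : (2 * δ * p * r) ≤ 1 := by nlinarith [mul_nonneg (sq_nonneg (p - δ)) h2.le]
      have h6 : -1 ≤ (2 * δ * p * r) := by nlinarith [mul_nonneg (sq_nonneg (p + δ)) h2.le]
      nlinarith
    have h5 : (1 - 2 * y) ^ 2 ≤ 1 := by nlinarith [hy.1, hy.2]
    calc (δ ^ 2 * (2 * p * (1 - 2 * y) * r ^ 2)) ^ 2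
        = (δ ^ 2 * r) * (2 * δ * p * r) ^ 2 * (1 - 2 * y) ^ 2 * r := by ring
      _ ≤ 1 * 1 * 1 * r := by gcongr
      _ = r := by ring
  have h2 := J_bump hδ
  rw [le_div_iff₀ hδ] at h2
  have := Real.pi_le_four
  nlinarith

end OSP

namespace OSP

section loc
variable {V V1 V2 V3 : ℝ → ℝ} {c₀ M lam δ a σ ε : ℝ} {o : ℂ} {w w1 w2 H H1 : ℝ → ℂ}

lemma L1 (hVc : Continuous V) (hL : Loc M V lam δ a σ ε o w w1 w2 H H1) :
    δ ^ 3 * n2 w1 ^ 2 ≤ |(J (fun y => H y * (starRingEnd ℂ) (w y))).im| + ε * δ * n2 w ^ 2 := by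
  have h := mult_im hVc hL (D1.const (1:ℝ))
  have e1 : J (fun y => ((1:ℝ) : ℂ) * (H y * (starRingEnd ℂ) (w y))) =
      J (fun y => H y * (starRingEnd ℂ) (w y)) := J_congr fun y _ => by simp
  have e2 : J (fun y => ((0:ℝ) : ℂ) * (w1 y * (starRingEnd ℂ) (w y))) = 0 := by simp [J]
  rw [e1, e2] at h
  simp only [one_mul, ← n2_sq, Complex.zero_re, add_zero] at h
  set Q := (J (fun y => H y * (starRingEnd ℂ) (w y))).im
  have hd := hL.hδ
  have h1 : δ ^ 3 * (n2 w1 ^ 2 + a ^ 2 * n2 w ^ 2) = |σ * δ ^ 3 * (n2 w1 ^ 2 + a ^ 2 * n2 w ^ 2)| := by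
    rw [mul_assoc, abs_mul, hL.hσ, one_mul, abs_of_nonneg (by positivity)]
  have h2 : σ * δ ^ 3 * (n2 w1 ^ 2 + a ^ 2 * n2 w ^ 2) = -(Q + o.re * n2 w ^ 2) := by linarith
  rw [h2, abs_neg] at h1
  have h3 : |o.re * n2 w ^ 2| ≤ ε * δ * n2 w ^ 2 := by
    rw [abs_mul, abs_of_nonneg (sq_nonneg (n2 w))]
    exact mul_le_mul_of_nonneg_right ((Complex.abs_re_le_norm o).trans hL.ho) (sq_nonneg _)
  have h4 := abs_add_le Q (o.re * n2 w ^ 2)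
  have h5 : 0 ≤ δ ^ 3 * (a ^ 2 * n2 w ^ 2) := by positivity
  nlinarith

lemma L2l (hS : Shear c₀ M V V1 V2 V3) (hL : Loc M V lam δ a σ ε o w w1 w2 H H1)
    (hε : ε ≤ 1 / 2) {h : ℝ} (hh : 0 ≤ h) (hH : ∀ y ∈ Icc (0:ℝ) 1, ‖H y‖ ≤ h) :
    n2 w ≤ 2 * (h * Real.sqrt (Real.pi / (c₀ * δ)) + (2 * Real.pi / c₀ + M) * (δ * n2 w1)) := by
  have hδ := hL.hδ
  have hc0 := hS.c0
  have hm := (D1_mm (lam := lam) hS hL.hδ)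
  have hr := (D1_rr (lam := lam) hS hL.hδ).c
  have c1 := hm.c
  have c2 := hm.c'
  have c1C := hm.ofReal.c
  have c2C := hm.ofReal.c'
  have c5 := hL.dw.c
  have c6 := hL.dw.c'
  have c8 := hL.dH.c
  have c3 : Continuous fun y => (starRingEnd ℂ) (w y) := Complex.continuous_conj.comp c5
  have c4 : Continuous fun y => (starRingEnd ℂ) (w1 y) := Complex.continuous_conj.comp c6
  have hX := n2_nonneg w
  have hY := n2_nonneg w1
  have hM := hS.M1
  have hpi := Real.pi_pos
  have key := weak_id hS hL hL.dw.conj (by simp [hL.w0]) (by simp [hL.w1])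
  have e0 : J (fun y => w y * (starRingEnd ℂ) (w y)) = ((n2 w ^ 2 : ℝ) : ℂ) := by
    rw [n2_sq, ← J_ofReal]
    exact J_congr fun y _ => mul_conj_norm _
  have e3 : J (fun y => (mm1 V V1 lam δ y : ℂ) * ((starRingEnd ℂ) (w y) * w1 y)
          + (mm V lam δ y : ℂ) * ((starRingEnd ℂ) (w1 y) * w1 y)) =
      J (fun y => (mm1 V V1 lam δ y : ℂ) * ((starRingEnd ℂ) (w y) * w1 y))
      + ((J (fun y => mm V lam δ y * ‖w1 y‖ ^ 2) : ℝ) : ℂ) := by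
    rw [J_add (by fun_prop) (by fun_prop), ← J_ofReal]
    congr 1
    apply J_congr
    intro y _
    have := mul_conj_norm (w1 y)
    push_cast at this ⊢
    rw [← this]
    ring
  have e4 : J (fun y => (mm V lam δ y : ℂ) * ((starRingEnd ℂ) (w y) * w y)) =
      ((J (fun y => mm V lam δ y * ‖w y‖ ^ 2) : ℝ) : ℂ) := by
    rw [← J_ofReal]
    apply J_congr
    intro y _
    have := mul_conj_norm (w y)
    push_cast at this ⊢
    rw [← this]
    ring
  rw [e0, e3, e4] at key
  set Q1 := J (fun y => (mm V lam δ y : ℂ) * ((starRingEnd ℂ) (w y) * H y)) with hQ1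
  set Q2 := J (fun y => ((δ ^ 2 * rr V lam δ y : ℝ) : ℂ) * (w y * (starRingEnd ℂ) (w y))) with hQ2
  set Q3 := J (fun y => (mm1 V V1 lam δ y : ℂ) * ((starRingEnd ℂ) (w y) * w1 y)) with hQ3
  set Q4 := J (fun y => mm V lam δ y * ‖w y‖ ^ 2) with hQ4
  have hre := congrArg Complex.re key
  simp only [← Complex.ofReal_pow, Complex.add_im, Complex.mul_im, Complex.mul_re, Complex.I_re,
    Complex.I_im, Complex.ofReal_re, Complex.ofReal_im, Complex.add_re] at hre
  have hre2 : n2 w ^ 2 = Q1.re + Q2.re - σ * δ ^ 3 * Q3.im - o.im * Q4 := by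
    linear_combination hre
  set s := Real.sqrt (Real.pi / (c₀ * δ)) with hs
  have b1 : Q1.re ≤ h * (s * n2 w) := by
    refine (Complex.re_le_norm _).trans ?_
    have h1 : ‖Q1‖ ≤ J (fun y => h * (‖mm V lam δ y‖ * ‖w y‖)) := by
      refine norm_J_le_of (by fun_prop) (by fun_prop) fun y hy => ?_
      rw [norm_mul, norm_mul, RCLike.norm_conj, Complex.norm_real]
      have := hH y hy
      calc ‖mm V lam δ y‖ * (‖w y‖ * ‖H y‖) ≤ ‖mm V lam δ y‖ * (‖w y‖ * h) := by gcongr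
        _ = _ := by ring
    rw [J_cmul] at h1
    refine h1.trans (mul_le_mul_of_nonneg_left ((cs c1 c5).trans ?_) hh)
    exact mul_le_mul_of_nonneg_right (Real.le_sqrt_of_sq_le (n2_mm hS hδ)) hX
  have b2 : Q2.re ≤ (2 * Real.pi / c₀) * (δ * n2 w1) * n2 w := by
    refine (Complex.re_le_norm _).trans ?_
    have h1 : ‖Q2‖ ≤ J (fun y => (δ ^ 2 * (2 * (n2 w * n2 w1))) * rr V lam δ y) := by
      refine norm_J_le_of (by fun_prop) (by fun_prop) fun y hy => ?_
      have hp := rr_pos (V := V) (lam := lam) hδ y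
      rw [norm_mul, norm_mul, RCLike.norm_conj, Complex.norm_real, Real.norm_eq_abs,
        abs_of_nonneg (by positivity)]
      have := hL.dw.sup0 hL.w0 hy
      calc δ ^ 2 * rr V lam δ y * (‖w y‖ * ‖w y‖) = δ ^ 2 * rr V lam δ y * ‖w y‖ ^ 2 := by ring
        _ ≤ δ ^ 2 * rr V lam δ y * (2 * (n2 w * n2 w1)) := by gcongr
        _ = _ := by ring
    rw [J_cmul] at h1
    refine h1.trans ((mul_le_mul_of_nonneg_left (J_rr hS hδ) (by positivity)).trans (le_of_eq ?_))
    field_simp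
  have b3 : -(σ * δ ^ 3 * Q3.im) ≤ M * (δ * n2 w1) * n2 w := by
    have h0 : |Q3.im| * δ ^ 2 ≤ M * (n2 w * n2 w1) := by
      have h1 : ‖((δ ^ 2 : ℝ) : ℂ) * Q3‖ ≤ J (fun y => M * (‖w y‖ * ‖w1 y‖)) := by
        rw [hQ3, ← J_cmulC]
        refine norm_J_le_of (by fun_prop) (by fun_prop) fun y hy => ?_
        have h1 := mm1_le (lam := lam) hS hδ y
        have h2 := rr_le (V := V) (lam := lam) hδ y
        rw [norm_mul, norm_mul, norm_mul, RCLike.norm_conj, Complex.norm_real, Complex.norm_real,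
          Real.norm_eq_abs, Real.norm_eq_abs, abs_of_nonneg (sq_nonneg δ)]
        have h3 : δ ^ 2 * |mm1 V V1 lam δ y| ≤ M := by nlinarith [sq_nonneg δ]
        rw [← mul_assoc]
        gcongr
      rw [norm_mul, Complex.norm_real, Real.norm_eq_abs, abs_of_nonneg (sq_nonneg δ), J_cmul] at h1
      have h2 := Complex.abs_im_le_norm Q3
      have h3 := cs c5 c6
      nlinarith [sq_nonneg δ]
    have h1 : -(σ * δ ^ 3 * Q3.im) ≤ |Q3.im| * δ ^ 2 * δ := by
      refine (neg_le_abs _).trans (le_of_eq ?_)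
      rw [abs_mul, abs_mul, hL.hσ, abs_of_pos (by positivity)]
      ring
    nlinarith
  have b4 : -(o.im * Q4) ≤ ε * n2 w ^ 2 := by
    have h0 : |Q4| * δ ≤ n2 w ^ 2 := by
      have h1 : ‖δ * Q4‖ ≤ J (fun y => ‖w y‖ ^ 2) := by
        rw [hQ4, ← J_cmul]
        refine norm_J_le_of (by fun_prop) (by fun_prop) fun y hy => ?_
        have h1 := mm_le (V := V) (lam := lam) hδ y
        rw [← mul_assoc, norm_mul, norm_mul, Real.norm_eq_abs, Real.norm_eq_abs, abs_of_pos hδ,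
          norm_pow, norm_norm]
        nlinarith [sq_nonneg ‖w y‖]
      rw [norm_mul, Real.norm_eq_abs, Real.norm_eq_abs, abs_of_pos hδ, ← n2_sq] at h1
      linarith
    have h1 := (Complex.abs_im_le_norm o).trans hL.ho
    have h2 : -(o.im * Q4) ≤ |o.im| * |Q4| := by rw [← abs_mul]; exact neg_le_abs _
    have h3 : |o.im| * |Q4| ≤ (ε * δ) * |Q4| := by gcongr
    have := hL.hε0
    nlinarith
  have hfin : n2 w * n2 w ≤
      n2 w * (2 * (h * s + (2 * Real.pi / c₀ + M) * (δ * n2 w1))) := by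
    nlinarith [sq_nonneg (n2 w)]
  rcases hX.eq_or_lt with h0 | h0
  · rw [← h0]
    have hs0 : 0 ≤ s := Real.sqrt_nonneg _
    positivity
  · exact le_of_mul_le_mul_left hfin h0

lemma L3 (hS : Shear c₀ M V V1 V2 V3) (hL : Loc M V lam δ a σ ε o w w1 w2 H H1)
    {h : ℝ} (hh : 0 ≤ h) (hH : ∀ y ∈ Icc (0:ℝ) 1, ‖H y‖ ≤ h) :
    |(J (fun y => H y * (starRingEnd ℂ) (w y))).im| ≤ h * (4 * Real.sqrt δ) * n2 w
      + (2 + M + M ^ 2) * δ * ((n2 w + δ * n2 w1) *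
        (h * Real.sqrt (Real.pi / (c₀ * δ)) + (n2 H1 + h * (4 / Real.sqrt δ)))) := by
  have hδ := hL.hδ
  have hz := zc_D1 hδ
  have hc0 := hS.c0
  have hr := (D1_rr (lam := lam) hS hL.hδ).c
  have hm := (D1_mm (lam := lam) hS hL.hδ)
  have c1 := hm.c
  have c5 := hL.dw.c
  have c6 := hL.dw.c'
  have c8 := hL.dH.c
  have c9 := hL.dH.c'
  have cz := hz.c
  have cz1 := hz.c'
  have c3 : Continuous fun y => (starRingEnd ℂ) (w y) := Complex.continuous_conj.comp c5
  have c4 : Continuous fun y => (starRingEnd ℂ) (H y) := Complex.continuous_conj.comp c8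
  have c10 : Continuous fun y => (starRingEnd ℂ) (H1 y) := Complex.continuous_conj.comp c9
  have hX := n2_nonneg w
  have hY := n2_nonneg w1
  have hM := hS.M1
  have hf := hL.dH.conj.mul hz.ofReal
  have key := weak_est hS hL hf (by simp [zc_0 hδ]) (by simp [zc_1 hδ])
  set f : ℝ → ℂ := fun y => (starRingEnd ℂ) (H y) * ((zc δ y : ℝ) : ℂ) with hfd
  have eA : Real.sqrt (wA V lam δ f) ≤ h * Real.sqrt (Real.pi / (c₀ * δ)) := by
    have h1 : wA V lam δ f ≤ J (fun y => h ^ 2 * rr V lam δ y) := by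
      unfold wA
      have := hf.c
      refine J_mono (by fun_prop) (by fun_prop) fun y hy => ?_
      have hp := rr_pos (V := V) (lam := lam) hδ y
      have h2 : ‖f y‖ ≤ h := by
        rw [hfd]
        simp only [norm_mul, RCLike.norm_conj, Complex.norm_real, Real.norm_eq_abs]
        have := zc_abs hδ y
        have := hH y hy
        calc ‖H y‖ * |zc δ y| ≤ h * 1 := by gcongr
          _ = h := mul_one h
      rw [mul_comm]
      gcongr
    rw [J_cmul] at h1
    rw [show h * Real.sqrt (Real.pi / (c₀ * δ)) = Real.sqrt (h ^ 2 * (Real.pi / (c₀ * δ))) by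
      rw [Real.sqrt_mul (sq_nonneg h), Real.sqrt_sq hh]]
    exact Real.sqrt_le_sqrt (h1.trans (mul_le_mul_of_nonneg_left (J_rr hS hδ) (sq_nonneg h)))
  have eB : n2 (fun y => (starRingEnd ℂ) (H1 y) * ((zc δ y : ℝ) : ℂ)
      + (starRingEnd ℂ) (H y) * ((zc1 δ y : ℝ) : ℂ)) ≤ n2 H1 + h * (4 / Real.sqrt δ) := by
    have h1 := n2_le_add (f := fun y => (starRingEnd ℂ) (H1 y) * ((zc δ y : ℝ) : ℂ)
      + (starRingEnd ℂ) (H y) * ((zc1 δ y : ℝ) : ℂ)) (g := H1) (h := zc1 δ) (by fun_prop) c9 cz1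
      zero_le_one hh ?_
    · refine h1.trans ?_
      have := n2_zc1 hδ
      nlinarith
    · intro y hy
      refine (norm_add_le _ _).trans ?_
      rw [norm_mul, norm_mul, RCLike.norm_conj, RCLike.norm_conj, Complex.norm_real, Complex.norm_real]
      have h2 := zc_abs hδ y
      have h3 := hH y hy
      rw [Real.norm_eq_abs (zc δ y)]
      have h4 : ‖H1 y‖ * |zc δ y| ≤ ‖H1 y‖ * 1 := by gcongr
      have h5 : ‖H y‖ * ‖zc1 δ y‖ ≤ h * ‖zc1 δ y‖ := by gcongr
      linarith
  have hfc := hf.c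
  have r1 : J (fun y => (mm V lam δ y : ℂ) * (f y * H y)) =
      ((J (fun y => mm V lam δ y * (zc δ y * ‖H y‖ ^ 2)) : ℝ) : ℂ) := by
    rw [← J_ofReal]
    apply J_congr
    intro y _
    have := mul_conj_norm (H y)
    push_cast at this ⊢
    rw [← this, hfd]
    ring
  have r2 : J (fun y => H y * (starRingEnd ℂ) (w y)) =
      (starRingEnd ℂ) (J (fun y => w y * f y))
      + J (fun y => ((1 - zc δ y : ℝ) : ℂ) * (H y * (starRingEnd ℂ) (w y))) := by
    have cw : Continuous fun y => (starRingEnd ℂ) (w y * f y) :=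
      Complex.continuous_conj.comp (by fun_prop)
    rw [← J_conj, ← J_add cw (by fun_prop)]
    apply J_congr
    intro y _
    simp only [hfd, map_mul, Complex.conj_conj, Complex.conj_ofReal]
    push_cast
    ring
  have r3 : ‖J (fun y => ((1 - zc δ y : ℝ) : ℂ) * (H y * (starRingEnd ℂ) (w y)))‖
      ≤ h * (4 * Real.sqrt δ) * n2 w := by
    have h1 := norm_J_le_of (f := fun y => ((1 - zc δ y : ℝ) : ℂ) * (H y * (starRingEnd ℂ) (w y)))
      (g := fun y => h * (‖1 - zc δ y‖ * ‖w y‖)) (by fun_prop) (by fun_prop) ?_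
    · rw [J_cmul] at h1
      refine h1.trans ?_
      have h2 := cs (f := fun y => 1 - zc δ y) (g := w) (by fun_prop) c5
      have h3 := n2_one_sub_zc hδ
      calc _ ≤ h * (n2 (fun y => 1 - zc δ y) * n2 w) := by gcongr
        _ ≤ h * ((4 * Real.sqrt δ) * n2 w) := by gcongr
        _ = _ := by ring
    · intro y hy
      rw [norm_mul, norm_mul, RCLike.norm_conj, Complex.norm_real]
      have := hH y hy
      calc ‖1 - zc δ y‖ * (‖H y‖ * ‖w y‖) ≤ ‖1 - zc δ y‖ * (h * ‖w y‖) := by gcongr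
        _ = _ := by ring
  rw [r2, Complex.add_im, Complex.conj_im]
  have r4 : |-(J (fun y => w y * f y)).im| ≤ (2 + M + M ^ 2) * δ * ((n2 w + δ * n2 w1) *
        (h * Real.sqrt (Real.pi / (c₀ * δ)) + (n2 H1 + h * (4 / Real.sqrt δ)))) := by
    rw [abs_neg]
    have h1 := Complex.abs_im_le_norm
      (J (fun y => w y * f y) - J (fun y => (mm V lam δ y : ℂ) * (f y * H y)))
    rw [Complex.sub_im, r1, Complex.ofReal_im, sub_zero, ← r1] at h1
    refine h1.trans (key.trans ?_)
    gcongr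
  refine (abs_add_le _ _).trans ?_
  have := (Complex.abs_im_le_norm _).trans r3
  linarith

lemma L4 (hS : Shear c₀ M V V1 V2 V3) (hL : Loc M V lam δ a σ ε o w w1 w2 H H1) :
    n2 (fun y => (V y - lam) * ‖w y‖) ^ 2 ≤
      n2 H * n2 (fun y => (V y - lam) * ‖w y‖) + M * δ ^ 3 * (n2 w * n2 w1)
      + δ * n2 w * n2 (fun y => (V y - lam) * ‖w y‖) := by
  have hδ := hL.hδ
  have hV := hS.d0.c
  have hV1 := hS.d0.c'
  have c5 := hL.dw.c
  have c6 := hL.dw.c'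
  have c8 := hL.dH.c
  have c3 : Continuous fun y => (starRingEnd ℂ) (w y) := Complex.continuous_conj.comp c5
  set g : ℝ → ℝ := fun y => (V y - lam) * ‖w y‖ with hg
  have hgc : Continuous g := by fun_prop
  have h := mult_re hV hL ((hS.d0.sub (D1.const lam)).congr' (fun y => sub_zero _))
  have e1 : J (fun y => (V y - lam) * ((V y - lam) * ‖w y‖ ^ 2)) = n2 g ^ 2 := by
    rw [n2_sq]
    apply J_congr
    intro y _
    rw [Real.norm_eq_abs, sq_abs, hg]
    ring
  rw [e1] at h
  have b1 : ‖J (fun y => ((V y - lam : ℝ) : ℂ) * (H y * (starRingEnd ℂ) (w y)))‖ ≤ n2 H * n2 g := by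
    refine (norm_J_le_of (g := fun y => ‖H y‖ * ‖g y‖) (by fun_prop) (by fun_prop) ?_).trans (cs c8 hgc)
    intro y _
    rw [norm_mul, norm_mul, RCLike.norm_conj, Complex.norm_real, hg, norm_mul, norm_norm]
    exact le_of_eq (by ring)
  have b2 : ‖J (fun y => (V1 y : ℂ) * (w1 y * (starRingEnd ℂ) (w y)))‖ ≤ M * (n2 w * n2 w1) := by
    have h1 := norm_J_le_of (f := fun y => (V1 y : ℂ) * (w1 y * (starRingEnd ℂ) (w y)))
      (g := fun y => M * (‖w y‖ * ‖w1 y‖)) (by fun_prop) (by fun_prop) ?_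
    · rw [J_cmul] at h1
      exact h1.trans (mul_le_mul_of_nonneg_left (cs c5 c6) (by linarith [hS.M1]))
    · intro y _
      rw [norm_mul, norm_mul, RCLike.norm_conj, Complex.norm_real, Real.norm_eq_abs, mul_comm ‖w1 y‖]
      exact mul_le_mul_of_nonneg_right (hS.b1 y) (by positivity)
  have b3 : |J (fun y => (V y - lam) * ‖w y‖ ^ 2)| ≤ n2 w * n2 g := by
    rw [← Real.norm_eq_abs]
    refine (norm_J_le_of (g := fun y => ‖w y‖ * ‖g y‖) (by fun_prop) (by fun_prop) ?_).trans (cs c5 hgc)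
    intro y _
    rw [hg, norm_mul, norm_mul, norm_norm, norm_pow, norm_norm]
    exact le_of_eq (by ring)
  rw [h]
  have t1 := (Complex.re_le_norm _).trans b1
  have t2 : -(σ * δ ^ 3 * (J (fun y => (V1 y : ℂ) * (w1 y * (starRingEnd ℂ) (w y)))).im) ≤
      M * δ ^ 3 * (n2 w * n2 w1) := by
    refine (neg_le_abs _).trans ?_
    rw [abs_mul, abs_mul, hL.hσ, abs_of_pos (by positivity : 0 < δ ^ 3)]
    have := (Complex.abs_im_le_norm _).trans b2
    calc _ ≤ 1 * δ ^ 3 * (M * (n2 w * n2 w1)) := by gcongr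
      _ = _ := by ring
  have t3 : -(o.im * J (fun y => (V y - lam) * ‖w y‖ ^ 2)) ≤ δ * n2 w * n2 g := by
    refine (neg_le_abs _).trans ?_
    rw [abs_mul]
    have h1 : |o.im| ≤ δ := (Complex.abs_im_le_norm o).trans (hL.ho.trans (by nlinarith [hL.hε1]))
    calc _ ≤ δ * (n2 w * n2 g) := by gcongr
      _ = _ := by ring
  linarith

end loc

end OSP

namespace OSP

lemma alg1 {A B ε X T G : ℝ} (hA : 1 ≤ A) (hB : 0 ≤ B) (hX : 0 ≤ X) (hT : 0 ≤ T) (hG : 0 ≤ G)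
    (hε0 : 0 ≤ ε) (hε : ε * (4 * A ^ 2) ≤ 1) (h1 : X ≤ A * (T + G))
    (h2 : T ^ 2 ≤ B * (X + T) * G + ε * X ^ 2) :
    X + T ≤ (2 * A * (4 * A * B + 3)) * G := by
  have h3 : X ^ 2 ≤ A ^ 2 * (2 * T ^ 2 + 2 * G ^ 2) := by
    have : X ^ 2 ≤ (A * (T + G)) ^ 2 := by gcongr
    nlinarith [sq_nonneg (T - G), sq_nonneg A, mul_nonneg (sq_nonneg A) (sq_nonneg (T - G))]
  have h4 : ε * X ^ 2 ≤ (T ^ 2 + G ^ 2) / 2 := by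
    calc ε * X ^ 2 ≤ ε * (A ^ 2 * (2 * T ^ 2 + 2 * G ^ 2)) := by gcongr
      _ = (ε * (4 * A ^ 2)) * ((T ^ 2 + G ^ 2) / 2) := by ring
      _ ≤ 1 * ((T ^ 2 + G ^ 2) / 2) := by gcongr
      _ = _ := one_mul _
  have h5 : X + T ≤ 2 * A * (T + G) := by nlinarith
  have h6 : B * (X + T) * G ≤ B * (2 * A * (T + G)) * G := by gcongr
  set K := 4 * A * B with hK
  have hK0 : 0 ≤ K := by positivity
  have h7 : T ^ 2 ≤ K * (T * G + G ^ 2) + G ^ 2 := by nlinarith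
  have h8 : T ≤ (K + 2) * G := by
    by_contra hc
    push Not at hc
    have h9 : G ≤ T := by nlinarith [mul_nonneg hK0 hG]
    nlinarith [mul_nonneg hK0 hG, mul_nonneg hT hG, mul_nonneg hK0 (mul_nonneg hT hG)]
  calc X + T ≤ 2 * A * (T + G) := h5
    _ ≤ 2 * A * ((K + 2) * G + G) := by gcongr
    _ = _ := by ring

/-- Local resolvent bound. -/
lemma local_D {c₀ M : ℝ} (hc₀ : 0 < c₀) (hM : 1 ≤ M) : ∃ C ε₁ : ℝ, 0 < C ∧ 0 < ε₁ ∧ ε₁ ≤ 1 / 2 ∧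
    ∀ {V V1 V2 V3 : ℝ → ℝ} {lam δ a σ ε : ℝ} {o : ℂ} {w w1 w2 H H1 : ℝ → ℂ},
    Shear c₀ M V V1 V2 V3 → Loc M V lam δ a σ ε o w w1 w2 H H1 → ε ≤ ε₁ →
    n2 w + δ * n2 w1 ≤ C * (nH a H H1 / (Real.sqrt a * Real.sqrt δ)) := by
  have hpi := Real.pi_pos
  set P := Real.sqrt (Real.pi / c₀) with hP
  have hP0 : 0 ≤ P := Real.sqrt_nonneg _
  set A := 2 * (2 * P + (2 * Real.pi / c₀ + M)) with hA
  have hA1 : 1 ≤ A := by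
    have : 0 ≤ 2 * Real.pi / c₀ := by positivity
    rw [hA]; linarith
  set B := 8 + (2 + M + M ^ 2) * (2 * P + M + 8) with hB
  have hB0 : 0 ≤ B := by positivity
  refine ⟨2 * A * (4 * A * B + 3), min (1 / 2) (1 / (4 * A ^ 2)), by positivity, by positivity,
    min_le_left _ _, ?_⟩
  intro V V1 V2 V3 lam δ a σ ε o w w1 w2 H H1 hS hL hε
  have hδ := hL.hδ
  have ha := hL.ha
  have hε1 : ε ≤ 1 / 2 := hε.trans (min_le_left _ _)
  have hε2 : ε * (4 * A ^ 2) ≤ 1 := by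
    have := hε.trans (min_le_right _ _)
    rwa [le_div_iff₀ (by positivity)] at this
  set N := nH a H H1 with hN
  have hN0 : 0 ≤ N := nH_nonneg _ _ _
  set sa := Real.sqrt a with hsa
  set sd := Real.sqrt δ with hsd
  have hsa1 : 1 ≤ sa := Real.one_le_sqrt.2 ha
  have hsa0 : 0 < sa := by linarith
  have hsd0 : 0 < sd := Real.sqrt_pos.2 hδ
  have hsa2 : sa ^ 2 = a := Real.sq_sqrt (by linarith)
  have hsd2 : sd ^ 2 = δ := Real.sq_sqrt hδ.le
  have hss : sa * sd ≤ M := by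
    have h1 : (sa * sd) ^ 2 ≤ M := by rw [mul_pow, hsa2, hsd2]; exact hL.hκ
    nlinarith [sq_nonneg (sa * sd - 1)]
  have hs : Real.sqrt (Real.pi / (c₀ * δ)) = P / sd := by
    rw [hP, hsd, ← Real.sqrt_div (by positivity), div_div]
  set G := N / (sa * sd) with hG
  have hG0 : 0 ≤ G := by positivity
  set h := 2 * (N / sa) with hh
  have hh0 : 0 ≤ h := by positivity
  have hhG : h = 2 * sd * G := by rw [hh, hG]; field_simp
  have hH : ∀ y ∈ Icc (0:ℝ) 1, ‖H y‖ ≤ h := fun y hy => sup_nH ha hL.dH hy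
  have hX := n2_nonneg w
  have hY := n2_nonneg w1
  have l1 := L1 hS.d0.c hL
  have l2 := L2l hS hL hε1 hh0 hH
  have l3 := L3 hS hL hh0 hH
  set T := δ * n2 w1 with hT
  have hT0 : 0 ≤ T := by positivity
  rw [hs] at l2 l3
  rw [← hsd] at l3
  have e1 : h * (P / sd) = 2 * P * G := by rw [hhG]; field_simp
  rw [e1] at l2 l3
  have hX2 : n2 w ≤ A * (T + G) := by
    refine l2.trans ?_
    have : 0 ≤ 2 * Real.pi / c₀ := by positivity
    rw [hA]
    nlinarith [mul_nonneg hP0 hT0, mul_nonneg this hG0, mul_nonneg (by linarith : 0 ≤ M) hG0]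
  have hN1 : n2 H1 ≤ M * G := by
    have h1 : N = sa * sd * G := by rw [hG]; field_simp
    calc n2 H1 ≤ N := n2_le_nH a H H1
      _ = sa * sd * G := h1
      _ ≤ _ := by gcongr
  have e2 : h * (4 / sd) = 8 * G := by rw [hhG]; field_simp; ring
  rw [e2] at l3
  have e3 : h * (4 * sd) * n2 w = δ * (8 * G * n2 w) := by rw [hhG, ← hsd2]; ring
  rw [e3] at l3
  have hD0 : 0 ≤ n2 w + T := by linarith
  have l4 : |(J (fun y => H y * (starRingEnd ℂ) (w y))).im| ≤ δ * (B * (n2 w + T) * G) := by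
    refine l3.trans ?_
    have h1 : (2 + M + M ^ 2) * δ * ((n2 w + T) * (2 * P * G + (n2 H1 + 8 * G))) ≤
        (2 + M + M ^ 2) * δ * ((n2 w + T) * (2 * P * G + (M * G + 8 * G))) := by
      gcongr
    have h2 : δ * (8 * G * n2 w) ≤ δ * (8 * G * (n2 w + T)) := by
      gcongr
      linarith
    refine (add_le_add h2 h1).trans (le_of_eq ?_)
    rw [hB]
    ring
  have hfin : T ^ 2 ≤ B * (n2 w + T) * G + ε * n2 w ^ 2 := by
    have h1 : δ * T ^ 2 ≤ δ * (B * (n2 w + T) * G + ε * n2 w ^ 2) := by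
      have : δ ^ 3 * n2 w1 ^ 2 = δ * T ^ 2 := by rw [hT]; ring
      linarith
    exact le_of_mul_le_mul_left h1 hδ
  exact alg1 hA1 hB0 hX hT0 hG0 hL.hε0 hε2 hX2 hfin

set_option maxHeartbeats 800000 in
/-- Bound on `(V-λ)w` and on the `L¹` norm. -/
lemma local_Z {c₀ M : ℝ} (hc₀ : 0 < c₀) (hM : 1 ≤ M) : ∃ C ε₁ : ℝ, 0 < C ∧ 0 < ε₁ ∧ ε₁ ≤ 1 / 2 ∧
    ∀ {V V1 V2 V3 : ℝ → ℝ} {lam δ a σ ε : ℝ} {o : ℂ} {w w1 w2 H H1 : ℝ → ℂ},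
    Shear c₀ M V V1 V2 V3 → Loc M V lam δ a σ ε o w w1 w2 H H1 → ε ≤ ε₁ →
    a * n2 (fun y => (V y - lam) * ‖w y‖) ≤ C * nH a H H1 ∧
    J (fun y => ‖w y‖) ≤ C * (nH a H H1 / (Real.sqrt a * Real.sqrt (Real.sqrt (a * δ)))) := by
  obtain ⟨C, ε₁, hC, hε₁, hε₂, hD⟩ := local_D hc₀ hM
  have hpi := Real.pi_pos
  set K := 2 + C * M + M ^ 2 * C with hK
  have hK0 : 0 < K := by positivity
  set P := Real.sqrt (Real.pi / c₀) with hP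
  have hP0 : 0 ≤ P := Real.sqrt_nonneg _
  refine ⟨K + P * (K + C), ε₁, by positivity, hε₁, hε₂, ?_⟩
  intro V V1 V2 V3 lam δ a σ ε o w w1 w2 H H1 hS hL hε
  have hδ := hL.hδ
  have ha := hL.ha
  have hDD := hD hS hL hε
  have h4 := L4 hS hL
  set N := nH a H H1 with hN
  have hN0 : 0 ≤ N := nH_nonneg _ _ _
  set sa := Real.sqrt a with hsa
  set sd := Real.sqrt δ with hsd
  have hsa0 : 0 < sa := Real.sqrt_pos.2 (by linarith)
  have hsd0 : 0 < sd := Real.sqrt_pos.2 hδ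
  have hsa2 : sa ^ 2 = a := Real.sq_sqrt (by linarith)
  have hsd2 : sd ^ 2 = δ := Real.sq_sqrt hδ.le
  have hk := hL.hκ
  have hX := n2_nonneg w
  have hY := n2_nonneg w1
  set X := n2 w
  set Y := n2 w1
  set Z := n2 (fun y => (V y - lam) * ‖w y‖) with hZ
  have hZ0 : 0 ≤ Z := n2_nonneg _
  have hHN := an2_le_nH (a := a) H H1
  rw [← hN] at hHN
  have hX' : sa * sd * X ≤ C * N := by
    have : X ≤ C * (N / (sa * sd)) := by
      have : 0 ≤ δ * Y := by positivity
      linarith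
    rw [← mul_div_assoc, le_div_iff₀ (by positivity)] at this
    linarith
  have hY' : sa * sd * (δ * Y) ≤ C * N := by
    have : δ * Y ≤ C * (N / (sa * sd)) := by linarith
    rw [← mul_div_assoc, le_div_iff₀ (by positivity)] at this
    linarith
  -- bounds with powers of `a`
  have hss : sa * sd ≤ M := by
    have h1 : (sa * sd) ^ 2 ≤ M := by rw [mul_pow, hsa2, hsd2]; exact hL.hκ
    nlinarith [sq_nonneg (sa * sd - 1)]
  have t1 : (a * δ * X) ≤ M * C * N := by
    calc a * δ * X = (sa * sd) * (sa * sd * X) := by rw [← hsa2, ← hsd2]; ring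
      _ ≤ M * (C * N) := by gcongr
      _ = _ := by ring
  have t2 : a ^ 2 * (M * δ ^ 3 * (X * Y)) ≤ M * (M * (C * N) ^ 2) := by
    calc a ^ 2 * (M * δ ^ 3 * (X * Y)) = M * ((a * δ) * ((sa * sd * X) * (sa * sd * (δ * Y)))) := by
          rw [← hsa2, ← hsd2]; ring
      _ ≤ M * (M * ((C * N) * (C * N))) := by gcongr
      _ = _ := by ring
  have hZZ : (a * Z) ^ 2 ≤ N * (a * Z) + M * (M * (C * N) ^ 2) + M * C * N * (a * Z) := by
    have h5 : a ^ 2 * Z ^ 2 ≤ a ^ 2 * (n2 H * Z + M * δ ^ 3 * (X * Y) + δ * X * Z) :=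
      mul_le_mul_of_nonneg_left h4 (sq_nonneg a)
    have h6 : (a * n2 H) * (a * Z) ≤ N * (a * Z) := by gcongr
    have h7 : (a * δ * X) * (a * Z) ≤ M * C * N * (a * Z) := by gcongr
    linarith
  have hMM : M * C ≤ M ^ 2 * C := by
    gcongr
    nlinarith
  have hMK : M * C ≤ K := by
    have := mul_nonneg (sq_nonneg M) hC.le
    rw [hK]
    linarith [mul_comm M C]
  have hMK2 : 1 + 2 * (M * C) ≤ K := by
    rw [hK]
    linarith [mul_comm M C]
  have hz : a * Z ≤ K * N := by
    by_contra hc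
    push Not at hc
    have haZ : 0 ≤ a * Z := by positivity
    have hMC : 0 ≤ M * C := by positivity
    have h5 : (M * C) * N ≤ a * Z := by
      refine le_trans ?_ hc.le
      gcongr
    have h6 : M * (M * (C * N) ^ 2) ≤ (M * C * N) * (a * Z) := by
      calc M * (M * (C * N) ^ 2) = (M * C * N) * (M * C * N) := by ring
        _ ≤ _ := by gcongr
    have h7 : (a * Z) * (a * Z) ≤ ((1 + 2 * (M * C)) * N) * (a * Z) := by linarith
    rcases haZ.eq_or_lt with h0 | h0
    · have : 0 ≤ K * N := by positivity
      linarith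
    · have h8 := le_of_mul_le_mul_right h7 h0
      have h9 : (1 + 2 * (M * C)) * N ≤ K * N := by
        gcongr
      linarith
  refine ⟨hz.trans (by gcongr; linarith [mul_nonneg hP0 (by positivity : 0 ≤ K + C)]), ?_⟩
  set sk := Real.sqrt (a * δ) with hsk
  have hsk0 : 0 < sk := Real.sqrt_pos.2 (by positivity)
  have hske : sk = sa * sd := Real.sqrt_mul (by linarith) _
  set b := sk / a with hb
  have hb0 : 0 < b := by positivity
  have hVc := hS.d0.c
  have c5 := hL.dw.c
  have cr := (D1_rr (lam := lam) hS hb0).c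
  have hw : J (fun y => ‖w y‖) ≤ Real.sqrt (Real.pi / (c₀ * b)) * (Z + b * X) := by
    have cw : Continuous (fun y => |V y - lam| * ‖w y‖ + b * ‖w y‖) := by fun_prop
    have h1 := cs (f := fun y => Real.sqrt (rr V lam b y)) (g := fun y => |V y - lam| * ‖w y‖ + b * ‖w y‖)
      (by fun_prop) cw
    have h2 : n2 (fun y => Real.sqrt (rr V lam b y)) ≤ Real.sqrt (Real.pi / (c₀ * b)) := by
      unfold n2
      apply Real.sqrt_le_sqrt
      refine le_trans (le_of_eq ?_) (J_rr (lam := lam) hS hb0)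
      apply J_congr
      intro y _
      rw [Real.norm_eq_abs, sq_abs, Real.sq_sqrt (rr_pos hb0 y).le]
    have h3 : n2 (fun y => |V y - lam| * ‖w y‖ + b * ‖w y‖) ≤ 1 * Z + b * X := by
      refine n2_le_add cw (by fun_prop) c5 zero_le_one hb0.le ?_
      intro y _
      rw [norm_mul, norm_norm, Real.norm_eq_abs, Real.norm_eq_abs, abs_of_nonneg (by positivity), one_mul]
    rw [one_mul] at h3
    have h4 : J (fun y => ‖w y‖) ≤
        J (fun y => ‖Real.sqrt (rr V lam b y)‖ * ‖|V y - lam| * ‖w y‖ + b * ‖w y‖‖) := by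
      refine J_mono (by fun_prop) (by fun_prop) fun y _ => ?_
      rw [Real.norm_eq_abs, Real.norm_eq_abs, abs_of_nonneg (Real.sqrt_nonneg _),
        abs_of_nonneg (by positivity)]
      have h5 : 1 ≤ Real.sqrt (rr V lam b y) * (|V y - lam| + b) := by
        have h6 := rr_mul (V := V) (lam := lam) hb0 y
        refine le_sq ?_ (by positivity)
        rw [mul_pow, Real.sq_sqrt (rr_pos hb0 y).le, one_pow, ← h6, mul_comm]
        apply mul_le_mul_of_nonneg_left _ (rr_pos hb0 y).le
        rw [← sq_abs (V y - lam)]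
        nlinarith [abs_nonneg (V y - lam)]
      nlinarith [norm_nonneg (w y)]
    exact h4.trans (h1.trans (mul_le_mul h2 h3 (n2_nonneg _) (Real.sqrt_nonneg _)))
  refine hw.trans ?_
  have hbs : Real.sqrt (Real.pi / (c₀ * b)) = P * (sa / Real.sqrt sk) := by
    rw [hb, hP, hsa, ← Real.sqrt_div (by linarith), ← Real.sqrt_mul (by positivity)]
    congr 1
    field_simp
  set q := Real.sqrt sk with hq
  have hq0 : 0 < q := Real.sqrt_pos.2 hsk0
  have hZb : a * (Z + b * X) ≤ (K + C) * N := by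
    have : a * (b * X) = sa * sd * X := by
      rw [hb, hske]; field_simp
    rw [mul_add, this]
    nlinarith
  rw [hbs]
  have h9 : Z + b * X ≤ (K + C) * N / sa ^ 2 := by
    rw [hsa2, le_div_iff₀ (by linarith)]
    linarith
  calc P * (sa / q) * (Z + b * X) ≤ P * (sa / q) * ((K + C) * N / sa ^ 2) := by gcongr
    _ = P * (K + C) * (N / (sa * q)) := by field_simp
    _ ≤ _ := by
      gcongr
      linarith

end OSP

namespace OSP

/-- Integrable singular weight. -/
def sI (yc η t : ℝ) : ℝ := (Real.sqrt (|t - yc| + η))⁻¹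

lemma sI_cont {yc η : ℝ} (hη : 0 < η) : Continuous (sI yc η) := by
  unfold sI
  have hd : ∀ t : ℝ, Real.sqrt (|t - yc| + η) ≠ 0 := fun t => by positivity
  fun_prop (disch := exact hd)

lemma sI_pos {yc η : ℝ} (hη : 0 < η) (t : ℝ) : 0 < sI yc η t := by
  unfold sI
  positivity

lemma sqrt_add_le {a b : ℝ} (ha : 0 ≤ a) (hb : 0 ≤ b) :
    Real.sqrt (a + b) ≤ Real.sqrt a + Real.sqrt b := by
  refine le_sq ?_ (by positivity)
  rw [Real.sq_sqrt (by positivity), add_sq, Real.sq_sqrt ha, Real.sq_sqrt hb]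
  have := mul_nonneg (Real.sqrt_nonneg a) (Real.sqrt_nonneg b)
  linarith

lemma J_sI {yc η : ℝ} (hη : 0 < η) (hyc : yc ∈ Icc (0:ℝ) 1) : J (sI yc η) ≤ 4 := by
  have hc := sI_cont (yc := yc) hη
  have ii : ∀ p q : ℝ, IntervalIntegrable (sI yc η) volume p q := fun p q => hc.intervalIntegrable _ _
  unfold J
  rw [← intervalIntegral.integral_add_adjacent_intervals (ii 0 yc) (ii yc 1)]
  have h1 : ∫ y in (0:ℝ)..yc, sI yc η y = -2 * Real.sqrt (yc - yc + η) - -2 * Real.sqrt (yc - 0 + η) := by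
    refine intervalIntegral.integral_eq_sub_of_hasDerivAt_of_le
      (f := fun t => -2 * Real.sqrt (yc - t + η)) hyc.1 (by fun_prop) ?_ (ii _ _)
    intro x hx
    have hp : 0 < yc - x + η := by linarith [hx.2]
    have := (((((hasDerivAt_id x).const_sub yc)).add_const η).sqrt hp.ne').const_mul (-2)
    refine this.congr_deriv ?_
    simp only [id]
    unfold sI
    rw [abs_of_neg (by linarith [hx.2]), neg_sub]
    have : Real.sqrt (yc - x + η) ≠ 0 := (Real.sqrt_pos.2 hp).ne'
    field_simp
  have h2 : ∫ y in yc..1, sI yc η y = 2 * Real.sqrt (1 - yc + η) - 2 * Real.sqrt (yc - yc + η) := by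
    refine intervalIntegral.integral_eq_sub_of_hasDerivAt_of_le
      (f := fun t => 2 * Real.sqrt (t - yc + η)) hyc.2 (by fun_prop) ?_ (ii _ _)
    intro x hx
    have hp : 0 < x - yc + η := by linarith [hx.1]
    have := (((((hasDerivAt_id x).sub_const yc)).add_const η).sqrt hp.ne').const_mul 2
    refine this.congr_deriv ?_
    simp only [id]
    unfold sI
    rw [abs_of_pos (by linarith [hx.1])]
    have : Real.sqrt (x - yc + η) ≠ 0 := (Real.sqrt_pos.2 hp).ne'
    field_simp
  rw [h1, h2]
  have e0 : yc - yc + η = η := by ring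
  have a1 := sqrt_add_le (a := yc - 0) (b := η) (by linarith [hyc.1]) hη.le
  have a2 := sqrt_add_le (a := 1 - yc) (b := η) (by linarith [hyc.2]) hη.le
  have a3 : Real.sqrt (yc - 0) ≤ 1 := by
    exact Real.sqrt_le_one.2 (by linarith [hyc.2])
  have a4 : Real.sqrt (1 - yc) ≤ 1 := by
    exact Real.sqrt_le_one.2 (by linarith [hyc.1])
  rw [e0]
  linarith

lemma log_bound {t : ℝ} (ht : 0 ≤ t) : Real.log (1 + t) ^ 2 ≤ 16 * Real.sqrt t := by
  set u := Real.sqrt (Real.sqrt t) with hu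
  have hu0 : 0 ≤ u := Real.sqrt_nonneg _
  have hu2 : u ^ 2 = Real.sqrt t := Real.sq_sqrt (Real.sqrt_nonneg _)
  have hu4 : u ^ 4 = t := by
    rw [show (4:ℕ) = 2 * 2 from rfl, pow_mul, hu2, Real.sq_sqrt ht]
  have h1 : Real.log (1 + t) ≤ 4 * u := by
    have h2 : 1 + t ≤ (1 + u) ^ 4 := by
      rw [← hu4]
      nlinarith [pow_nonneg hu0 2, pow_nonneg hu0 3]
    have h3 := Real.log_le_log (by linarith) h2
    rw [Real.log_pow] at h3
    have h4 := Real.log_le_sub_one_of_pos (by linarith : 0 < 1 + u)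
    push_cast at h3
    linarith
  have h0 : 0 ≤ Real.log (1 + t) := Real.log_nonneg (by linarith)
  rw [← hu2]
  nlinarith

lemma log_diff_le {x y τ : ℝ} (hx : 0 < x) (hxy : x ≤ y) (hτ : y - x ≤ τ) :
    (Real.log x - Real.log y) ^ 2 ≤ 16 * (Real.sqrt τ * (Real.sqrt x)⁻¹) := by
  have hy : 0 < y := by linarith
  have h1 := log_bound (t := (y - x) / x) (div_nonneg (by linarith) hx.le)
  have h2 : 1 + (y - x) / x = y / x := by field_simp; ring
  rw [h2, Real.log_div hy.ne' hx.ne', Real.sqrt_div (by linarith)] at h1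
  have h3 : (Real.log x - Real.log y) ^ 2 = (Real.log y - Real.log x) ^ 2 := by ring
  rw [h3]
  refine h1.trans ?_
  rw [div_eq_mul_inv]
  have := Real.sqrt_le_sqrt hτ
  gcongr

lemma log_diff {x y τ : ℝ} (hx : 0 < x) (hy : 0 < y) (hτ : |x - y| ≤ τ) :
    (Real.log x - Real.log y) ^ 2 ≤ 16 * (Real.sqrt τ * ((Real.sqrt x)⁻¹ + (Real.sqrt y)⁻¹)) := by
  have p1 : 0 ≤ (Real.sqrt x)⁻¹ := by positivity
  have p2 : 0 ≤ (Real.sqrt y)⁻¹ := by positivity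
  have p3 := Real.sqrt_nonneg τ
  rcases le_total x y with h | h
  · have h1 := log_diff_le hx h (by linarith [neg_le_abs (x - y)] : y - x ≤ τ)
    nlinarith [mul_nonneg p3 p2]
  · have h1 := log_diff_le hy h (by linarith [le_abs_self (x - y)] : x - y ≤ τ)
    have h3 : (Real.log x - Real.log y) ^ 2 = (Real.log y - Real.log x) ^ 2 := by ring
    rw [h3]
    nlinarith [mul_nonneg p3 p1]

lemma n2_le_deriv {f f1 : ℝ → ℂ} (hf : D1 f f1) (f0 : f 0 = 0) : n2 f ≤ n2 f1 := by
  refine n2_le_const hf.c (n2_nonneg _) fun y hy => ?_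
  refine le_sq ?_ (n2_nonneg _)
  have h := hf.holder (p := 0) (q := y) ⟨le_rfl, zero_le_one⟩ hy
  rw [f0, sub_zero, sub_zero, abs_of_nonneg hy.1] at h
  nlinarith [hy.2, sq_nonneg (n2 f1)]

lemma sup_le_deriv {f f1 : ℝ → ℂ} (hf : D1 f f1) (f0 : f 0 = 0) {y : ℝ} (hy : y ∈ Icc (0:ℝ) 1) :
    ‖f y‖ ≤ n2 f1 := by
  refine le_sq ?_ (n2_nonneg _)
  have h := hf.holder (p := 0) (q := y) ⟨le_rfl, zero_le_one⟩ hy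
  rw [f0, sub_zero, sub_zero, abs_of_nonneg hy.1] at h
  nlinarith [hy.2, sq_nonneg (n2 f1)]

/-- Constant in the logarithmic lemma. -/
def CL (c₀ M c₁ : ℝ) : ℝ := Real.sqrt (128 / Real.sqrt c₁) * (1 / c₀ + M / c₀ ^ 2)

lemma LOG {V V1 V2 V3 : ℝ → ℝ} {c₀ M c₁ : ℝ} (hS : Shear c₀ M V V1 V2 V3) (hc₁ : 0 < c₁)
    {x x' z z' l : ℝ → ℝ} {f f1 : ℝ → ℂ} {η τ y1 y2 : ℝ} (hη : 0 < η)
    (hx : D1 x x') (hz : D1 z z') (x0 : ∀ t, 0 < x t) (z0 : ∀ t, 0 < z t)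
    (hy1 : y1 ∈ Icc (0:ℝ) 1) (hy2 : y2 ∈ Icc (0:ℝ) 1)
    (xl : ∀ t ∈ Icc (0:ℝ) 1, c₁ * (|t - y1| + η) ≤ x t)
    (zl : ∀ t ∈ Icc (0:ℝ) 1, c₁ * (|t - y2| + η) ≤ z t)
    (hxz : ∀ t ∈ Icc (0:ℝ) 1, |x t - z t| ≤ τ)
    (hl : ∀ t, V1 t * l t = x' t / x t - z' t / z t)
    (hf : D1 f f1) (f0 : f 0 = 0) (f1' : f 1 = 0) :
    ‖J (fun t => (l t : ℂ) * f t)‖ ≤ CL c₀ M c₁ * Real.sqrt (Real.sqrt τ) * n2 f1 := by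
  have hc0 := hS.c0
  have hM := hS.M1
  have v0 : ∀ t, V1 t ≠ 0 := fun t => (lt_of_lt_of_le hc0 (hS.lo t)).ne'
  have hLam := (hx.log fun t => (x0 t).ne').sub (hz.log fun t => (z0 t).ne')
  have hi := hS.d1.inv v0
  have hg := hf.mul hi.ofReal
  set Lam : ℝ → ℝ := fun y => Real.log (x y) - Real.log (z y) with hLd
  set Lam1 : ℝ → ℝ := fun y => x' y / x y - z' y / z y with hL1d
  set g : ℝ → ℂ := fun y => f y * (((V1 y)⁻¹ : ℝ) : ℂ) with hgd
  set g1 : ℝ → ℂ := fun y => f1 y * (((V1 y)⁻¹ : ℝ) : ℂ) + f y * ((-V2 y / V1 y ^ 2 : ℝ) : ℂ) with hg1d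
  have cL := hLam.c
  have cL1 := hLam.c'
  have cg := hg.c
  have cg1 := hg.c'
  have g0 : g 0 = 0 := by simp [hgd, f0]
  have g1' : g 1 = 0 := by simp [hgd, f1']
  have hprod : J (fun y => ((Lam1 y : ℝ) : ℂ) * g y + ((Lam y : ℝ) : ℂ) * g1 y) = 0 :=
    (hLam.ofReal.mul hg).ftc.trans (by rw [g0, g1']; simp)
  rw [J_add (by fun_prop) (by fun_prop)] at hprod
  have e1 : J (fun t => (l t : ℂ) * f t) = - J (fun t => ((Lam t : ℝ) : ℂ) * g1 t) := by
    rw [← add_eq_zero_iff_eq_neg, ← hprod]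
    congr 1
    apply J_congr
    intro t _
    have : Lam1 t = V1 t * l t := (hl t).symm
    have hv : (V1 t : ℂ) ≠ 0 := by exact_mod_cast v0 t
    rw [this, hgd]
    push_cast
    field_simp
  rw [e1, norm_neg]
  refine (norm_J_mul_le (by fun_prop) cg1).trans ?_
  have hn1 : n2 (fun t => ((Lam t : ℝ) : ℂ)) ≤ Real.sqrt (128 / Real.sqrt c₁) * Real.sqrt (Real.sqrt τ) := by
    rw [← Real.sqrt_mul (by positivity)]
    unfold n2
    apply Real.sqrt_le_sqrt
    have c1 := sI_cont (yc := y1) hη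
    have c2 := sI_cont (yc := y2) hη
    have h1 : J (fun t => ‖((Lam t : ℝ) : ℂ)‖ ^ 2) ≤
        J (fun t => (16 * (Real.sqrt τ * (Real.sqrt c₁)⁻¹)) * (sI y1 η t + sI y2 η t)) := by
      refine J_mono (by fun_prop) (by fun_prop) fun t ht => ?_
      rw [Complex.norm_real, Real.norm_eq_abs, sq_abs]
      refine (log_diff (x0 t) (z0 t) (hxz t ht)).trans ?_
      have i1 : (Real.sqrt (x t))⁻¹ ≤ (Real.sqrt c₁)⁻¹ * sI y1 η t := by
        unfold sI
        rw [← mul_inv, ← Real.sqrt_mul hc₁.le]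
        exact inv_anti₀ (by positivity) (Real.sqrt_le_sqrt (xl t ht))
      have i2 : (Real.sqrt (z t))⁻¹ ≤ (Real.sqrt c₁)⁻¹ * sI y2 η t := by
        unfold sI
        rw [← mul_inv, ← Real.sqrt_mul hc₁.le]
        exact inv_anti₀ (by positivity) (Real.sqrt_le_sqrt (zl t ht))
      calc 16 * (Real.sqrt τ * ((Real.sqrt (x t))⁻¹ + (Real.sqrt (z t))⁻¹))
          ≤ 16 * (Real.sqrt τ * ((Real.sqrt c₁)⁻¹ * sI y1 η t + (Real.sqrt c₁)⁻¹ * sI y2 η t)) := by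
            gcongr
        _ = _ := by ring
    rw [J_cmul, J_add c1 c2] at h1
    refine h1.trans ?_
    have h2 := J_sI hη hy1
    have h3 := J_sI hη hy2
    calc 16 * (Real.sqrt τ * (Real.sqrt c₁)⁻¹) * (J (sI y1 η) + J (sI y2 η))
        ≤ 16 * (Real.sqrt τ * (Real.sqrt c₁)⁻¹) * (4 + 4) := by gcongr
      _ = _ := by ring
  have hn2 : n2 g1 ≤ (1 / c₀ + M / c₀ ^ 2) * n2 f1 := by
    have h1 : n2 g1 ≤ (1 / c₀) * n2 f1 + (M / c₀ ^ 2) * n2 f := by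
      refine n2_le_add cg1 hf.c' hf.c (by positivity) (by positivity) fun t _ => ?_
      rw [hg1d]
      refine (norm_add_le _ _).trans ?_
      rw [norm_mul, norm_mul, Complex.norm_real, Complex.norm_real, Real.norm_eq_abs, Real.norm_eq_abs]
      have hlo := hS.lo t
      have hb := hS.b2 t
      have hvp : 0 < V1 t := lt_of_lt_of_le hc0 hlo
      have i1 : |(V1 t)⁻¹| ≤ 1 / c₀ := by
        rw [abs_of_pos (by positivity), one_div]
        exact inv_anti₀ hc0 hlo
      have i2 : |-V2 t / V1 t ^ 2| ≤ M / c₀ ^ 2 := by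
        rw [abs_div, abs_neg, abs_of_pos (by positivity : 0 < V1 t ^ 2)]
        gcongr
      nlinarith [norm_nonneg (f t), norm_nonneg (f1 t)]
    have h2 := n2_le_deriv hf f0
    have h3 : 0 ≤ M / c₀ ^ 2 := by positivity
    nlinarith
  unfold CL
  calc _ ≤ (Real.sqrt (128 / Real.sqrt c₁) * Real.sqrt (Real.sqrt τ)) * ((1 / c₀ + M / c₀ ^ 2) * n2 f1) :=
        mul_le_mul hn1 hn2 (n2_nonneg _) (by positivity)
    _ = _ := by ring

section U
variable {V V1 V2 V3 : ℝ → ℝ} {c₀ M lam δ : ℝ}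

/-- `√((V-λ)²+δ²)`. -/
def UU (V : ℝ → ℝ) (lam δ : ℝ) (y : ℝ) : ℝ := Real.sqrt ((V y - lam) ^ 2 + δ ^ 2)

/-- Its derivative. -/
def UU1 (V V1 : ℝ → ℝ) (lam δ : ℝ) (y : ℝ) : ℝ := V1 y * (V y - lam) / UU V lam δ y

lemma UU_pos (hδ : 0 < δ) (y : ℝ) : 0 < UU V lam δ y := Real.sqrt_pos.2 (den_pos hδ y)

lemma UU_D1 (hS : Shear c₀ M V V1 V2 V3) (hδ : 0 < δ) : D1 (UU V lam δ) (UU1 V V1 lam δ) := by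
  have h := D1_den (lam := lam) (δ := δ) hS
  have hV := hS.d0.c
  have hV1 := hS.d0.c'
  have hc : Continuous (UU V lam δ) := Real.continuous_sqrt.comp h.c
  refine ⟨hc, ?_, ?_⟩
  · unfold UU1
    exact (by fun_prop : Continuous fun y => V1 y * (V y - lam)).div hc fun y => (UU_pos hδ y).ne'
  · intro x hx
    refine ((h.d x hx).sqrt (den_pos hδ x).ne').congr_deriv ?_
    have := UU_pos (V := V) (lam := lam) hδ x
    unfold UU1
    unfold UU at this ⊢
    field_simp

lemma UU_quot (hδ : 0 < δ) (y : ℝ) :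
    UU1 V V1 lam δ y / UU V lam δ y = V1 y * mm V lam δ y := by
  have h1 : UU V lam δ y * UU V lam δ y = (V y - lam) ^ 2 + δ ^ 2 :=
    Real.mul_self_sqrt (den_pos hδ y).le
  unfold UU1 mm rr
  rw [div_div, h1, mul_div_assoc, div_eq_mul_inv]

lemma UU_ge_abs (y : ℝ) : |V y - lam| ≤ UU V lam δ y :=
  Real.abs_le_sqrt (by nlinarith [sq_nonneg δ])

lemma UU_le (hδ : 0 < δ) (y : ℝ) : UU V lam δ y ≤ |V y - lam| + δ := by
  unfold UU
  refine le_sq ?_ (by positivity)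
  rw [Real.sq_sqrt (den_pos hδ y).le, ← sq_abs (V y - lam)]
  nlinarith [abs_nonneg (V y - lam)]

lemma UU_ge (hδ : 0 < δ) (y : ℝ) : (|V y - lam| + δ) / 2 ≤ UU V lam δ y := by
  unfold UU
  refine Real.le_sqrt_of_sq_le ?_
  rw [← sq_abs (V y - lam)]
  nlinarith [sq_nonneg (|V y - lam| - δ), abs_nonneg (V y - lam)]

lemma UU_low (hS : Shear c₀ M V V1 V2 V3) (hδ : 0 < δ) {yc : ℝ} (hC : Crit V c₀ lam yc)
    {t : ℝ} (ht : t ∈ Icc (0:ℝ) 1) : c₀ / 2 * (|t - yc| + δ) ≤ UU V lam δ t := by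
  refine le_trans ?_ (UU_ge hδ t)
  have h1 := hC.lo t ht
  have h2 : c₀ * δ ≤ δ := by nlinarith [hS.c1]
  linarith

lemma UU_lip (hδ : 0 < δ) (y z : ℝ) : UU V lam δ y - UU V lam δ z ≤ |V y - V z| := by
  have hz := UU_pos (V := V) (lam := lam) hδ z
  have h0 := UU_ge_abs (V := V) (lam := lam) (δ := δ) z
  have h1 : UU V lam δ z * UU V lam δ z = (V z - lam) ^ 2 + δ ^ 2 :=
    Real.mul_self_sqrt (den_pos hδ z).le
  have h2 : UU V lam δ y ≤ UU V lam δ z + |V y - V z| := by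
    have hA := abs_nonneg (V y - V z)
    unfold UU at *
    rw [Real.sqrt_le_left (by positivity)]
    have h3 : (V y - V z) * (V z - lam) ≤ |V y - V z| * |V z - lam| := by
      rw [← abs_mul]; exact le_abs_self _
    have h4 := mul_le_mul_of_nonneg_left h0 hA
    have h5 := sq_abs (V y - V z)
    nlinarith
  linarith

/-- Constant in the principal value bound. -/
def CP (c₀ M : ℝ) : ℝ := CL c₀ M (c₀ / 4) * Real.sqrt (Real.sqrt M)

lemma CP_nonneg {c₀ M : ℝ} (hc : 0 < c₀) (hM : 1 ≤ M) : 0 ≤ CP c₀ M := by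
  unfold CP CL
  positivity

/-- Principal value bound. -/
lemma Pbd (hS : Shear c₀ M V V1 V2 V3) (hδ : 0 < δ) {f f1 : ℝ → ℂ}
    (hf : D1 f f1) (f0 : f 0 = 0) (f1' : f 1 = 0) :
    ‖J (fun t => (mm V lam δ t : ℂ) * f t)‖ ≤ CP c₀ M * n2 f1 := by
  obtain ⟨yc, hC⟩ := exists_crit hS lam
  have hc0 := hS.c0
  have hc1 := hS.c1
  obtain ⟨yr, hyr, hd⟩ : ∃ yr ∈ Icc (0:ℝ) 1, 1 / 2 ≤ |yr - yc| := by
    rcases le_total yc (1 / 2) with h | h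
    · exact ⟨1, ⟨zero_le_one, le_rfl⟩, le_trans (by linarith) (le_abs_self _)⟩
    · exact ⟨0, ⟨le_rfl, zero_le_one⟩, le_trans (by linarith) (neg_le_abs _)⟩
  have key := LOG hS (by positivity : 0 < c₀ / 4) (x := UU V lam δ) (x' := UU1 V V1 lam δ)
    (z := fun _ => UU V lam δ yr) (z' := fun _ => 0) (l := mm V lam δ) (η := δ) (τ := M)
    (y1 := yc) (y2 := yc) hδ (UU_D1 hS hδ) (D1.const _) (UU_pos hδ) (fun _ => UU_pos hδ yr)
    hC.mem hC.mem ?_ ?_ ?_ ?_ hf f0 f1'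
  · unfold CP
    exact key
  · intro t ht
    have := UU_low hS hδ hC ht
    nlinarith [abs_nonneg (t - yc)]
  · intro t ht
    have h1 := UU_low hS hδ hC hyr
    have h2 : |t - yc| ≤ 1 := by
      rw [abs_le]
      constructor <;> linarith [ht.1, ht.2, hC.mem.1, hC.mem.2]
    nlinarith [abs_nonneg (t - yc)]
  · intro t ht
    have hl : |V t - V yr| ≤ M := by
      refine (hS.lip hyr ht).trans ?_
      have : |t - yr| ≤ 1 := by
        rw [abs_le]
        constructor <;> linarith [ht.1, ht.2, hyr.1, hyr.2]
      nlinarith [hS.M1]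
    have h1 := UU_lip (V := V) (lam := lam) hδ t yr
    have h2 := UU_lip (V := V) (lam := lam) hδ yr t
    rw [abs_sub_comm] at h2
    rw [abs_le]
    constructor <;> linarith
  · intro t
    rw [zero_div, sub_zero, UU_quot hδ]

end U

end OSP

namespace OSP

section sys
variable {V V1 V2 V3 : ℝ → ℝ} {c₀ M lam δ a σ ε : ℝ} {o : ℂ} {w w1 w2 φ φ1 G G1 : ℝ → ℂ}

/-- Full system with the nonlocal term. -/
structure Sys (c₀ M : ℝ) (V V1 V2 V3 : ℝ → ℝ) (lam δ a σ ε : ℝ) (o : ℂ)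
    (w w1 w2 φ φ1 G G1 : ℝ → ℂ) : Prop where
  S : Shear c₀ M V V1 V2 V3
  L : Loc M V lam δ a σ ε o w w1 w2 (fun y => (V2 y : ℂ) * φ y + G y)
    (fun y => (V3 y : ℂ) * φ y + (V2 y : ℂ) * φ1 y + G1 y)
  dφ : D1 φ φ1
  dφ1 : D1 φ1 (fun y => w y + (a:ℂ) ^ 2 * φ y)
  dG : D1 G G1
  φ0 : φ 0 = 0
  φ1' : φ 1 = 0

lemma Sys.wphi (h : Sys c₀ M V V1 V2 V3 lam δ a σ ε o w w1 w2 φ φ1 G G1) :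
    J (fun y => w y * (starRingEnd ℂ) (φ y)) = ((-(nH a φ φ1 ^ 2) : ℝ) : ℂ) := by
  have c1 := h.dφ.c
  have c2 := h.dφ.c'
  have c3 := h.L.dw.c
  have c4 : Continuous fun y => (starRingEnd ℂ) (φ y) := Complex.continuous_conj.comp c1
  have hP := (h.dφ1.mul h.dφ.conj).ftc
  simp only [h.φ0, h.φ1', map_zero, mul_zero, sub_zero] at hP
  rw [nH_sq, n2_sq, n2_sq]
  have e : J (fun y => (w y + (a:ℂ) ^ 2 * φ y) * (starRingEnd ℂ) (φ y) + φ1 y * (starRingEnd ℂ) (φ1 y))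
      = J (fun y => w y * (starRingEnd ℂ) (φ y)) + ((J (fun y => ‖φ1 y‖ ^ 2) : ℝ) : ℂ)
        + (a:ℂ) ^ 2 * ((J (fun y => ‖φ y‖ ^ 2) : ℝ) : ℂ) := by
    rw [← J_ofReal, ← J_ofReal, ← J_cmulC, ← J_add (by fun_prop) (by fun_prop),
      ← J_add (by fun_prop) (by fun_prop)]
    apply J_congr
    intro y _
    simp only [← mul_conj_norm]
    ring
  rw [e] at hP
  push_cast
  linear_combination hP

lemma Sys.nH_le (h : Sys c₀ M V V1 V2 V3 lam δ a σ ε o w w1 w2 φ φ1 G G1) :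
    nH a (fun y => (V2 y : ℂ) * φ y + G y) (fun y => (V3 y : ℂ) * φ y + (V2 y : ℂ) * φ1 y + G1 y)
      ≤ 3 * M * nH a φ φ1 + 2 * nH a G G1 := by
  have hM := h.S.M1
  have ha := h.L.ha
  have c1 := h.dφ.c
  have c2 := h.dφ.c'
  have c3 := h.dG.c
  have c4 := h.dG.c'
  have c5 := h.S.d2.c
  have c6 := h.S.d2.c'
  have q1 : n2 (fun y => (V2 y : ℂ) * φ y + G y) ≤ M * n2 φ + 1 * n2 G := by
    refine n2_le_add (by fun_prop) c1 c3 (by linarith) zero_le_one fun y _ => ?_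
    refine (norm_add_le _ _).trans ?_
    rw [norm_mul, Complex.norm_real, Real.norm_eq_abs, one_mul]
    gcongr
    exact h.S.b2 y
  have q2 : n2 (fun y => (V3 y : ℂ) * φ y + (V2 y : ℂ) * φ1 y) ≤ M * n2 φ + M * n2 φ1 := by
    refine n2_le_add (by fun_prop) c1 c2 (by linarith) (by linarith) fun y _ => ?_
    refine (norm_add_le _ _).trans ?_
    rw [norm_mul, norm_mul, Complex.norm_real, Real.norm_eq_abs, Complex.norm_real, Real.norm_eq_abs]
    gcongr
    · exact h.S.b3 y
    · exact h.S.b2 y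
  have q3 : n2 (fun y => (V3 y : ℂ) * φ y + (V2 y : ℂ) * φ1 y + G1 y) ≤
      1 * n2 (fun y => (V3 y : ℂ) * φ y + (V2 y : ℂ) * φ1 y) + 1 * n2 G1 := by
    refine n2_le_add (by fun_prop) (by fun_prop) c4 (by linarith) (by linarith) fun y _ => ?_
    refine (norm_add_le _ _).trans ?_
    rw [one_mul, one_mul]
  have p1 := n2_le_nH a φ φ1
  have p2 := an2_le_nH (a := a) φ φ1
  have p3 := n2_le_nH a G G1
  have p4 := an2_le_nH (a := a) G G1
  have z1 := n2_nonneg φ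
  have z2 := n2_nonneg G
  have z3 := n2_nonneg φ1
  have z4 := n2_nonneg G1
  have z5 := n2_nonneg (fun y => (V2 y : ℂ) * φ y + G y)
  have z6 := n2_nonneg (fun y => (V3 y : ℂ) * φ y + (V2 y : ℂ) * φ1 y + G1 y)
  have p5 : n2 φ ≤ nH a φ φ1 := by nlinarith
  have r1 : a * n2 (fun y => (V2 y : ℂ) * φ y + G y) ≤ M * nH a φ φ1 + nH a G G1 := by
    calc a * n2 (fun y => (V2 y : ℂ) * φ y + G y) ≤ a * (M * n2 φ + 1 * n2 G) := by gcongr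
      _ = M * (a * n2 φ) + a * n2 G := by ring
      _ ≤ _ := by gcongr
  have r2 : n2 (fun y => (V3 y : ℂ) * φ y + (V2 y : ℂ) * φ1 y + G1 y) ≤ 2 * M * nH a φ φ1 + nH a G G1 := by
    have : M * n2 φ + M * n2 φ1 ≤ M * nH a φ φ1 + M * nH a φ φ1 := by gcongr
    linarith
  have r3 := nH_nonneg a φ φ1
  have r4 := nH_nonneg a G G1
  refine le_sq ?_ (by positivity)
  rw [nH_sq, ← mul_pow]
  have y1 : 0 ≤ M * nH a φ φ1 := by positivity
  calc _ ≤ (2 * M * nH a φ φ1 + nH a G G1) ^ 2 + (M * nH a φ φ1 + nH a G G1) ^ 2 := by gcongr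
    _ ≤ _ := by nlinarith [mul_nonneg y1 r4]

lemma n2_mul_le {f g : ℝ → ℂ} (hf : Continuous f) (hg : Continuous g) {s : ℝ} (hs : 0 ≤ s)
    (h : ∀ y ∈ Icc (0:ℝ) 1, ‖f y‖ ≤ s) : n2 (fun y => f y * g y) ≤ s * n2 g := by
  refine n2_le_mul (by fun_prop) hg hs fun y hy => ?_
  rw [norm_mul]
  gcongr
  exact h y hy

lemma n2_tri {f g : ℝ → ℂ} (hf : Continuous f) (hg : Continuous g) :
    n2 (fun y => f y + g y) ≤ n2 f + n2 g := by
  have := n2_le_add (f := fun y => f y + g y) (α := 1) (β := 1) (by fun_prop) hf hg zero_le_one zero_le_one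
    fun y _ => by simpa using norm_add_le (f y) (g y)
  simpa using this

lemma n2_conj (f : ℝ → ℂ) : n2 (fun y => (starRingEnd ℂ) (f y)) = n2 f :=
  n2_eq fun y _ => RCLike.norm_conj _

/-- Product bound for the derivative. -/
lemma n2_prod {f f1 g g1 : ℝ → ℂ} (hf : D1 f f1) (hg : D1 g g1) {A B A1 B1 : ℝ}
    (hA : ∀ y ∈ Icc (0:ℝ) 1, ‖f y‖ ≤ A) (hB : ∀ y ∈ Icc (0:ℝ) 1, ‖g y‖ ≤ B)
    (hA1 : n2 f1 ≤ A1) (hB1 : n2 g1 ≤ B1) :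
    n2 (fun y => f1 y * g y + f y * g1 y) ≤ A1 * B + A * B1 := by
  have c1 := hf.c
  have c2 := hf.c'
  have c3 := hg.c
  have c4 := hg.c'
  have h0 : (0:ℝ) ∈ Icc (0:ℝ) 1 := ⟨le_rfl, zero_le_one⟩
  have A0 : 0 ≤ A := (norm_nonneg _).trans (hA 0 h0)
  have B0 : 0 ≤ B := (norm_nonneg _).trans (hB 0 h0)
  refine (n2_tri (by fun_prop) (by fun_prop)).trans ?_
  have h1 := n2_mul_le c1 c4 A0 hA
  have h2 := n2_mul_le c3 c2 B0 hB
  have h3 : n2 (fun y => f1 y * g y) = n2 (fun y => g y * f1 y) := by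
    congr 1
    funext y
    ring
  rw [h3]
  have := mul_le_mul_of_nonneg_left hA1 B0
  have := mul_le_mul_of_nonneg_left hB1 A0
  linarith

/-- The quadratic form. -/
def QQ (V V2 : ℝ → ℝ) (lam δ : ℝ) (φ : ℝ → ℂ) : ℝ :=
  J (fun y => mm V lam δ y * (V2 y * ‖φ y‖ ^ 2))

lemma Sys.sup_le (h : Sys c₀ M V V1 V2 V3 lam δ a σ ε o w w1 w2 φ φ1 G G1) {y : ℝ}
    (hy : y ∈ Icc (0:ℝ) 1) : ‖φ y‖ ≤ nH a φ φ1 :=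
  (sup_le_deriv h.dφ h.φ0 hy).trans (n2_le_nH _ _ _)

lemma Sys.supG_le (h : Sys c₀ M V V1 V2 V3 lam δ a σ ε o w w1 w2 φ φ1 G G1) {y : ℝ}
    (hy : y ∈ Icc (0:ℝ) 1) : ‖G y‖ ≤ 2 * nH a G G1 := by
  refine (sup_nH h.L.ha h.dG hy).trans ?_
  have h1 : 1 ≤ Real.sqrt a := Real.one_le_sqrt.2 h.L.ha
  have := div_le_self (nH_nonneg a G G1) h1
  linarith

lemma Sys.main1 (h : Sys c₀ M V V1 V2 V3 lam δ a σ ε o w w1 w2 φ φ1 G G1) :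
    |nH a φ φ1 ^ 2 + QQ V V2 lam δ φ| ≤ 3 * CP c₀ M * nH a G G1 * nH a φ φ1
      + (2 + M + M ^ 2) * δ * ((n2 w + δ * n2 w1) * (Real.sqrt (wA V lam δ φ) + n2 φ1)) := by
  have hδ := h.L.hδ
  have c1 := h.dφ.c
  have c2 := h.dφ.c'
  have c3 := h.dG.c
  have c5 := h.S.d2.c
  have cm := (D1_mm (lam := lam) h.S hδ).c
  have c4 : Continuous fun y => (starRingEnd ℂ) (φ y) := Complex.continuous_conj.comp c1
  have hw := weak_est h.S h.L h.dφ.conj (by simp [h.φ0]) (by simp [h.φ1'])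
  rw [h.wphi, n2_conj] at hw
  have e1 : wA V lam δ (fun y => (starRingEnd ℂ) (φ y)) = wA V lam δ φ := by
    unfold wA
    simp only [RCLike.norm_conj]
  rw [e1] at hw
  have e2 : J (fun y => (mm V lam δ y : ℂ) * ((starRingEnd ℂ) (φ y) * ((V2 y : ℂ) * φ y + G y))) =
      ((QQ V V2 lam δ φ : ℝ) : ℂ) + J (fun y => (mm V lam δ y : ℂ) * ((starRingEnd ℂ) (φ y) * G y)) := by
    unfold QQ
    rw [← J_ofReal, ← J_add (by fun_prop) (by fun_prop)]
    apply J_congr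
    intro y _
    have := mul_conj_norm (φ y)
    push_cast at this ⊢
    rw [← this]
    ring
  rw [e2] at hw
  have hp := Pbd (lam := lam) h.S hδ (h.dφ.conj.mul h.dG) (by simp [h.φ0]) (by simp [h.φ1'])
  have hn := n2_prod h.dφ.conj h.dG (A := nH a φ φ1) (B := 2 * nH a G G1) (A1 := nH a φ φ1)
    (B1 := nH a G G1) (fun y hy => by rw [RCLike.norm_conj]; exact h.sup_le hy)
    (fun y hy => h.supG_le hy) (by rw [n2_conj]; exact n2_le_nH _ _ _) (n2_le_nH _ _ _)
  have hCP := CP_nonneg h.S.c0 h.S.M1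
  have hp2 := hp.trans (mul_le_mul_of_nonneg_left hn hCP)
  rw [← Real.norm_eq_abs, ← Complex.norm_real]
  set X := J (fun y => (mm V lam δ y : ℂ) * ((starRingEnd ℂ) (φ y) * G y)) with hX
  have e3 : ((nH a φ φ1 ^ 2 + QQ V V2 lam δ φ : ℝ) : ℂ) =
      -X - (((-(nH a φ φ1 ^ 2) : ℝ) : ℂ) - (((QQ V V2 lam δ φ : ℝ) : ℂ) + X)) := by
    push_cast; ring
  rw [e3]
  refine (norm_sub_le _ _).trans ?_
  rw [norm_neg]
  linarith

lemma n2_V2phi (hS : Shear c₀ M V V1 V2 V3) (hφ : D1 φ φ1) {s e : ℝ} (hs0 : 0 ≤ s)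
    (hs : ∀ y ∈ Icc (0:ℝ) 1, ‖φ y‖ ≤ s) (h1 : n2 φ ≤ e) (h2 : n2 φ1 ≤ e) :
    n2 (fun y => (((V3 y * ‖φ y‖ ^ 2 + V2 y * (2 * (φ1 y * (starRingEnd ℂ) (φ y)).re)) : ℝ) : ℂ))
      ≤ 3 * M * s * e := by
  have hM := hS.M1
  have c1 := hφ.c
  have c2 := hφ.c'
  have c3 := hφ.normSq.c'
  have c5 := hS.d2.c
  have c6 := hS.d2.c'
  have : n2 (fun y => (((V3 y * ‖φ y‖ ^ 2 + V2 y * (2 * (φ1 y * (starRingEnd ℂ) (φ y)).re)) : ℝ) : ℂ))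
      ≤ (M * s) * n2 φ + (2 * M * s) * n2 φ1 := by
    refine n2_le_add (by fun_prop) c1 c2 (by positivity) (by positivity) fun y hy => ?_
    rw [Complex.norm_real]
    refine (norm_add_le _ _).trans ?_
    rw [norm_mul, norm_mul, norm_mul, Real.norm_eq_abs, Real.norm_eq_abs, Real.norm_eq_abs, Real.norm_eq_abs]
    have k1 := Complex.abs_re_le_norm (φ1 y * (starRingEnd ℂ) (φ y))
    rw [norm_mul, RCLike.norm_conj] at k1
    have k2 := hs y hy
    have k3 : |‖φ y‖ ^ 2| ≤ s * ‖φ y‖ := by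
      rw [abs_of_nonneg (by positivity), sq]
      gcongr
    have k4 : |(φ1 y * (starRingEnd ℂ) (φ y)).re| ≤ s * ‖φ1 y‖ := by
      refine k1.trans ?_
      rw [mul_comm]
      gcongr
    have k5 : |(2:ℝ)| = 2 := abs_of_pos (by norm_num)
    rw [k5]
    calc |V3 y| * |‖φ y‖ ^ 2| + |V2 y| * (2 * |(φ1 y * (starRingEnd ℂ) (φ y)).re|)
        ≤ M * (s * ‖φ y‖) + M * (2 * (s * ‖φ1 y‖)) := by
          gcongr
          · exact hS.b3 y
          · exact hS.b2 y
      _ = _ := by ring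
  have k6 : 0 ≤ M * s := by positivity
  nlinarith [mul_le_mul_of_nonneg_left h1 k6, mul_le_mul_of_nonneg_left h2 k6]

lemma Sys.QQ_le (h : Sys c₀ M V V1 V2 V3 lam δ a σ ε o w w1 w2 φ φ1 G G1) {s : ℝ} (hs0 : 0 ≤ s)
    (hs : ∀ y ∈ Icc (0:ℝ) 1, ‖φ y‖ ≤ s) : |QQ V V2 lam δ φ| ≤ 3 * CP c₀ M * M * s * nH a φ φ1 := by
  have hd := (h.S.d2.mul h.dφ.normSq).ofReal
  have hp := Pbd (lam := lam) h.S h.L.hδ hd (by simp [h.φ0]) (by simp [h.φ1'])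
  have hCP := CP_nonneg h.S.c0 h.S.M1
  have ha := h.L.ha
  have h1 : n2 φ ≤ nH a φ φ1 := by nlinarith [an2_le_nH (a := a) φ φ1, n2_nonneg φ]
  have hn := n2_V2phi h.S h.dφ hs0 hs h1 (n2_le_nH _ _ _)
  have e : J (fun t => (mm V lam δ t : ℂ) * ((V2 t * ‖φ t‖ ^ 2 : ℝ) : ℂ)) = ((QQ V V2 lam δ φ : ℝ) : ℂ) := by
    unfold QQ
    rw [← J_ofReal]
    apply J_congr
    intro y _
    push_cast
    ring
  rw [e, Complex.norm_real, Real.norm_eq_abs] at hp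
  have := mul_le_mul_of_nonneg_left hn hCP
  linarith

lemma wA_le_sup (hS : Shear c₀ M V V1 V2 V3) (hδ : 0 < δ) {f : ℝ → ℂ} (hf : Continuous f) {s : ℝ} (hs0 : 0 ≤ s)
    (hs : ∀ y ∈ Icc (0:ℝ) 1, ‖f y‖ ≤ s) :
    Real.sqrt (wA V lam δ f) ≤ s * (Real.sqrt (Real.pi / c₀) / Real.sqrt δ) := by
  have hc := hS.c0
  have hr := (D1_rr (lam := lam) hS hδ).c
  rw [← Real.sqrt_div (by positivity), Real.sqrt_le_left (by positivity), mul_pow,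
    Real.sq_sqrt (by positivity)]
  have h1 : wA V lam δ f ≤ J (fun y => s ^ 2 * rr V lam δ y) := by
    refine J_mono (by fun_prop) (by fun_prop) fun y hy => ?_
    have := rr_pos (V := V) (lam := lam) hδ y
    have h2 := hs y hy
    rw [mul_comm]
    gcongr
  rw [J_cmul] at h1
  refine h1.trans ?_
  have := J_rr (lam := lam) hS hδ
  rw [div_div]
  gcongr

end sys

end OSP

namespace OSP

set_option maxHeartbeats 800000 in
lemma large_a {c₀ M : ℝ} (hc₀ : 0 < c₀) (hM : 1 ≤ M) : ∃ K C ε₁ : ℝ, 1 ≤ K ∧ 0 < C ∧ 0 < ε₁ ∧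
    ∀ {V V1 V2 V3 : ℝ → ℝ} {lam δ a σ ε : ℝ} {o : ℂ} {w w1 w2 φ φ1 G G1 : ℝ → ℂ},
    Sys c₀ M V V1 V2 V3 lam δ a σ ε o w w1 w2 φ φ1 G G1 → ε ≤ ε₁ → K ≤ a →
    nH a φ φ1 ≤ C * nH a G G1 := by
  obtain ⟨C0, ε₁, hC0, hε₁, _, hD⟩ := local_D hc₀ hM
  have hCP := CP_nonneg hc₀ hM
  have hpi := Real.pi_pos
  set P := Real.sqrt (Real.pi / c₀) with hP
  have hP0 : 0 ≤ P := Real.sqrt_nonneg _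
  set A := (2 + M + M ^ 2) * C0 * (2 * P + M) with hA
  have hA0 : 0 < A := by positivity
  set T := 12 * A * M + 24 * CP c₀ M * M + 1 with hT
  have hT1 : 1 ≤ T := by
    have : 0 ≤ 12 * A * M + 24 * CP c₀ M * M := by positivity
    linarith
  refine ⟨T ^ 2, 6 * CP c₀ M + 4 * A, ε₁, by nlinarith, by positivity, hε₁, ?_⟩
  intro V V1 V2 V3 lam δ a σ ε o w w1 w2 φ φ1 G G1 h hε hK
  have hδ := h.L.hδ
  have ha := h.L.ha
  have hd := hD h.S h.L hε
  have hN := h.nH_le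
  have h1 := h.main1
  have e0 := nH_nonneg a φ φ1
  have N0 := nH_nonneg a G G1
  have hsup : ∀ y ∈ Icc (0:ℝ) 1, ‖φ y‖ ≤ 2 * (nH a φ φ1 / Real.sqrt a) :=
    fun y hy => sup_nH ha h.dφ hy
  have hw := wA_le_sup (lam := lam) h.S hδ h.dφ.c (by positivity) hsup
  have hQ := h.QQ_le (by positivity) hsup
  have h1e := n2_le_nH a φ φ1
  have hκ := h.L.hκ
  set e := nH a φ φ1 with he
  set N := nH a G G1 with hNd
  set x := Real.sqrt a with hx
  set z := Real.sqrt δ with hz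
  have x0 : 0 < x := Real.sqrt_pos.2 (by linarith)
  have z0 : 0 < z := Real.sqrt_pos.2 hδ
  have hx2 : x ^ 2 = a := Real.sq_sqrt (by linarith)
  have hz2 : z ^ 2 = δ := Real.sq_sqrt hδ.le
  have hxT : T ≤ x := le_sq (by rw [hx2]; exact hK) x0.le
  have hxz : x * z ≤ M := by
    refine le_sq ?_ (by linarith)
    rw [mul_pow, hx2, hz2]
    nlinarith
  have hD0 : n2 w + δ * n2 w1 ≤ C0 * ((3 * M * e + 2 * N) / (x * z)) := by
    refine hd.trans ?_
    gcongr
  have hE : (2 + M + M ^ 2) * δ * ((n2 w + δ * n2 w1) * (Real.sqrt (wA V lam δ φ) + n2 φ1))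
      ≤ A * (3 * M * e + 2 * N) * e / x ^ 2 := by
    have hw0 := n2_nonneg w
    have hw10 := n2_nonneg w1
    have k0 := n2_nonneg φ1
    calc (2 + M + M ^ 2) * δ * ((n2 w + δ * n2 w1) * (Real.sqrt (wA V lam δ φ) + n2 φ1))
        ≤ (2 + M + M ^ 2) * δ * ((C0 * ((3 * M * e + 2 * N) / (x * z))) *
            (2 * (e / x) * (P / z) + e)) := by gcongr
      _ = (2 + M + M ^ 2) * C0 * (2 * P + x * z) * (3 * M * e + 2 * N) * e / x ^ 2 := by
          rw [← hz2]
          field_simp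
      _ ≤ _ := by
          rw [hA]
          gcongr
  have hmain : e ^ 2 ≤ 3 * CP c₀ M * N * e + A * (3 * M * e + 2 * N) * e / x ^ 2
      + 3 * CP c₀ M * M * (2 * (e / x)) * e := by
    have := (abs_le.1 h1).2
    have := (abs_le.1 hQ).1
    linarith
  have f1 : 3 * CP c₀ M * M * (2 * (e / x)) * e ≤ e ^ 2 / 4 := by
    rw [show 3 * CP c₀ M * M * (2 * (e / x)) * e = (6 * CP c₀ M * M) * e ^ 2 / x by ring,
      div_le_iff₀ x0]
    have : 24 * CP c₀ M * M ≤ x := by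
      have : 0 ≤ 12 * A * M := by positivity
      linarith
    have m1 := mul_le_mul_of_nonneg_right this (sq_nonneg e)
    linarith
  have f2 : A * (3 * M * e + 2 * N) * e / x ^ 2 ≤ e ^ 2 / 4 + 2 * A * N * e := by
    rw [div_le_iff₀ (by positivity)]
    have k1 : 12 * A * M ≤ x ^ 2 := by
      have : 0 ≤ 24 * CP c₀ M * M := by positivity
      nlinarith
    have k2 : 1 ≤ x ^ 2 := by nlinarith
    have k3 : 0 ≤ 2 * A * N * e := by positivity
    have m1 := mul_le_mul_of_nonneg_right k1 (sq_nonneg e)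
    have m2 := mul_le_mul_of_nonneg_left k2 k3
    linarith
  rcases e0.eq_or_lt with h0 | h0
  · rw [← h0]
    positivity
  · have : e * e ≤ ((6 * CP c₀ M + 4 * A) * N) * e := by linarith
    exact le_of_mul_le_mul_right this h0

/-- Normalized small system. -/
structure Nz (c₀ M K CD r : ℝ) (V V1 V2 V3 : ℝ → ℝ) (lam yc δ a σ ε : ℝ) (o : ℂ)
    (w w1 w2 φ φ1 G G1 : ℝ → ℂ) : Prop where
  sys : Sys c₀ M V V1 V2 V3 lam δ a σ ε o w w1 w2 φ φ1 G G1
  crit : Crit V c₀ lam yc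
  K1 : 1 ≤ K
  CD0 : 0 ≤ CD
  aK : a ≤ K
  r0 : 0 < r
  r1 : r ≤ 1
  δr : δ ≤ r ^ 4
  εr : ε ≤ r ^ 4
  Nr : nH a G G1 ≤ r ^ 4
  e1 : nH a φ φ1 ≤ 1
  hD : Real.sqrt δ * (n2 w + δ * n2 w1) ≤ CD

section nz
variable {V V1 V2 V3 : ℝ → ℝ} {c₀ M K CD r lam yc δ a σ ε : ℝ} {o : ℂ} {w w1 w2 φ φ1 G G1 : ℝ → ℂ}

lemma Nz.sqrt (h : Nz c₀ M K CD r V V1 V2 V3 lam yc δ a σ ε o w w1 w2 φ φ1 G G1) :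
    ∃ z, 0 < z ∧ z ≤ r ∧ δ = z ^ 4 ∧ Real.sqrt δ = z ^ 2 := by
  have hδ := h.sys.L.hδ
  refine ⟨Real.sqrt (Real.sqrt δ), by positivity, ?_, ?_, ?_⟩
  · have h1 := h.δr
    have h0 := h.r0
    rw [Real.sqrt_le_left h0.le, Real.sqrt_le_left (by positivity)]
    nlinarith
  · rw [show (4:ℕ) = 2 * 2 from rfl, pow_mul, Real.sq_sqrt (Real.sqrt_nonneg _), Real.sq_sqrt hδ.le]
  · rw [Real.sq_sqrt (Real.sqrt_nonneg _)]

lemma Nz.phi1 (h : Nz c₀ M K CD r V V1 V2 V3 lam yc δ a σ ε o w w1 w2 φ φ1 G G1) : n2 φ1 ≤ 1 :=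
  (n2_le_nH _ _ _).trans h.e1

lemma Nz.phi (h : Nz c₀ M K CD r V V1 V2 V3 lam yc δ a σ ε o w w1 w2 φ φ1 G G1) : n2 φ ≤ 1 :=
  (n2_le_deriv h.sys.dφ h.sys.φ0).trans h.phi1

lemma Nz.sup (h : Nz c₀ M K CD r V V1 V2 V3 lam yc δ a σ ε o w w1 w2 φ φ1 G G1) {y : ℝ}
    (hy : y ∈ Icc (0:ℝ) 1) : ‖φ y‖ ≤ 1 :=
  (h.sys.sup_le hy).trans h.e1

lemma Nz.supG (h : Nz c₀ M K CD r V V1 V2 V3 lam yc δ a σ ε o w w1 w2 φ φ1 G G1) {y : ℝ}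
    (hy : y ∈ Icc (0:ℝ) 1) : ‖G y‖ ≤ 2 * r ^ 4 :=
  (h.sys.supG_le hy).trans (by linarith [h.Nr])

lemma Nz.nG1 (h : Nz c₀ M K CD r V V1 V2 V3 lam yc δ a σ ε o w w1 w2 φ φ1 G G1) : n2 G1 ≤ r ^ 4 :=
  (n2_le_nH _ _ _).trans h.Nr

/-- Weighted bound for a function vanishing to half order. -/
lemma wA_holder (hS : Shear c₀ M V V1 V2 V3) (hδ : 0 < δ) (hC : Crit V c₀ lam yc) {f : ℝ → ℂ}
    (hf : Continuous f) {A B : ℝ} (hA : 0 ≤ A) (hB : 0 ≤ B)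
    (h : ∀ y ∈ Icc (0:ℝ) 1, ‖f y‖ ^ 2 ≤ A ^ 2 + B ^ 2 * |y - yc|) {z : ℝ} (hz : 0 < z) (hzδ : δ = z ^ 4) :
    z ^ 2 * Real.sqrt (wA V lam δ f) ≤ (4 / c₀) * (A + B * z) := by
  have hc := hS.c0
  have hc1 := hS.c1
  have hpi := Real.pi_pos
  have hr := (D1_rr (lam := lam) hS hδ).c
  have h1 : wA V lam δ f ≤ J (fun y => A ^ 2 * rr V lam δ y + B ^ 2 * (rr V lam δ y * |y - yc|)) := by
    refine J_mono (by fun_prop) (by fun_prop) fun y hy => ?_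
    have := rr_pos (V := V) (lam := lam) hδ y
    have h2 := h y hy
    nlinarith
  rw [J_add (by fun_prop) (by fun_prop), J_cmul, J_cmul] at h1
  have h2 := J_rr (lam := lam) hS hδ
  have h3 := J_rr_dist hS hδ hC
  have h4 : Real.sqrt (Real.pi / (c₀ * δ)) ≤ 2 / (c₀ * z ^ 2) := by
    rw [Real.sqrt_le_left (by positivity), hzδ, div_pow, div_le_div_iff₀ (by positivity) (by positivity)]
    have h5 : Real.pi ≤ 4 := Real.pi_le_four
    have h6 : c₀ ^ 2 ≤ c₀ := by nlinarith
    have : 0 < z ^ 4 := by positivity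
    calc Real.pi * (c₀ * z ^ 2) ^ 2 = Real.pi * (c₀ ^ 2 * z ^ 4) := by ring
      _ ≤ 4 * (c₀ * z ^ 4) := by gcongr
      _ = _ := by ring
  have h7 : J (fun y => rr V lam δ y * |y - yc|) ≤ 2 / (c₀ ^ 2 * z ^ 2) := by
    have : J (fun y => rr V lam δ y * |y - yc|) ≤ (2 / (c₀ * z ^ 2)) / c₀ := by
      rw [le_div_iff₀ hc]
      linarith
    refine this.trans (le_of_eq ?_)
    field_simp
  have h8 : J (rr V lam δ) ≤ 4 / (c₀ ^ 2 * z ^ 4) := by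
    refine h2.trans ?_
    rw [hzδ]
    have h6 : c₀ ^ 2 ≤ c₀ := by nlinarith
    have := Real.pi_le_four
    gcongr
  refine le_sq ?_ (by positivity)
  rw [mul_pow, Real.sq_sqrt (wA_nonneg hδ f)]
  calc (z ^ 2) ^ 2 * wA V lam δ f ≤ (z ^ 2) ^ 2 * (A ^ 2 * (4 / (c₀ ^ 2 * z ^ 4)) + B ^ 2 * (2 / (c₀ ^ 2 * z ^ 2))) := by
        have := mul_le_mul_of_nonneg_left h8 (sq_nonneg A)
        have := mul_le_mul_of_nonneg_left h7 (sq_nonneg B)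
        have : 0 ≤ (z ^ 2) ^ 2 := by positivity
        gcongr
        linarith
    _ = (4 * A ^ 2 + 2 * B ^ 2 * z ^ 2) / c₀ ^ 2 := by
        field_simp
    _ ≤ (4 / c₀ * (A + B * z)) ^ 2 := by
        rw [mul_pow, div_pow, div_mul_eq_mul_div]
        gcongr
        nlinarith [mul_nonneg hA (mul_nonneg hB hz.le), sq_nonneg (B * z), sq_nonneg A]

lemma D1.holder2 {f f1 : ℝ → ℂ} (hf : D1 f f1) {p q : ℝ} (hp : p ∈ Icc (0:ℝ) 1) (hq : q ∈ Icc (0:ℝ) 1) :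
    ‖f q‖ ^ 2 ≤ 2 * ‖f p‖ ^ 2 + 2 * (|q - p| * n2 f1 ^ 2) := by
  have h1 := hf.holder hp hq
  have h2 : ‖f q‖ ≤ ‖f q - f p‖ + ‖f p‖ := by
    simpa using norm_add_le (f q - f p) (f p)
  nlinarith [norm_nonneg (f q), sq_nonneg (‖f q - f p‖ - ‖f p‖), pow_le_pow_left₀ (norm_nonneg (f q)) h2 2]

/-- Error in the weak formulation. -/
lemma Nz.err (h : Nz c₀ M K CD r V V1 V2 V3 lam yc δ a σ ε o w w1 w2 φ φ1 G G1) {f : ℝ → ℂ}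
    (hf : Continuous f) {A B F1 F : ℝ} (hA : 0 ≤ A) (hB : 0 ≤ B) (hF : 0 ≤ F) (hF1 : F1 ≤ F)
    (hh : ∀ y ∈ Icc (0:ℝ) 1, ‖f y‖ ^ 2 ≤ A ^ 2 + B ^ 2 * |y - yc|) :
    (2 + M + M ^ 2) * δ * ((n2 w + δ * n2 w1) * (Real.sqrt (wA V lam δ f) + F1))
      ≤ (2 + M + M ^ 2) * CD * (4 / c₀) * (A + (B + F) * r) := by
  obtain ⟨z, z0, zr, hz4, hz2⟩ := h.sqrt
  have hM := h.sys.S.M1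
  have hc := h.sys.S.c0
  have hc1 := h.sys.S.c1
  have hd := h.hD
  rw [hz2] at hd
  have hw := wA_holder (lam := lam) h.sys.S h.sys.L.hδ h.crit hf hA hB hh z0 hz4
  have hw0 := n2_nonneg w
  have hw10 := n2_nonneg w1
  have hδ := h.sys.L.hδ
  have h0 : 0 ≤ n2 w + δ * n2 w1 := by positivity
  have hs := Real.sqrt_nonneg (wA V lam δ f)
  have hCD := h.CD0
  have hr0 := h.r0
  have k1 : z ^ 2 * (Real.sqrt (wA V lam δ f) + F1) ≤ (4 / c₀) * (A + (B + F) * r) := by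
    have e1 : z ^ 2 * F1 ≤ (4 / c₀) * (F * r) := by
      have : 1 ≤ 4 / c₀ := by rw [le_div_iff₀ hc]; linarith
      have hz1 : z ^ 2 ≤ r := by nlinarith [h.r1]
      calc z ^ 2 * F1 ≤ z ^ 2 * F := by gcongr
        _ ≤ r * F := by gcongr
        _ = 1 * (F * r) := by ring
        _ ≤ _ := by gcongr
    have e2 : (4 / c₀) * (A + B * z) ≤ (4 / c₀) * (A + B * r) := by gcongr
    have e3 : (4 / c₀) * (A + (B + F) * r) = (4 / c₀) * (A + B * r) + (4 / c₀) * (F * r) := by ring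
    rw [e3]
    linarith
  calc (2 + M + M ^ 2) * δ * ((n2 w + δ * n2 w1) * (Real.sqrt (wA V lam δ f) + F1))
      = (2 + M + M ^ 2) * ((z ^ 2 * (n2 w + δ * n2 w1)) * (z ^ 2 * (Real.sqrt (wA V lam δ f) + F1))) := by
        rw [hz4]; ring
    _ ≤ (2 + M + M ^ 2) * (CD * ((4 / c₀) * (A + (B + F) * r))) := by
        have : 0 ≤ (4 / c₀) * (A + (B + F) * r) := by positivity
        have k2 : (z ^ 2 * (n2 w + δ * n2 w1)) * (z ^ 2 * (Real.sqrt (wA V lam δ f) + F1)) ≤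
            (z ^ 2 * (n2 w + δ * n2 w1)) * ((4 / c₀) * (A + (B + F) * r)) := by gcongr
        have k3 : (z ^ 2 * (n2 w + δ * n2 w1)) * ((4 / c₀) * (A + (B + F) * r)) ≤
            CD * ((4 / c₀) * (A + (B + F) * r)) := by gcongr
        exact mul_le_mul_of_nonneg_left (k2.trans k3) (by positivity)
    _ = _ := by ring

end nz

end OSP

namespace OSP

section nz
variable {V V1 V2 V3 : ℝ → ℝ} {c₀ M K CD r lam yc δ a σ ε : ℝ} {o : ℂ} {w w1 w2 φ φ1 G G1 : ℝ → ℂ}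

/-- Constant. -/
def CE (c₀ M CD : ℝ) : ℝ := 3 * CP c₀ M + 3 * ((2 + M + M ^ 2) * CD * (4 / c₀))

lemma CE_nonneg (hc : 0 < c₀) (hM : 1 ≤ M) (hCD : 0 ≤ CD) : 0 ≤ CE c₀ M CD := by
  have := CP_nonneg hc hM
  unfold CE
  positivity

lemma Nz.E1 (h : Nz c₀ M K CD r V V1 V2 V3 lam yc δ a σ ε o w w1 w2 φ φ1 G G1) :
    |nH a φ φ1 ^ 2 + QQ V V2 lam δ φ| ≤ CE c₀ M CD * (‖φ yc‖ + r) := by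
  have h1 := h.sys.main1
  have hCP := CP_nonneg h.sys.S.c0 h.sys.S.M1
  have hM := h.sys.S.M1
  have hc := h.sys.S.c0
  have hCD := h.CD0
  have hr := h.r0
  have herr := h.err (A := 2 * ‖φ yc‖) (B := 2) (F1 := n2 φ1) (F := 1) h.sys.dφ.c (by positivity)
    (by norm_num) zero_le_one h.phi1 (by
      intro y hy
      have := h.sys.dφ.holder2 h.crit.mem hy
      have h2 := h.phi1
      have h3 := n2_nonneg φ1
      have h4 : n2 φ1 ^ 2 ≤ 1 := by nlinarith
      have h5 := abs_nonneg (y - yc)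
      nlinarith [mul_le_mul_of_nonneg_left h4 h5, sq_nonneg ‖φ yc‖])
  have h2 : 3 * CP c₀ M * nH a G G1 * nH a φ φ1 ≤ 3 * CP c₀ M * r := by
    have e0 := nH_nonneg a φ φ1
    have N0 := nH_nonneg a G G1
    have e1 := h.e1
    have N1 := h.Nr
    have : nH a G G1 * nH a φ φ1 ≤ r * 1 := by
      have : r ^ 4 ≤ r := by
        have := pow_le_pow_of_le_one hr.le h.r1 (show 1 ≤ 4 by norm_num)
        simpa using this
      gcongr
      linarith
    nlinarith
  set B := (2 + M + M ^ 2) * CD * (4 / c₀) with hB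
  have hB0 : 0 ≤ B := by positivity
  have h3 : CE c₀ M CD * (‖φ yc‖ + r) = 3 * CP c₀ M * (‖φ yc‖ + r) + 3 * (B * (‖φ yc‖ + r)) := by
    unfold CE; ring
  rw [h3]
  have h4 : 0 ≤ CP c₀ M * ‖φ yc‖ := by positivity
  have h5 : 0 ≤ B * ‖φ yc‖ := by positivity
  nlinarith

lemma fin_lemma (hc : 0 < c₀) (hM : 1 ≤ M) (hCD : 0 ≤ CD) : ∃ κ : ℝ, 0 < κ ∧
    ∀ {V V1 V2 V3 : ℝ → ℝ} {K r lam yc δ a σ ε : ℝ} {o : ℂ} {w w1 w2 φ φ1 G G1 : ℝ → ℂ},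
    Nz c₀ M K CD r V V1 V2 V3 lam yc δ a σ ε o w w1 w2 φ φ1 G G1 →
    ‖φ yc‖ ≤ κ → -κ ≤ n2 φ1 ^ 2 + QQ V V2 lam δ φ → r ≤ κ → nH a φ φ1 < 1 := by
  have hCE := CE_nonneg hc hM hCD
  have hCP := CP_nonneg hc hM
  set E := CE c₀ M CD with hE
  set L := 2 * E + 1 with hL
  set T := 2 * E + 6 * CP c₀ M * M * L + 1 with hT
  have hL1 : 1 ≤ L := by linarith
  have hT0 : 1 ≤ T := by
    have : 0 ≤ 2 * E + 6 * CP c₀ M * M * L := by positivity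
    linarith
  set t := 1 / (2 * T) with ht
  have t0 : 0 < t := by positivity
  have tT : T * t = 1 / 2 := by rw [ht]; field_simp
  have t1 : t ≤ 1 := by nlinarith
  refine ⟨t ^ 4, by positivity, ?_⟩
  intro V V1 V2 V3 K r lam yc δ a σ ε o w w1 w2 φ φ1 G G1 h h1 h2 h3
  have ha := h.sys.L.ha
  have hE1 := (abs_le.1 h.E1).2
  have k1 : E * (‖φ yc‖ + r) ≤ E * (t ^ 4 + t ^ 4) := by gcongr
  have k2 := nH_sq a φ φ1
  have n0 := n2_nonneg φ
  have k3 : n2 φ ^ 2 ≤ L * t ^ 4 := by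
    have : n2 φ ^ 2 ≤ a ^ 2 * n2 φ ^ 2 := le_mul_of_one_le_left (sq_nonneg _) (by nlinarith)
    rw [hL]
    linarith
  have k4 : n2 φ ≤ L * t ^ 2 := by
    refine le_sq (k3.trans ?_) (by positivity)
    rw [mul_pow, ← pow_mul]
    have : L ≤ L ^ 2 := by nlinarith
    gcongr
  have k5 : ∀ y ∈ Icc (0:ℝ) 1, ‖φ y‖ ≤ 2 * L * t := by
    intro y hy
    refine le_sq ((h.sys.dφ.sup0 h.sys.φ0 hy).trans ?_) (by positivity)
    have := h.phi1
    have k6 : n2 φ * n2 φ1 ≤ L * t ^ 2 * 1 := by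
      gcongr
      exact n2_nonneg φ1
    have : L * t ^ 2 ≤ L ^ 2 * t ^ 2 := by
      have : L ≤ L ^ 2 := by nlinarith
      gcongr
    nlinarith [sq_nonneg (L * t)]
  have k7 := h.sys.QQ_le (by positivity) k5
  have e0 := nH_nonneg a φ φ1
  have k8 : 3 * CP c₀ M * M * (2 * L * t) * nH a φ φ1 ≤ 6 * CP c₀ M * M * L * t := by
    have : 0 ≤ 6 * CP c₀ M * M * L * t := by positivity
    have e1 := h.e1
    nlinarith
  have k9 := (abs_le.1 k7).1
  have k10 : t ^ 4 ≤ t := by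
    have := pow_le_pow_of_le_one t0.le t1 (show 1 ≤ 4 by norm_num)
    simpa using this
  have k11 : nH a φ φ1 ^ 2 ≤ 1 / 2 := by
    have : E * (t ^ 4 + t ^ 4) ≤ E * (t + t) := by gcongr
    have : T * t = E * (t + t) + 6 * CP c₀ M * M * L * t + t := by rw [hT]; ring
    linarith
  nlinarith

/-- Positivity on a subinterval without critical point. -/
lemma POS (hS : Shear c₀ M V V1 V2 V3) {f f1 : ℝ → ℂ} (hf : D1 f f1) {p q s : ℝ} (hp : 0 ≤ p)
    (hpq : p ≤ q) (hq : q ≤ 1) (fp : f p = 0) (fq : f q = 0) (hs : ∀ y ∈ Icc p q, V y - s ≠ 0) :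
    0 ≤ ∫ y in p..q, (‖f1 y‖ ^ 2 + V2 y / (V y - s) * ‖f y‖ ^ 2) := by
  have c1 := hf.c
  have c2 := hf.c'
  have cV := hS.d0.c
  have cV1 := hS.d1.c
  have cV2 := hS.d2.c
  have cn := hf.normSq.c'
  have cUi : ContinuousOn (fun y => (V y - s)⁻¹) (Icc p q) :=
    ContinuousOn.inv₀ (by fun_prop) hs
  set g : ℝ → ℝ := fun y => V1 y * ‖f y‖ ^ 2 * (V y - s)⁻¹ with hg
  set g1 : ℝ → ℝ := fun y => (V2 y * ‖f y‖ ^ 2 + V1 y * (2 * (f1 y * (starRingEnd ℂ) (f y)).re)) * (V y - s)⁻¹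
    + V1 y * ‖f y‖ ^ 2 * (-V1 y / (V y - s) ^ 2) with hg1
  have cg1 : ContinuousOn g1 (Icc p q) := by
    have e : g1 = fun y => (V2 y * ‖f y‖ ^ 2 + V1 y * (2 * (f1 y * (starRingEnd ℂ) (f y)).re)) * (V y - s)⁻¹
      + V1 y * ‖f y‖ ^ 2 * (-V1 y * ((V y - s)⁻¹ * (V y - s)⁻¹)) := by
      rw [hg1]; funext y; rw [div_eq_mul_inv, sq (V y - s), mul_inv]
    rw [e]
    fun_prop
  have hder : ∀ x ∈ Ioo p q, HasDerivAt g (g1 x) x := by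
    intro x hx
    have hx' : x ∈ Ioo (0:ℝ) 1 := ⟨lt_of_le_of_lt hp hx.1, lt_of_lt_of_le hx.2 hq⟩
    have d1 := (hS.d1.d x hx').mul (hf.normSq.d x hx')
    have d2 := ((hS.d0.d x hx').sub_const s).inv (hs x ⟨hx.1.le, hx.2.le⟩)
    exact d1.mul d2
  have hIntA : IntervalIntegrable g1 volume p q := by
    apply ContinuousOn.intervalIntegrable
    rwa [uIcc_of_le hpq]
  have hF := intervalIntegral.integral_eq_sub_of_hasDerivAt_of_le hpq
    (by rw [hg]; fun_prop) hder hIntA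
  have g0 : g q - g p = 0 := by simp [hg, fp, fq]
  rw [g0] at hF
  have cc : ContinuousOn (fun y => ‖f1 y‖ ^ 2 + V2 y / (V y - s) * ‖f y‖ ^ 2) (Icc p q) := by
    simp only [div_eq_mul_inv]
    fun_prop
  have hIntB : IntervalIntegrable (fun y => ‖f1 y‖ ^ 2 + V2 y / (V y - s) * ‖f y‖ ^ 2) volume p q := by
    apply ContinuousOn.intervalIntegrable
    rwa [uIcc_of_le hpq]
  have hd := intervalIntegral.integral_sub hIntB hIntA
  rw [hF, sub_zero] at hd
  rw [← hd]
  apply intervalIntegral.integral_nonneg hpq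
  intro y hy
  have hU := hs y hy
  have key : ‖f1 y‖ ^ 2 + V2 y / (V y - s) * ‖f y‖ ^ 2 - g1 y =
      ‖f1 y‖ ^ 2 - 2 * (V1 y / (V y - s)) * (f1 y * (starRingEnd ℂ) (f y)).re
        + (V1 y / (V y - s)) ^ 2 * ‖f y‖ ^ 2 := by
    simp only [hg1]
    field_simp
    ring
  rw [key]
  set t := V1 y / (V y - s) with ht
  have k1 := Complex.abs_re_le_norm (f1 y * (starRingEnd ℂ) (f y))
  rw [norm_mul, RCLike.norm_conj] at k1
  have k2 : t * (f1 y * (starRingEnd ℂ) (f y)).re ≤ |t| * (‖f1 y‖ * ‖f y‖) := by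
    refine (le_abs_self _).trans ?_
    rw [abs_mul]
    gcongr
  nlinarith [sq_nonneg (‖f1 y‖ - |t| * ‖f y‖), sq_abs t]

lemma bdry (hS : Shear c₀ M V V1 V2 V3) (hδ : 0 < δ) (hC : Crit V c₀ lam yc) (hφ : D1 φ φ1)
    (φ0 : φ 0 = 0) (φ1' : φ 1 = 0) (hn : n2 φ1 ≤ 1) {z z' : ℝ → ℝ} {s yb τ : ℝ} (hz : D1 z z')
    (z0 : ∀ t, 0 < z t) (hs : ∀ t, V t - s ≠ 0) (hq : ∀ t, z' t / z t = V1 t / (V t - s))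
    (hyb : yb ∈ Icc (0:ℝ) 1) (zl : ∀ t ∈ Icc (0:ℝ) 1, c₀ / 2 * (|t - yb| + δ) ≤ z t)
    (hxz : ∀ t ∈ Icc (0:ℝ) 1, |UU V lam δ t - z t| ≤ τ) :
    -(CL c₀ M (c₀ / 2) * Real.sqrt (Real.sqrt τ) * (3 * M)) ≤ n2 φ1 ^ 2 + QQ V V2 lam δ φ := by
  have hc := hS.c0
  have hM := hS.M1
  have c1 := hφ.c
  have c2 := hφ.c'
  have cV := hS.d0.c
  have cV2 := hS.d2.c
  have cm := (D1_mm (lam := lam) hS hδ).c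
  have cUi : Continuous (fun y => (V y - s)⁻¹) := Continuous.inv₀ (by fun_prop) hs
  have key := LOG hS (by positivity : 0 < c₀ / 2) (l := fun t => mm V lam δ t - (V t - s)⁻¹) hδ
    (UU_D1 (lam := lam) hS hδ) hz (UU_pos hδ) z0 hC.mem hyb (fun t ht => UU_low hS hδ hC ht) zl hxz
    (fun t => by rw [UU_quot hδ, hq, mul_sub, div_eq_mul_inv])
    (hS.d2.mul hφ.normSq).ofReal (by simp [φ0]) (by simp [φ1'])
  have hsup : ∀ y ∈ Icc (0:ℝ) 1, ‖φ y‖ ≤ 1 := fun y hy => (sup_le_deriv hφ φ0 hy).trans hn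
  have hn2 := n2_V2phi hS hφ zero_le_one hsup ((n2_le_deriv hφ φ0).trans hn) hn
  have hp := POS hS hφ le_rfl zero_le_one le_rfl φ0 φ1' (s := s) (fun y _ => hs y)
  have hp' : 0 ≤ J (fun y => ‖φ1 y‖ ^ 2 + V2 y / (V y - s) * ‖φ y‖ ^ 2) := hp
  simp only [div_eq_mul_inv] at hp'
  rw [J_add (by fun_prop) (by fun_prop), ← n2_sq] at hp'
  have e : J (fun t => (((mm V lam δ t - (V t - s)⁻¹ : ℝ)) : ℂ) * ((V2 t * ‖φ t‖ ^ 2 : ℝ) : ℂ)) =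
      ((QQ V V2 lam δ φ - J (fun y => V2 y * (V y - s)⁻¹ * ‖φ y‖ ^ 2) : ℝ) : ℂ) := by
    unfold QQ
    rw [← J_sub (by fun_prop) (by fun_prop), ← J_ofReal]
    apply J_congr
    intro y _
    push_cast
    ring
  rw [e, Complex.norm_real, Real.norm_eq_abs] at key
  have hCL : 0 ≤ CL c₀ M (c₀ / 2) * Real.sqrt (Real.sqrt τ) := by
    unfold CL
    positivity
  have k1 := mul_le_mul_of_nonneg_left hn2 hCL
  have k2 := (abs_le.1 key).1
  linarith

lemma bdry_left (hS : Shear c₀ M V V1 V2 V3) (hδ : 0 < δ) (hC : Crit V c₀ lam yc) (hφ : D1 φ φ1)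
    (φ0 : φ 0 = 0) (φ1' : φ 1 = 0) (hn : n2 φ1 ≤ 1) {τ : ℝ} (hτ : 0 ≤ τ) (hl : lam ≤ V 0 + τ) :
    -(CL c₀ M (c₀ / 2) * Real.sqrt (Real.sqrt (τ + δ)) * (3 * M)) ≤ n2 φ1 ^ 2 + QQ V V2 lam δ φ := by
  have hp : ∀ t, 0 < V t - (min lam (V 0) - δ) := fun t => by
    have := hS.vlo t
    have := min_le_right lam (V 0)
    linarith
  have hc := hS.c0
  have hc1 := hS.c1
  refine bdry hS hδ hC hφ φ0 φ1' hn (z := fun t => V t - (min lam (V 0) - δ)) (z' := fun t => V1 t)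
    (s := min lam (V 0) - δ) (yb := 0) ((hS.d0.sub (D1.const _)).congr' (by simp)) hp
    (fun t => (hp t).ne') (fun t => rfl) ⟨le_rfl, zero_le_one⟩ ?_ ?_
  · intro t ht
    have h1 := hS.growth le_rfl ht.1 ht.2
    have := min_le_right lam (V 0)
    rw [sub_zero, abs_of_nonneg ht.1]
    nlinarith [ht.1]
  · intro t ht
    have h1 := UU_le (V := V) (lam := lam) hδ t
    have h2 := UU_ge_abs (V := V) (lam := lam) (δ := δ) t
    have h3 := hS.vlo t
    have h4 := le_abs_self (V t - lam)
    have h5 := neg_le_abs (V t - lam)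
    have h6 : |V t - lam| ≤ V t - min lam (V 0) + τ := by
      rw [abs_le]
      rcases le_total lam (V 0) with h | h
      · rw [min_eq_left h]; constructor <;> linarith
      · rw [min_eq_right h]; constructor <;> linarith
    have h7 : V t - min lam (V 0) ≤ |V t - lam| + τ := by
      rcases le_total lam (V 0) with h | h
      · rw [min_eq_left h]; linarith
      · rw [min_eq_right h]; linarith
    rw [abs_le]
    constructor <;> linarith

lemma bdry_right (hS : Shear c₀ M V V1 V2 V3) (hδ : 0 < δ) (hC : Crit V c₀ lam yc) (hφ : D1 φ φ1)
    (φ0 : φ 0 = 0) (φ1' : φ 1 = 0) (hn : n2 φ1 ≤ 1) {τ : ℝ} (hτ : 0 ≤ τ) (hl : V 1 - τ ≤ lam) :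
    -(CL c₀ M (c₀ / 2) * Real.sqrt (Real.sqrt (τ + δ)) * (3 * M)) ≤ n2 φ1 ^ 2 + QQ V V2 lam δ φ := by
  have hp : ∀ t, 0 < (max lam (V 1) + δ) - V t := fun t => by
    have := hS.vhi t
    have := le_max_right lam (V 1)
    linarith
  have hc := hS.c0
  have hc1 := hS.c1
  refine bdry hS hδ hC hφ φ0 φ1' hn (z := fun t => (max lam (V 1) + δ) - V t) (z' := fun t => -V1 t)
    (s := max lam (V 1) + δ) (yb := 1) (((D1.const _).sub hS.d0).congr' (by simp)) hp
    (fun t => by have := hp t; intro h; linarith) (fun t => ?_) ⟨zero_le_one, le_rfl⟩ ?_ ?_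
  · rw [← neg_sub (V t), neg_div_neg_eq]
  · intro t ht
    have h1 := hS.growth ht.1 ht.2 le_rfl
    have := le_max_right lam (V 1)
    rw [abs_of_nonpos (by linarith [ht.2])]
    nlinarith [ht.2]
  · intro t ht
    have h1 := UU_le (V := V) (lam := lam) hδ t
    have h2 := UU_ge_abs (V := V) (lam := lam) (δ := δ) t
    have h3 := hS.vhi t
    have h4 := le_abs_self (V t - lam)
    have h5 := neg_le_abs (V t - lam)
    have h6 : |V t - lam| ≤ max lam (V 1) - V t + τ := by
      rw [abs_le]
      rcases le_total lam (V 1) with h | h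
      · rw [max_eq_right h]; constructor <;> linarith
      · rw [max_eq_left h]; constructor <;> linarith
    have h7 : max lam (V 1) - V t ≤ |V t - lam| + τ := by
      rcases le_total lam (V 1) with h | h
      · rw [max_eq_right h]; linarith
      · rw [max_eq_left h]; linarith
    rw [abs_le]
    constructor <;> linarith

end nz

end OSP

namespace OSP

section intB
variable {V V1 V2 V3 : ℝ → ℝ} {c₀ M K CD r lam yc δ a σ ε : ℝ} {o : ℂ} {w w1 w2 φ φ1 G G1 : ℝ → ℂ}

lemma mm_shift (hδ : 0 < δ) {t : ℝ} (ht : |t| = δ) {y : ℝ} (hy : t * (V y - lam) ≤ 0) :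
    V y - (lam + t) ≠ 0 ∧ |(V y - (lam + t))⁻¹ - mm V lam δ y| ≤ δ * rr V lam δ y := by
  have ht2 : t ^ 2 = δ ^ 2 := by rw [← sq_abs, ht]
  set x := V y - lam with hx
  have e : V y - (lam + t) = x - t := by rw [hx]; ring
  have hd : 0 < x ^ 2 + δ ^ 2 := by positivity
  have hne : x - t ≠ 0 := by
    intro h
    have : x = t := by linarith
    rw [this] at hy
    nlinarith
  rw [e]
  refine ⟨hne, ?_⟩
  have e2 : (x - t)⁻¹ - mm V lam δ y = t * ((x + t) / (x - t)) * rr V lam δ y := by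
    unfold mm rr
    rw [← hx]
    field_simp
    linear_combination (-1) * ht2
  rw [e2, abs_mul, abs_mul, ht, abs_of_pos (rr_pos hδ y)]
  have h1 : |(x + t) / (x - t)| ≤ 1 := by
    rw [abs_div, div_le_one (abs_pos.2 hne)]
    apply sq_le_sq.1
    nlinarith
  have := rr_pos (V := V) (lam := lam) hδ y
  nlinarith [mul_le_mul_of_nonneg_left h1 (mul_pos hδ this).le]

lemma POS2 (hS : Shear c₀ M V V1 V2 V3) (hδ : 0 < δ) {f f1 : ℝ → ℂ} (hf : D1 f f1) {p q t : ℝ}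
    (hp : 0 ≤ p) (hpq : p ≤ q) (hq : q ≤ 1) (fp : f p = 0) (fq : f q = 0) (ht : |t| = δ)
    (hs : ∀ y ∈ Icc p q, t * (V y - lam) ≤ 0) :
    0 ≤ ∫ y in p..q, (‖f1 y‖ ^ 2 + (mm V lam δ y * (V2 y * ‖f y‖ ^ 2)
      + M * δ * (rr V lam δ y * ‖f y‖ ^ 2))) := by
  have h1 := POS hS hf hp hpq hq fp fq (s := lam + t) (fun y hy => (mm_shift hδ ht (hs y hy)).1)
  have c1 := hf.c
  have c2 := hf.c'
  have cV := hS.d0.c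
  have cV2 := hS.d2.c
  have cm := (D1_mm (lam := lam) hS hδ).c
  have hr := (D1_rr (lam := lam) hS hδ).c
  have cUi : ContinuousOn (fun y => (V y - (lam + t))⁻¹) (Icc p q) :=
    ContinuousOn.inv₀ (by fun_prop) (fun y hy => (mm_shift hδ ht (hs y hy)).1)
  refine h1.trans (intervalIntegral.integral_mono_on hpq ?_ (Continuous.intervalIntegrable (by fun_prop) _ _) ?_)
  · apply ContinuousOn.intervalIntegrable
    rw [uIcc_of_le hpq]
    simp only [div_eq_mul_inv]
    fun_prop
  · intro y hy
    have h2 := (mm_shift hδ ht (hs y hy)).2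
    have h3 := hS.b2 y
    have h4 : V2 y * ((V y - (lam + t))⁻¹ - mm V lam δ y) ≤ M * (δ * rr V lam δ y) := by
      refine (le_abs_self _).trans ?_
      rw [abs_mul]
      have := hS.M1
      gcongr
    have h5 := mul_le_mul_of_nonneg_right h4 (sq_nonneg ‖f y‖)
    rw [div_eq_mul_inv]
    nlinarith

lemma POS3 (hS : Shear c₀ M V V1 V2 V3) (hδ : 0 < δ) (hy : yc ∈ Icc (0:ℝ) 1) (hV : V yc = lam)
    {f f1 : ℝ → ℂ} (hf : D1 f f1) (f0 : f 0 = 0) (f1' : f 1 = 0) (fc : f yc = 0) :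
    0 ≤ n2 f1 ^ 2 + QQ V V2 lam δ f + M * δ * wA V lam δ f := by
  have hc := hS.c0
  have c1 := hf.c
  have c2 := hf.c'
  have cV2 := hS.d2.c
  have cm := (D1_mm (lam := lam) hS hδ).c
  have hr := (D1_rr (lam := lam) hS hδ).c
  have h1 := POS2 (lam := lam) hS hδ hf le_rfl hy.1 hy.2 f0 fc (t := δ) (abs_of_pos hδ) (by
    intro y h
    have := hS.growth h.1 h.2 hy.2
    have : c₀ * (yc - y) ≥ 0 := mul_nonneg hc.le (by linarith [h.2])
    have : V y - lam ≤ 0 := by linarith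
    nlinarith)
  have h2 := POS2 (lam := lam) hS hδ hf hy.1 hy.2 le_rfl fc f1' (t := -δ) (by rw [abs_neg, abs_of_pos hδ]) (by
    intro y h
    have := hS.growth hy.1 h.1 h.2
    have : c₀ * (y - yc) ≥ 0 := mul_nonneg hc.le (by linarith [h.1])
    have : 0 ≤ V y - lam := by linarith
    nlinarith)
  have h3 := add_nonneg h1 h2
  rw [intervalIntegral.integral_add_adjacent_intervals (Continuous.intervalIntegrable (by fun_prop) _ _)
    (Continuous.intervalIntegrable (by fun_prop) _ _)] at h3
  have h4 : 0 ≤ J (fun y => ‖f1 y‖ ^ 2 + (mm V lam δ y * (V2 y * ‖f y‖ ^ 2)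
      + M * δ * (rr V lam δ y * ‖f y‖ ^ 2))) := h3
  rw [J_add (by fun_prop) (by fun_prop), J_add (by fun_prop) (by fun_prop), J_cmul, ← n2_sq] at h4
  unfold QQ wA
  linarith

set_option maxHeartbeats 1000000 in
/-- Interior positivity up to the value of `φ` at the critical point. -/
lemma Nz.intB (h : Nz c₀ M K CD r V V1 V2 V3 lam yc δ a σ ε o w w1 w2 φ φ1 G G1) (hV : V yc = lam)
    {b g : ℝ} (hb : 0 < b) (hyb : b ≤ yc * (1 - yc)) (hg : g ≤ 1) (hφ : ‖φ yc‖ ≤ g * b) :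
    -((3 + 12 * CP c₀ M * M) * g + 64 * M / c₀ ^ 2 * r) ≤ n2 φ1 ^ 2 + QQ V V2 lam δ φ := by
  obtain ⟨z, z0, zr, hz4, hz2⟩ := h.sqrt
  have hS := h.sys.S
  have hδ := h.sys.L.hδ
  have hM := hS.M1
  have hc := hS.c0
  have hyc := h.crit.mem
  have g0 : 0 ≤ g := by
    by_contra hh
    have : g * b < 0 := mul_neg_of_neg_of_pos (by linarith) hb
    linarith [norm_nonneg (φ yc)]
  set cc : ℂ := φ yc / ((yc * (1 - yc) : ℝ) : ℂ) with hcc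
  have hyp : 0 < yc * (1 - yc) := by linarith
  have ccg : ‖cc‖ ≤ g := by
    rw [hcc, norm_div, Complex.norm_real, Real.norm_eq_abs, abs_of_pos hyp, div_le_iff₀ hyp]
    refine hφ.trans (by gcongr)
  have dq0 : D1 (fun y : ℝ => y * (1 - y)) (fun y => 1 - 2 * y) :=
    (D1.id.mul ((D1.const 1).sub D1.id)).congr' (fun y => by ring)
  have dq := dq0.ofReal
  have df : D1 (fun y => φ y - cc * ((y * (1 - y) : ℝ) : ℂ)) (fun y => φ1 y - cc * ((1 - 2 * y : ℝ) : ℂ)) :=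
    (h.sys.dφ.sub ((D1.const cc).mul dq)).congr' (fun y => by simp)
  set f : ℝ → ℂ := fun y => φ y - cc * ((y * (1 - y) : ℝ) : ℂ) with hf
  set f1 : ℝ → ℂ := fun y => φ1 y - cc * ((1 - 2 * y : ℝ) : ℂ) with hf1
  have f0 : f 0 = 0 := by simp [hf, h.sys.φ0]
  have f1' : f 1 = 0 := by simp [hf, h.sys.φ1']
  have fc : f yc = 0 := by
    simp only [hf, hcc]
    rw [div_mul_cancel₀]
    · ring
    · exact_mod_cast hyp.ne'
  have cφ := h.sys.dφ.c
  have cφ1 := h.sys.dφ.c'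
  have cf := df.c
  have cf1 := df.c'
  have nf1 : n2 f1 ≤ n2 φ1 + g := by
    have := n2_le_add (f := f1) (α := 1) (β := 1) (g := φ1) (h := fun _ : ℝ => g) cf1 cφ1 continuous_const
      zero_le_one zero_le_one (fun y hy => by
        rw [one_mul, one_mul, Real.norm_eq_abs, abs_of_nonneg g0]
        refine (norm_sub_le _ _).trans ?_
        gcongr
        rw [norm_mul, Complex.norm_real, Real.norm_eq_abs]
        have : |1 - 2 * y| ≤ 1 := abs_le.2 ⟨by linarith [hy.2], by linarith [hy.1]⟩
        calc ‖cc‖ * |1 - 2 * y| ≤ g * 1 := by gcongr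
          _ = g := mul_one g)
    rw [n2_const, abs_of_nonneg g0] at this
    linarith
  have hφ1 := h.phi1
  have nφ0 := n2_nonneg φ1
  have nf0 := n2_nonneg f1
  have nf2 : n2 f1 ≤ 2 := by linarith
  have supf : ∀ y ∈ Icc (0:ℝ) 1, ‖f y‖ ≤ 2 := fun y hy => (sup_le_deriv df f0 hy).trans nf2
  have k1 := POS3 hS hδ hyc hV df f0 f1' fc
  have k2 : n2 f1 ^ 2 ≤ n2 φ1 ^ 2 + 3 * g := by nlinarith
  have k3 := wA_holder (lam := lam) hS hδ h.crit cf le_rfl (by norm_num : (0:ℝ) ≤ 2) (by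
    intro y hy
    have := df.holder hyc hy
    rw [fc, sub_zero] at this
    have h5 := abs_nonneg (y - yc)
    have h6 : n2 f1 ^ 2 ≤ 4 := by nlinarith
    nlinarith [mul_le_mul_of_nonneg_left h6 h5]) z0 hz4
  have k4 : δ * wA V lam δ f ≤ 64 / c₀ ^ 2 * r := by
    have h1 := Real.sq_sqrt (wA_nonneg (V := V) (lam := lam) hδ f)
    have h2 : δ * wA V lam δ f = (z ^ 2 * Real.sqrt (wA V lam δ f)) ^ 2 := by
      rw [mul_pow, h1, hz4]; ring
    rw [h2]
    calc (z ^ 2 * Real.sqrt (wA V lam δ f)) ^ 2 ≤ (4 / c₀ * (0 + 2 * z)) ^ 2 := by gcongr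
      _ = 64 / c₀ ^ 2 * (z * z) := by ring
      _ ≤ 64 / c₀ ^ 2 * r := by
        gcongr
        nlinarith [h.r1]
  -- difference of quadratic forms
  have cV2 := hS.d2.c
  have cm := (D1_mm (lam := lam) hS hδ).c
  have cmC := (D1_mm (lam := lam) hS hδ).ofReal.c
  have cfb : Continuous fun y => (starRingEnd ℂ) (f y) := Complex.continuous_conj.comp cf
  have cqC := dq.c
  have dA := (hS.d2.ofReal).mul dq
  have dB := ((D1.const (-cc)).mul df.conj).add ((D1.const (-(starRingEnd ℂ) cc)).mul h.sys.dφ)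
  have dh := dA.mul dB
  have supq : ∀ y ∈ Icc (0:ℝ) 1, |y * (1 - y)| ≤ 1 := fun y hy =>
    abs_le.2 ⟨by nlinarith [hy.1, hy.2], by nlinarith [hy.1, hy.2]⟩
  have nq : n2 (fun y => ((V3 y : ℝ) : ℂ) * ((y * (1 - y) : ℝ) : ℂ) + ((V2 y : ℝ) : ℂ) * ((1 - 2 * y : ℝ) : ℂ))
      ≤ M * 1 + M * 1 := by
    refine n2_prod hS.d2.ofReal dq (A := M) (B := 1) ?_ ?_ ?_ ?_
    · intro y _
      rw [Complex.norm_real]; exact hS.b2 y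
    · intro y hy
      rw [Complex.norm_real]; exact supq y hy
    · refine n2_le_const hS.d2.ofReal.c' (by linarith) fun y _ => ?_
      rw [Complex.norm_real]; exact hS.b3 y
    · refine n2_le_const dq.c' zero_le_one fun y hy => ?_
      rw [Complex.norm_real]
      exact abs_le.2 ⟨by linarith [hy.2], by linarith [hy.1]⟩
  have nh := n2_prod dA dB (A := M) (B := 3 * g) (A1 := M * 1 + M * 1) (B1 := 3 * g) (by
      intro y hy
      rw [norm_mul, Complex.norm_real, Complex.norm_real]
      have := hS.b2 y
      have := supq y hy
      calc ‖V2 y‖ * ‖y * (1 - y)‖ ≤ M * 1 := by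
            apply mul_le_mul <;> first | assumption | positivity
        _ = M := mul_one M) (by
      intro y hy
      refine (norm_add_le _ _).trans ?_
      rw [norm_mul, norm_mul, norm_neg, norm_neg, RCLike.norm_conj, RCLike.norm_conj]
      have h1 := supf y hy
      have h2 := h.sup hy
      calc ‖cc‖ * ‖f y‖ + ‖cc‖ * ‖φ y‖ ≤ g * 2 + g * 1 := by gcongr
        _ = 3 * g := by ring) nq (by
      have e := n2_le_add (α := g) (β := g) dB.c' cf1 cφ1 g0 g0 (fun y hy => by
        refine (norm_add_le _ _).trans ?_
        rw [zero_mul, zero_mul, zero_add, zero_add, norm_mul, norm_mul, norm_neg, norm_neg,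
          RCLike.norm_conj, RCLike.norm_conj]
        gcongr)
      refine e.trans ?_
      nlinarith)
  have k5 := Pbd (lam := lam) hS hδ dh (by simp) (by simp)
  have k6 : J (fun y => ((mm V lam δ y : ℝ) : ℂ) * (((V2 y : ℝ) : ℂ) * ((y * (1 - y) : ℝ) : ℂ)
      * (-cc * (starRingEnd ℂ) (f y) + -(starRingEnd ℂ) cc * φ y))) =
      ((QQ V V2 lam δ f - QQ V V2 lam δ φ : ℝ) : ℂ) := by
    unfold QQ
    rw [← J_sub (by fun_prop) (by fun_prop), ← J_ofReal]
    apply J_congr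
    intro y _
    have e1 : ((‖f y‖ ^ 2 : ℝ) : ℂ) = f y * (starRingEnd ℂ) (f y) := (mul_conj_norm _).symm
    have e2 : ((‖φ y‖ ^ 2 : ℝ) : ℂ) = φ y * (starRingEnd ℂ) (φ y) := (mul_conj_norm _).symm
    have e3 : (starRingEnd ℂ) (f y) = (starRingEnd ℂ) (φ y) - (starRingEnd ℂ) cc * ((y * (1 - y) : ℝ) : ℂ) := by
      simp only [hf, map_sub, map_mul, Complex.conj_ofReal]
    rw [Complex.ofReal_sub, Complex.ofReal_mul (mm V lam δ y), Complex.ofReal_mul (mm V lam δ y),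
      Complex.ofReal_mul (V2 y), Complex.ofReal_mul (V2 y), e1, e2]
    have e4 : f y = φ y - cc * ((y * (1 - y) : ℝ) : ℂ) := rfl
    have e5 : φ y = f y + cc * ((y * (1 - y) : ℝ) : ℂ) := by rw [e4]; ring
    have e6 : (starRingEnd ℂ) (φ y) = (starRingEnd ℂ) (f y) + (starRingEnd ℂ) cc * ((y * (1 - y) : ℝ) : ℂ) := by rw [e3]; ring
    rw [e6, e5]
    ring
  rw [k6, Complex.norm_real, Real.norm_eq_abs] at k5
  have hCP := CP_nonneg hc hM
  have k7 := (abs_le.1 (k5.trans (mul_le_mul_of_nonneg_left nh hCP))).2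
  have k8 := mul_le_mul_of_nonneg_left k4 (by linarith : (0:ℝ) ≤ M)
  have k9 : 64 * M / c₀ ^ 2 * r = M * (64 / c₀ ^ 2 * r) := by ring
  have k10 : 0 ≤ CP c₀ M * M * g := by positivity
  nlinarith

end intB

end OSP

namespace OSP

/-- The multiplier `V''·y(1-y)`. -/
def th (V2 : ℝ → ℝ) (y : ℝ) : ℝ := V2 y * (y * (1 - y))

/-- Its derivative. -/
def th1 (V2 V3 : ℝ → ℝ) (y : ℝ) : ℝ := V3 y * (y * (1 - y)) + V2 y * (1 - 2 * y)

/-- Error constant. -/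
def CW (c₀ M CD : ℝ) : ℝ := (2 + M + M ^ 2) * CD * (4 / c₀)

section intA
variable {V V1 V2 V3 : ℝ → ℝ} {c₀ M K CD r lam yc δ a σ ε : ℝ} {o : ℂ} {w w1 w2 φ φ1 G G1 : ℝ → ℂ}

lemma q_le {y : ℝ} (hy : y ∈ Icc (0:ℝ) 1) : |y * (1 - y)| ≤ 1 :=
  abs_le.2 ⟨by nlinarith [hy.1, hy.2], by nlinarith [hy.1, hy.2]⟩

lemma q1_le {y : ℝ} (hy : y ∈ Icc (0:ℝ) 1) : |1 - 2 * y| ≤ 1 :=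
  abs_le.2 ⟨by linarith [hy.1, hy.2], by linarith [hy.1, hy.2]⟩

lemma D1_th (hS : Shear c₀ M V V1 V2 V3) : D1 (th V2) (th1 V2 V3) := by
  have dq0 : D1 (fun y : ℝ => y * (1 - y)) (fun y => 1 - 2 * y) :=
    (D1.id.mul ((D1.const 1).sub D1.id)).congr' (fun y => by ring)
  exact hS.d2.mul dq0

lemma mul_bd {x y A B : ℝ} (hx : |x| ≤ A) (hy : |y| ≤ B) : |x * y| ≤ A * B := by
  rw [abs_mul]
  exact mul_le_mul hx hy (abs_nonneg _) ((abs_nonneg _).trans hx)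

lemma th_le (hS : Shear c₀ M V V1 V2 V3) {y : ℝ} (hy : y ∈ Icc (0:ℝ) 1) : |th V2 y| ≤ M := by
  have := mul_bd (hS.b2 y) (q_le hy)
  rw [mul_one] at this
  exact this

lemma th1_le (hS : Shear c₀ M V V1 V2 V3) {y : ℝ} (hy : y ∈ Icc (0:ℝ) 1) : |th1 V2 V3 y| ≤ 2 * M := by
  refine (abs_add_le _ _).trans ?_
  have := mul_bd (hS.b3 y) (q_le hy)
  have := mul_bd (hS.b2 y) (q1_le hy)
  linarith

lemma CW_nonneg (hc : 0 < c₀) (hM : 1 ≤ M) (hCD : 0 ≤ CD) : 0 ≤ CW c₀ M CD := by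
  unfold CW; positivity

lemma Nz.r4 (h : Nz c₀ M K CD r V V1 V2 V3 lam yc δ a σ ε o w w1 w2 φ φ1 G G1) : r ^ 4 ≤ r := by
  simpa using pow_le_pow_of_le_one h.r0.le h.r1 (show 1 ≤ 4 by norm_num)

lemma Nz.supH (h : Nz c₀ M K CD r V V1 V2 V3 lam yc δ a σ ε o w w1 w2 φ φ1 G G1) {y : ℝ}
    (hy : y ∈ Icc (0:ℝ) 1) : ‖(V2 y : ℂ) * φ y + G y‖ ≤ 3 * M := by
  refine (norm_add_le _ _).trans ?_
  rw [norm_mul, Complex.norm_real, Real.norm_eq_abs]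
  have h1 := h.sys.S.b2 y
  have h2 := h.sup hy
  have h3 := h.supG hy
  have h4 := h.r4
  have h5 := h.r1
  have hM := h.sys.S.M1
  have : |V2 y| * ‖φ y‖ ≤ M * 1 := by gcongr
  linarith

lemma Nz.nH1 (h : Nz c₀ M K CD r V V1 V2 V3 lam yc δ a σ ε o w w1 w2 φ φ1 G G1) :
    n2 (fun y => (V3 y : ℂ) * φ y + (V2 y : ℂ) * φ1 y + G1 y) ≤ 5 * M := by
  have h1 := h.sys.nH_le
  have h2 := n2_le_nH a (fun y => (V2 y : ℂ) * φ y + G y) (fun y => (V3 y : ℂ) * φ y + (V2 y : ℂ) * φ1 y + G1 y)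
  have h3 := h.e1
  have h4 := h.Nr
  have h5 := h.r4
  have h6 := h.r1
  have hM := h.sys.S.M1
  nlinarith

lemma Nz.imG (h : Nz c₀ M K CD r V V1 V2 V3 lam yc δ a σ ε o w w1 w2 φ φ1 G G1) :
    ‖J (fun y => w y * ((th V2 y : ℂ) * (starRingEnd ℂ) (G y)))‖ ≤ (7 * M * CW c₀ M CD + 25 * M ^ 2 * CP c₀ M) * r := by
  have hS := h.sys.S
  have hM := hS.M1
  have hc := hS.c0
  have hδ := h.sys.L.hδ
  have hr := h.r0
  have hr4 := h.r4
  have df := (D1_th hS).ofReal.mul h.sys.dG.conj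
  have f0 : ((th V2 0 : ℝ) : ℂ) * (starRingEnd ℂ) (G 0) = 0 := by simp [th]
  have f1 : ((th V2 1 : ℝ) : ℂ) * (starRingEnd ℂ) (G 1) = 0 := by simp [th]
  have hsup : ∀ y ∈ Icc (0:ℝ) 1, ‖((th V2 y : ℝ) : ℂ)‖ ≤ M := fun y hy => by
    rw [Complex.norm_real]; exact th_le hS hy
  have hsup1 : n2 (fun y => ((th1 V2 V3 y : ℝ) : ℂ)) ≤ 2 * M :=
    n2_le_const (D1_th hS).ofReal.c' (by linarith) fun y hy => by
      rw [Complex.norm_real]; exact th1_le hS hy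
  have hG : ∀ y ∈ Icc (0:ℝ) 1, ‖(starRingEnd ℂ) (G y)‖ ≤ 2 * r ^ 4 := fun y hy => by
    rw [RCLike.norm_conj]; exact h.supG hy
  have hn := n2_prod (B1 := r ^ 4) (D1_th hS).ofReal h.sys.dG.conj hsup hG hsup1 (by rw [n2_conj]; exact h.nG1)
  have hfs : ∀ y ∈ Icc (0:ℝ) 1, ‖((th V2 y : ℝ) : ℂ) * (starRingEnd ℂ) (G y)‖ ≤ M * (2 * r ^ 4) := fun y hy => by
    rw [norm_mul]
    exact mul_le_mul (hsup y hy) (hG y hy) (norm_nonneg _) (by linarith)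
  have k1 := weak_est hS h.sys.L df f0 f1
  have k2 := h.err (A := M * (2 * r ^ 4)) (B := 0) (F := 2 * M * (2 * r ^ 4) + M * r ^ 4) df.c (by positivity) le_rfl
    (by positivity) hn (fun y hy => by
      have := hfs y hy
      have := norm_nonneg (((th V2 y : ℝ) : ℂ) * (starRingEnd ℂ) (G y))
      nlinarith)
  have k3 := Pbd (lam := lam) hS hδ (df.mul h.sys.L.dH) (by simp [th]) (by simp [th])
  have hn2 := n2_prod df h.sys.L.dH hfs (fun y hy => h.supH hy) hn h.nH1
  have hCP := CP_nonneg hc hM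
  have k4 := k3.trans (mul_le_mul_of_nonneg_left hn2 hCP)
  have k5 := by
    have := norm_add_le (J (fun y => w y * ((th V2 y : ℂ) * (starRingEnd ℂ) (G y))) -
      J (fun y => (mm V lam δ y : ℂ) * (((th V2 y : ℂ) * (starRingEnd ℂ) (G y)) * ((V2 y : ℂ) * φ y + G y))))
      (J (fun y => (mm V lam δ y : ℂ) * (((th V2 y : ℂ) * (starRingEnd ℂ) (G y)) * ((V2 y : ℂ) * φ y + G y))))
    rw [sub_add_cancel] at this
    exact this.trans (add_le_add (k1.trans k2) k4)
  refine k5.trans ?_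
  have hCW := CW_nonneg hc hM h.CD0
  have e1 : (2 + M + M ^ 2) * CD * (4 / c₀) = CW c₀ M CD := rfl
  rw [e1]
  have e2 : (M * (2 * r ^ 4) + (0 + (2 * M * (2 * r ^ 4) + M * r ^ 4)) * r) ≤ 7 * M * r := by
    have : M * r ^ 4 * r ≤ M * r ^ 4 * 1 := by gcongr; exact h.r1
    have : M * r ^ 4 ≤ M * r := by gcongr
    linarith
  have e3 : (2 * M * (2 * r ^ 4) + M * r ^ 4) * (3 * M) + M * (2 * r ^ 4) * (5 * M) ≤ 25 * M ^ 2 * r := by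
    have : M ^ 2 * r ^ 4 ≤ M ^ 2 * r := by gcongr
    linarith
  have := mul_le_mul_of_nonneg_left e2 hCW
  have := mul_le_mul_of_nonneg_left e3 hCP
  linarith

lemma Nz.imphi (h : Nz c₀ M K CD r V V1 V2 V3 lam yc δ a σ ε o w w1 w2 φ φ1 G G1) :
    |(J (fun y => w y * (((th V2 y * V2 y : ℝ) : ℂ) * (starRingEnd ℂ) (φ y)))).im|
      ≤ (9 * M ^ 2 * CW c₀ M CD + 15 * M ^ 2 * CP c₀ M) * r := by
  have hS := h.sys.S
  have hM := hS.M1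
  have hc := hS.c0
  have hδ := h.sys.L.hδ
  have hr := h.r0
  have hr4 := h.r4
  have hyc := h.crit.mem
  set q0 : ℝ := th V2 yc * V2 yc with hq0
  have dq : D1 (fun y => ((th V2 y * V2 y - q0 : ℝ) : ℂ)) (fun y => ((th1 V2 V3 y * V2 y + th V2 y * V3 y : ℝ) : ℂ)) :=
    (((D1_th hS).mul hS.d2).sub (D1.const q0)).ofReal.congr' (fun y => by simp)
  have nd : n2 (fun y => ((th1 V2 V3 y * V2 y + th V2 y * V3 y : ℝ) : ℂ)) ≤ 3 * M ^ 2 := by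
    refine n2_le_const dq.c' (by positivity) fun y hy => ?_
    rw [Complex.norm_real]
    refine (abs_add_le _ _).trans ?_
    have := mul_bd (th1_le hS hy) (hS.b2 y)
    have := mul_bd (th_le hS hy) (hS.b3 y)
    linarith
  have nd0 := n2_nonneg (fun y => ((th1 V2 V3 y * V2 y + th V2 y * V3 y : ℝ) : ℂ))
  have hd : ∀ y ∈ Icc (0:ℝ) 1, ‖((th V2 y * V2 y - q0 : ℝ) : ℂ)‖ ^ 2 ≤ (3 * M ^ 2) ^ 2 * |y - yc| := by
    intro y hy
    have := dq.holder hyc hy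
    rw [hq0, sub_self, Complex.ofReal_zero, sub_zero, ← hq0] at this
    refine this.trans ?_
    rw [mul_comm]
    gcongr
  have hd1 : ∀ y ∈ Icc (0:ℝ) 1, ‖((th V2 y * V2 y - q0 : ℝ) : ℂ)‖ ≤ 3 * M ^ 2 := by
    intro y hy
    refine le_sq ((hd y hy).trans ?_) (by positivity)
    have : |y - yc| ≤ 1 := abs_le.2 ⟨by linarith [hy.1, hyc.2], by linarith [hy.2, hyc.1]⟩
    exact mul_le_of_le_one_right (by positivity) this
  have df := dq.mul h.sys.dφ.conj
  have hφ : ∀ y ∈ Icc (0:ℝ) 1, ‖(starRingEnd ℂ) (φ y)‖ ≤ 1 := fun y hy => by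
    rw [RCLike.norm_conj]; exact h.sup hy
  have hn := n2_prod (B1 := 1) dq h.sys.dφ.conj hd1 hφ nd (by rw [n2_conj]; exact h.phi1)
  have hfs : ∀ y ∈ Icc (0:ℝ) 1, ‖((th V2 y * V2 y - q0 : ℝ) : ℂ) * (starRingEnd ℂ) (φ y)‖ ≤ 3 * M ^ 2 * 1 := fun y hy => by
    rw [norm_mul]
    exact mul_le_mul (hd1 y hy) (hφ y hy) (norm_nonneg _) (by positivity)
  have k1 := weak_est hS h.sys.L df (by simp [h.sys.φ0]) (by simp [h.sys.φ1'])
  have k2 := h.err (A := 0) (B := 3 * M ^ 2) (F := 3 * M ^ 2 * 1 + 3 * M ^ 2 * 1) df.c le_rfl (by positivity)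
    (by positivity) hn (fun y hy => by
      rw [norm_mul, mul_pow]
      have h1 := hd y hy
      have h2 := hφ y hy
      have h3 : ‖(starRingEnd ℂ) (φ y)‖ ^ 2 ≤ 1 := pow_le_one₀ (norm_nonneg _) h2
      have h4 := mul_le_mul h1 h3 (by positivity) (by positivity)
      linarith)
  have k3 := Pbd (lam := lam) hS hδ (df.mul h.sys.dG) (by simp [h.sys.φ0]) (by simp [h.sys.φ1'])
  have hn2 := n2_prod df h.sys.dG hfs (fun y hy => h.supG hy) hn h.nG1
  have hCP := CP_nonneg hc hM
  have hCW := CW_nonneg hc hM h.CD0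
  have k4 := k3.trans (mul_le_mul_of_nonneg_left hn2 hCP)
  have c1 := h.sys.dφ.c
  have cG := h.sys.dG.c
  have cw := h.sys.L.dw.c
  have cV2 := hS.d2.c
  have ct := (D1_th hS).c
  have cb : Continuous fun y => (starRingEnd ℂ) (φ y) := Complex.continuous_conj.comp c1
  have cm := (D1_mm (lam := lam) hS hδ).c
  have s1 : J (fun y => w y * (((th V2 y * V2 y : ℝ) : ℂ) * (starRingEnd ℂ) (φ y))) =
      ((q0 * -(nH a φ φ1 ^ 2) : ℝ) : ℂ) + J (fun y => w y * (((th V2 y * V2 y - q0 : ℝ) : ℂ) * (starRingEnd ℂ) (φ y))) := by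
    rw [Complex.ofReal_mul, ← h.sys.wphi, ← J_cmulC, ← J_add (by fun_prop) (by fun_prop)]
    apply J_congr
    intro y _
    push_cast
    ring
  have s2 : J (fun y => (mm V lam δ y : ℂ) * ((((th V2 y * V2 y - q0 : ℝ) : ℂ) * (starRingEnd ℂ) (φ y)) * ((V2 y : ℂ) * φ y + G y)))
      = ((J (fun y => mm V lam δ y * ((th V2 y * V2 y - q0) * (V2 y * ‖φ y‖ ^ 2))) : ℝ) : ℂ)
       + J (fun y => (mm V lam δ y : ℂ) * ((((th V2 y * V2 y - q0 : ℝ) : ℂ) * (starRingEnd ℂ) (φ y)) * G y)) := by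
    rw [← J_ofReal, ← J_add (by fun_prop) (by fun_prop)]
    apply J_congr
    intro y _
    have := mul_conj_norm (φ y)
    push_cast at this ⊢
    rw [← this]
    ring
  rw [s2] at k1
  have k5 := k1.trans k2
  rw [s1, Complex.add_im, Complex.ofReal_im, zero_add]
  set P := J (fun y => w y * (((th V2 y * V2 y - q0 : ℝ) : ℂ) * (starRingEnd ℂ) (φ y)))
  set R := J (fun y => mm V lam δ y * ((th V2 y * V2 y - q0) * (V2 y * ‖φ y‖ ^ 2)))
  set Q := J (fun y => (mm V lam δ y : ℂ) * ((((th V2 y * V2 y - q0 : ℝ) : ℂ) * (starRingEnd ℂ) (φ y)) * G y))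
  have k6 : P.im = (P - ((R : ℂ) + Q)).im + Q.im := by simp
  rw [k6]
  refine (abs_add_le _ _).trans ?_
  have k7 := (Complex.abs_im_le_norm _).trans k5
  have k8 := (Complex.abs_im_le_norm _).trans k4
  refine (add_le_add k7 k8).trans ?_
  have e1 : (2 + M + M ^ 2) * CD * (4 / c₀) = CW c₀ M CD := rfl
  rw [e1]
  have e3 : (3 * M ^ 2 * 1 + 3 * M ^ 2 * 1) * (2 * r ^ 4) + 3 * M ^ 2 * 1 * r ^ 4 ≤ 15 * M ^ 2 * r := by
    have : M ^ 2 * r ^ 4 ≤ M ^ 2 * r := by gcongr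
    linarith
  have := mul_le_mul_of_nonneg_left e3 hCP
  linarith

/-- Constant. -/
def CA (c₀ M K CD : ℝ) : ℝ := 16 * M ^ 2 * CW c₀ M CD + 40 * M ^ 2 * CP c₀ M + (3 * M + M * K ^ 2) * CD ^ 2

lemma Nz.A1 (h : Nz c₀ M K CD r V V1 V2 V3 lam yc δ a σ ε o w w1 w2 φ φ1 G G1)
    (hsg : (∀ y ∈ Icc (0:ℝ) 1, 0 ≤ V2 y) ∨ (∀ y ∈ Icc (0:ℝ) 1, V2 y ≤ 0)) :
    δ ^ 3 * J (fun y => |th V2 y| * ‖w1 y‖ ^ 2) ≤ CA c₀ M K CD * r := by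
  obtain ⟨z, z0, zr, hz4, hz2⟩ := h.sqrt
  have hS := h.sys.S
  have hM := hS.M1
  have hc := hS.c0
  have hδ := h.sys.L.hδ
  have hr := h.r0
  have hr4 := h.r4
  have hCP := CP_nonneg hc hM
  have hCW := CW_nonneg hc hM h.CD0
  have k := mult_im hS.d0.c h.sys.L (D1_th hS)
  have i1 := h.imG
  have i2 := h.imphi
  have c1 := h.sys.dφ.c
  have cG := h.sys.dG.c
  have cw := h.sys.L.dw.c
  have cw1 := h.sys.L.dw.c'
  have cV2 := hS.d2.c
  have ct := (D1_th hS).c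
  have ct1 := (D1_th hS).c'
  have cb : Continuous fun y => (starRingEnd ℂ) (φ y) := Complex.continuous_conj.comp c1
  have cGb : Continuous fun y => (starRingEnd ℂ) (G y) := Complex.continuous_conj.comp cG
  have cwb : Continuous fun y => (starRingEnd ℂ) (w y) := Complex.continuous_conj.comp cw
  have s1 : J (fun y => (th V2 y : ℂ) * (((V2 y : ℂ) * φ y + G y) * (starRingEnd ℂ) (w y))) =
      (starRingEnd ℂ) (J (fun y => w y * (((th V2 y * V2 y : ℝ) : ℂ) * (starRingEnd ℂ) (φ y)))
        + J (fun y => w y * ((th V2 y : ℂ) * (starRingEnd ℂ) (G y)))) := by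
    rw [← J_add (by fun_prop) (by fun_prop), ← J_conj]
    apply J_congr
    intro y _
    simp only [map_add, map_mul, Complex.conj_conj, Complex.conj_ofReal, Complex.ofReal_mul]
    ring
  rw [s1, Complex.conj_im, Complex.add_im] at k
  set I1 := (J (fun y => w y * (((th V2 y * V2 y : ℝ) : ℂ) * (starRingEnd ℂ) (φ y)))).im
  have i3 := (Complex.abs_im_le_norm _).trans i1
  set I2 := (J (fun y => w y * ((th V2 y : ℂ) * (starRingEnd ℂ) (G y)))).im
  have s2 : J (fun y => |th V2 y| * ‖w1 y‖ ^ 2) = |J (fun y => th V2 y * ‖w1 y‖ ^ 2)| := by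
    rcases hsg with hs | hs
    · have e : J (fun y => |th V2 y| * ‖w1 y‖ ^ 2) = J (fun y => th V2 y * ‖w1 y‖ ^ 2) := J_congr fun y hy => by
        rw [abs_of_nonneg]
        exact mul_nonneg (hs y hy) (mul_nonneg hy.1 (by linarith [hy.2]))
      rw [e, abs_of_nonneg]
      rw [← e]
      exact J_nonneg fun y _ => by positivity
    · have e : J (fun y => |th V2 y| * ‖w1 y‖ ^ 2) = - J (fun y => th V2 y * ‖w1 y‖ ^ 2) := by
        rw [← J_neg]
        refine J_congr fun y hy => ?_
        rw [abs_of_nonpos, neg_mul]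
        exact mul_nonpos_of_nonpos_of_nonneg (hs y hy) (mul_nonneg hy.1 (by linarith [hy.2]))
      rw [e, abs_of_nonpos]
      have : 0 ≤ J (fun y => |th V2 y| * ‖w1 y‖ ^ 2) := J_nonneg fun y _ => by positivity
      linarith
  have X0 := n2_nonneg w
  have Y0 := n2_nonneg w1
  have t1 : ‖J (fun y => (th1 V2 V3 y : ℂ) * (w1 y * (starRingEnd ℂ) (w y)))‖ ≤ 2 * M * (n2 w1 * n2 w) := by
    have := norm_J_le_of (f := fun y => (th1 V2 V3 y : ℂ) * (w1 y * (starRingEnd ℂ) (w y)))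
      (g := fun y => 2 * M * (‖w1 y‖ * ‖w y‖)) (by fun_prop) (by fun_prop) (fun y hy => by
        rw [norm_mul, norm_mul, RCLike.norm_conj, Complex.norm_real]
        have := th1_le hS hy
        rw [← Real.norm_eq_abs] at this
        gcongr)
    rw [J_cmul] at this
    exact this.trans (mul_le_mul_of_nonneg_left (cs cw1 cw) (by linarith))
  have t2 : |J (fun y => th V2 y * ‖w y‖ ^ 2)| ≤ M * n2 w ^ 2 := by
    have := norm_J_le_of (f := fun y => th V2 y * ‖w y‖ ^ 2)
      (g := fun y => M * ‖w y‖ ^ 2) (by fun_prop) (by fun_prop) (fun y hy => by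
        rw [norm_mul, norm_pow, norm_norm]
        have := th_le hS hy
        rw [← Real.norm_eq_abs] at this
        gcongr)
    rwa [J_cmul, ← n2_sq] at this
  have t1' := (Complex.abs_re_le_norm _).trans t1
  set R1 := (J (fun y => (th1 V2 V3 y : ℂ) * (w1 y * (starRingEnd ℂ) (w y)))).re
  set R2 := J (fun y => th V2 y * ‖w y‖ ^ 2)
  set P := J (fun y => th V2 y * ‖w1 y‖ ^ 2)
  have hσ := h.sys.L.hσ
  have s3 : δ ^ 3 * |P| = |I1 + I2 - σ * δ ^ 3 * R1 - σ * δ ^ 3 * a ^ 2 * R2 - o.re * R2| := by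
    have : I1 + I2 - σ * δ ^ 3 * R1 - σ * δ ^ 3 * a ^ 2 * R2 - o.re * R2 = σ * δ ^ 3 * P := by
      linarith
    rw [this, abs_mul, abs_mul, hσ, one_mul, abs_of_pos (by positivity : 0 < δ ^ 3)]
  rw [s2, s3]
  have d3 : |σ * δ ^ 3 * R1| ≤ δ ^ 3 * (2 * M * (n2 w1 * n2 w)) := by
    rw [abs_mul, abs_mul, hσ, one_mul, abs_of_pos (by positivity : 0 < δ ^ 3)]
    gcongr
  have d4 : |σ * δ ^ 3 * a ^ 2 * R2| ≤ δ ^ 3 * K ^ 2 * (M * n2 w ^ 2) := by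
    rw [abs_mul, abs_mul, abs_mul, hσ, one_mul, abs_of_pos (by positivity : 0 < δ ^ 3),
      abs_of_nonneg (sq_nonneg a)]
    have := h.aK
    have := h.sys.L.ha
    gcongr
  have d5 : |o.re * R2| ≤ r ^ 4 * δ * (M * n2 w ^ 2) := by
    rw [abs_mul]
    have h1 := (Complex.abs_re_le_norm o).trans h.sys.L.ho
    have h2 : ε * δ ≤ r ^ 4 * δ := by gcongr; exact h.εr
    have h3 := h1.trans h2
    gcongr
  have hD := h.hD
  rw [hz2] at hD
  have hCD := h.CD0
  have m1 : (z ^ 2 * n2 w) ≤ CD := by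
    refine le_trans ?_ hD
    have : 0 ≤ δ * n2 w1 := by positivity
    gcongr
    linarith
  have m2 : (z ^ 2 * (δ * n2 w1)) ≤ CD := by
    refine le_trans ?_ hD
    gcongr
    linarith
  have z1 : z ≤ 1 := zr.trans h.r1
  have z4 : z ^ 4 ≤ r := (by simpa using pow_le_pow_of_le_one z0.le z1 (show 1 ≤ 4 by norm_num) : z ^ 4 ≤ z).trans zr
  have z8 : z ^ 8 ≤ r := (by simpa using pow_le_pow_of_le_one z0.le z1 (show 1 ≤ 8 by norm_num) : z ^ 8 ≤ z).trans zr
  have d3' : δ ^ 3 * (2 * M * (n2 w1 * n2 w)) ≤ 2 * M * CD ^ 2 * r := by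
    calc δ ^ 3 * (2 * M * (n2 w1 * n2 w)) = 2 * M * ((z ^ 2 * n2 w) * (z ^ 2 * (δ * n2 w1))) * z ^ 4 := by
          rw [hz4]; ring
      _ ≤ 2 * M * (CD * CD) * r := by gcongr
      _ = _ := by ring
  have d4' : δ ^ 3 * K ^ 2 * (M * n2 w ^ 2) ≤ M * K ^ 2 * CD ^ 2 * r := by
    calc δ ^ 3 * K ^ 2 * (M * n2 w ^ 2) = M * K ^ 2 * (z ^ 2 * n2 w) ^ 2 * z ^ 8 := by
          rw [hz4]; ring
      _ ≤ M * K ^ 2 * CD ^ 2 * r := by gcongr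
  have d5' : r ^ 4 * δ * (M * n2 w ^ 2) ≤ M * CD ^ 2 * r := by
    calc r ^ 4 * δ * (M * n2 w ^ 2) = M * (z ^ 2 * n2 w) ^ 2 * r ^ 4 := by
          rw [hz4]; ring
      _ ≤ M * CD ^ 2 * r := by gcongr
  have f1 := abs_sub (I1 + I2 - σ * δ ^ 3 * R1 - σ * δ ^ 3 * a ^ 2 * R2) (o.re * R2)
  have f2 := abs_sub (I1 + I2 - σ * δ ^ 3 * R1) (σ * δ ^ 3 * a ^ 2 * R2)
  have f3 := abs_sub (I1 + I2) (σ * δ ^ 3 * R1)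
  have f4 := abs_add_le I1 I2
  have f5 : 0 ≤ CW c₀ M CD * r := by positivity
  have f6 : 7 * M * (CW c₀ M CD * r) ≤ 7 * M ^ 2 * (CW c₀ M CD * r) := by
    gcongr; nlinarith
  unfold CA
  linarith

end intA

end OSP

namespace OSP

section intA2
variable {V V1 V2 V3 : ℝ → ℝ} {c₀ M K CD r lam yc δ a σ ε : ℝ} {o : ℂ} {w w1 w2 φ φ1 G G1 : ℝ → ℂ}

lemma pi_bd (hc : 0 < c₀) (hc1 : c₀ ≤ 1) : Real.pi / c₀ ≤ (2 / c₀) ^ 2 := by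
  have hpi := Real.pi_le_four
  rw [div_pow, div_le_div_iff₀ hc (by positivity)]
  have : Real.pi * c₀ ^ 2 ≤ 4 * c₀ ^ 2 := by gcongr
  nlinarith

lemma n2_rr (hS : Shear c₀ M V V1 V2 V3) (hδ : 0 < δ) {z : ℝ} (hz : 0 < z) (hzδ : δ = z ^ 4) :
    z ^ 6 * n2 (rr V lam δ) ≤ 2 / c₀ := by
  have hc := hS.c0
  have hr := (D1_rr (lam := lam) hS hδ).c
  refine le_sq ?_ (by positivity)
  refine le_trans ?_ (pi_bd hc hS.c1)
  rw [mul_pow, n2_sq]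
  have h1 : J (fun y => δ ^ 2 * ‖rr V lam δ y‖ ^ 2) ≤ J (rr V lam δ) := by
    refine J_mono (by fun_prop) hr fun y _ => ?_
    have h2 := rr_le (V := V) (lam := lam) hδ y
    have h3 := rr_pos (V := V) (lam := lam) hδ y
    rw [Real.norm_eq_abs, sq_abs]
    nlinarith
  rw [J_cmul] at h1
  have h4 := h1.trans (J_rr (lam := lam) hS hδ)
  rw [le_div_iff₀ (by positivity)] at h4 ⊢
  rw [hzδ] at h4 ⊢
  linarith

lemma n2_rr32 (hS : Shear c₀ M V V1 V2 V3) (hδ : 0 < δ) {z : ℝ} (hz : 0 < z) (hzδ : δ = z ^ 4) :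
    z ^ 10 * n2 (fun y => ((rr V lam δ y * Real.sqrt (rr V lam δ y) : ℝ) : ℂ)) ≤ 2 / c₀ := by
  have hc := hS.c0
  have hr := (D1_rr (lam := lam) hS hδ).c
  refine le_sq ?_ (by positivity)
  refine le_trans ?_ (pi_bd hc hS.c1)
  rw [mul_pow, n2_sq]
  have h1 : J (fun y => δ ^ 4 * ‖((rr V lam δ y * Real.sqrt (rr V lam δ y) : ℝ) : ℂ)‖ ^ 2) ≤ J (rr V lam δ) := by
    refine J_mono (by fun_prop) hr fun y _ => ?_
    have h2 := rr_le (V := V) (lam := lam) hδ y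
    have h3 := rr_pos (V := V) (lam := lam) hδ y
    rw [Complex.norm_real, Real.norm_eq_abs, sq_abs, mul_pow, Real.sq_sqrt h3.le]
    have h5 : (δ ^ 2 * rr V lam δ y) ^ 2 ≤ 1 := pow_le_one₀ (by positivity) h2
    nlinarith
  rw [J_cmul] at h1
  have h4 := h1.trans (J_rr (lam := lam) hS hδ)
  rw [le_div_iff₀ (by positivity)] at h4 ⊢
  rw [hzδ] at h4 ⊢
  linarith

/-- Lower bound for the mass of the kernel. -/
lemma mass_rr (hS : Shear c₀ M V V1 V2 V3) (hδ : 0 < δ) (hδ1 : δ ≤ 1) (hyc : yc ∈ Icc (0:ℝ) 1) (hV : V yc = lam) :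
    1 / (2 * (1 + M ^ 2) ^ 2) ≤ δ ^ 3 * J (fun y => rr V lam δ y ^ 2) := by
  have hM := hS.M1
  have hr := (D1_rr (lam := lam) hS hδ).c
  obtain ⟨p, q, hp, hq, hpq, hpy⟩ : ∃ p q, 0 ≤ p ∧ q ≤ 1 ∧ q - p = δ / 2 ∧ ∀ y ∈ Icc p q, |y - yc| ≤ δ := by
    rcases le_total yc (1/2) with h | h
    · refine ⟨yc, yc + δ / 2, hyc.1, by linarith, by ring, fun y hy => abs_le.2 ⟨?_, ?_⟩⟩ <;> linarith [hy.1, hy.2]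
    · refine ⟨yc - δ / 2, yc, by linarith, hyc.2, by ring, fun y hy => abs_le.2 ⟨?_, ?_⟩⟩ <;> linarith [hy.1, hy.2]
  have hpq' : p ≤ q := by linarith
  have h1 := J_sub_le (f := fun y => rr V lam δ y ^ 2) (by fun_prop) (fun y _ => by positivity) hp hpq' hq
  have h2 : ∫ y in p..q, (1 / ((1 + M ^ 2) * δ ^ 2)) ^ 2 ≤ ∫ y in p..q, rr V lam δ y ^ 2 := by
    refine intervalIntegral.integral_mono_on hpq' (by simp) ((by fun_prop : Continuous _).intervalIntegrable _ _) fun y hy => ?_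
    have hy1 := hpy y hy
    have hl := hS.lip hyc (show y ∈ Icc (0:ℝ) 1 from ⟨hp.trans hy.1, hy.2.trans hq⟩)
    rw [hV] at hl
    have : |V y - lam| ≤ M * δ := hl.trans (by gcongr)
    have h3 : (V y - lam) ^ 2 ≤ (M * δ) ^ 2 := sq_le_sq' (by linarith [(abs_le.1 this).1]) (abs_le.1 this).2
    have h4 : 1 / ((1 + M ^ 2) * δ ^ 2) ≤ rr V lam δ y := by
      unfold rr
      rw [one_div]
      have := den_pos (V := V) (lam := lam) hδ y
      gcongr
      linarith
    gcongr
  rw [intervalIntegral.integral_const, hpq, smul_eq_mul] at h2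
  have h5 := mul_le_mul_of_nonneg_left (h2.trans h1) (by positivity : 0 ≤ δ ^ 3)
  refine le_trans (le_of_eq ?_) h5
  field_simp

/-- The test function bound, abstractly. -/
lemma Nz.Tw1 (h : Nz c₀ M K CD r V V1 V2 V3 lam yc δ a σ ε o w w1 w2 φ φ1 G G1)
    (hsg : (∀ y ∈ Icc (0:ℝ) 1, 0 ≤ V2 y) ∨ (∀ y ∈ Icc (0:ℝ) 1, V2 y ≤ 0)) {z : ℝ} (hz : 0 < z) (hzδ : δ = z ^ 4) :
    z ^ 6 * n2 (fun y => ((th V2 y ^ 2 : ℝ) : ℂ) * w1 y) ≤ M ^ 2 * (1 + CA c₀ M K CD) * Real.sqrt r := by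
  have hS := h.sys.S
  have hM := hS.M1
  have hA := h.A1 hsg
  have cw1 := h.sys.L.dw.c'
  have ct := (D1_th hS).c
  have hr := h.r0
  have hc := hS.c0
  have hCA : 0 ≤ CA c₀ M K CD := by
    have := CW_nonneg hc hM h.CD0
    have := CP_nonneg hc hM
    unfold CA
    positivity
  refine le_sq ?_ (by positivity)
  rw [mul_pow, n2_sq, mul_pow, Real.sq_sqrt hr.le]
  have h1 : J (fun y => ‖((th V2 y ^ 2 : ℝ) : ℂ) * w1 y‖ ^ 2) ≤ J (fun y => M ^ 3 * (|th V2 y| * ‖w1 y‖ ^ 2)) := by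
    refine J_mono (by fun_prop) (by fun_prop) fun y hy => ?_
    have := th_le hS hy
    rw [norm_mul, Complex.norm_real, norm_pow, Real.norm_eq_abs, mul_pow, ← mul_assoc]
    have h2 : |th V2 y| ^ 3 ≤ M ^ 3 := by gcongr
    have h3 := mul_le_mul_of_nonneg_right h2 (abs_nonneg (th V2 y))
    have h4 := mul_le_mul_of_nonneg_right h3 (sq_nonneg ‖w1 y‖)
    refine le_trans (le_of_eq ?_) h4
    ring
  rw [J_cmul] at h1
  set A := J (fun y => |th V2 y| * ‖w1 y‖ ^ 2)
  set B := J (fun y => ‖((th V2 y ^ 2 : ℝ) : ℂ) * w1 y‖ ^ 2)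
  rw [hzδ] at hA
  calc (z ^ 6) ^ 2 * B ≤ (z ^ 6) ^ 2 * (M ^ 3 * A) := by gcongr
    _ = M ^ 3 * ((z ^ 4) ^ 3 * A) := by ring
    _ ≤ M ^ 3 * (CA c₀ M K CD * r) := by gcongr
    _ = M ^ 3 * CA c₀ M K CD * r := by ring
    _ ≤ (M ^ 2 * (1 + CA c₀ M K CD)) ^ 2 * r := by
        have e1 : M ^ 3 ≤ M ^ 4 := pow_le_pow_right₀ hM (by norm_num)
        have e2 : CA c₀ M K CD ≤ (1 + CA c₀ M K CD) ^ 2 := by nlinarith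
        have e3 : M ^ 3 * CA c₀ M K CD ≤ M ^ 4 * (1 + CA c₀ M K CD) ^ 2 := by gcongr
        have := mul_le_mul_of_nonneg_right e3 hr.le
        refine this.trans (le_of_eq (by ring))

end intA2

end OSP

namespace OSP

section test
variable {V V1 V2 V3 : ℝ → ℝ} {c₀ M K CD r lam yc δ a σ ε : ℝ} {o : ℂ} {w w1 w2 φ φ1 G G1 H H1 : ℝ → ℂ}

/-- Part one of the test identity. -/
lemma test1 (hS : Shear c₀ M V V1 V2 V3) (hL : Loc M V lam δ a σ ε o w w1 w2 H H1) {T T1 : ℝ → ℝ} (hT : D1 T T1)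
    {t t1 : ℝ} (ht1 : 0 ≤ t1) (hTb : ∀ y ∈ Icc (0:ℝ) 1, |T y| ≤ t) (hT1b : ∀ y ∈ Icc (0:ℝ) 1, |T1 y| ≤ t1) :
    ‖J (fun y => ((T y * ((V y - lam) * rr V lam δ y ^ 2) : ℝ) : ℂ) * w y)‖
      ≤ n2 (rr V lam δ) * (n2 (fun y => (T y : ℂ) * w1 y) / c₀ + (t1 / c₀ + t * M / c₀ ^ 2) * n2 w) := by
  have hδ := hL.hδ
  have hc := hS.c0
  have ht : 0 ≤ t := (abs_nonneg _).trans (hTb 0 ⟨le_rfl, zero_le_one⟩)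
  have hM := hS.M1
  have hV1 : ∀ y, V1 y ≠ 0 := fun y => (lt_of_lt_of_le hc (hS.lo y)).ne'
  have hρ := D1_rr (lam := lam) hS hδ
  have hi := hS.d1.inv hV1
  have hq := ((hT.mul hi).ofReal).mul hL.dw
  have hP := (hρ.ofReal.mul hq).ftc
  simp only [hL.w0, hL.w1, mul_zero, sub_zero] at hP
  have c1 := hρ.c
  have c2 := hρ.c'
  have c3 := hi.c
  have c4 := hi.c'
  have c5 := hT.c
  have c6 := hT.c'
  have c7 := hL.dw.c
  have c8 := hL.dw.c'
  have c9 := hS.d0.c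
  have c10 := hS.d0.c'
  have e1 : J (fun y => ((T y * ((V y - lam) * rr V lam δ y ^ 2) : ℝ) : ℂ) * w y)
      = (1/2 : ℂ) * J (fun y => ((rr V lam δ y : ℝ) : ℂ) * (((T1 y * (V1 y)⁻¹ + T y * (-V2 y / V1 y ^ 2) : ℝ) : ℂ) * w y
          + ((T y * (V1 y)⁻¹ : ℝ) : ℂ) * w1 y)) := by
    have : J (fun y => ((T y * ((V y - lam) * rr V lam δ y ^ 2) : ℝ) : ℂ) * w y)
      = (-1/2 : ℂ) * J (fun y => ((-(2 * (V y - lam) * V1 y) * rr V lam δ y ^ 2 : ℝ) : ℂ) * (((T y * (V1 y)⁻¹ : ℝ) : ℂ) * w y)) := by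
      rw [← J_cmulC]
      apply J_congr
      intro y _
      have : ((V1 y : ℝ) : ℂ) ≠ 0 := by exact_mod_cast hV1 y
      push_cast
      field_simp
    rw [this]
    rw [J_add (by fun_prop) (by fun_prop)] at hP
    linear_combination (-1/2 : ℂ) * hP
  rw [e1, norm_mul]
  have e2 := norm_J_le_of (f := fun y => ((rr V lam δ y : ℝ) : ℂ) * (((T1 y * (V1 y)⁻¹ + T y * (-V2 y / V1 y ^ 2) : ℝ) : ℂ) * w y
          + ((T y * (V1 y)⁻¹ : ℝ) : ℂ) * w1 y))
    (g := fun y => (t1 / c₀ + t * M / c₀ ^ 2) * (‖rr V lam δ y‖ * ‖w y‖) + c₀⁻¹ * (‖rr V lam δ y‖ * ‖(T y : ℂ) * w1 y‖))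
    (by fun_prop) (by fun_prop) (fun y hy => by
      have hlo := hS.lo y
      have hp : 0 < V1 y := lt_of_lt_of_le hc hlo
      have i1 : (V1 y)⁻¹ ≤ c₀⁻¹ := by gcongr
      have b1 : |T1 y * (V1 y)⁻¹ + T y * (-V2 y / V1 y ^ 2)| ≤ t1 / c₀ + t * M / c₀ ^ 2 := by
        refine (abs_add_le _ _).trans (add_le_add ?_ ?_)
        · rw [abs_mul, abs_inv, abs_of_pos hp, div_eq_mul_inv]
          have := hT1b y hy
          gcongr
        · rw [abs_mul, abs_div, abs_neg, abs_pow, abs_of_pos hp, ← mul_div_assoc]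
          have := hTb y hy
          have := hS.b2 y
          gcongr
      rw [norm_mul, Complex.norm_real]
      have k1 : ‖((T1 y * (V1 y)⁻¹ + T y * (-V2 y / V1 y ^ 2) : ℝ) : ℂ) * w y + ((T y * (V1 y)⁻¹ : ℝ) : ℂ) * w1 y‖
         ≤ (t1 / c₀ + t * M / c₀ ^ 2) * ‖w y‖ + c₀⁻¹ * ‖(T y : ℂ) * w1 y‖ := by
        refine (norm_add_le _ _).trans (add_le_add ?_ ?_)
        · rw [norm_mul, Complex.norm_real, Real.norm_eq_abs]
          gcongr
        · rw [norm_mul, norm_mul, Complex.norm_real, Complex.norm_real, norm_mul, norm_inv, Real.norm_of_nonneg hp.le]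
          have := mul_le_mul_of_nonneg_right i1 (by positivity : 0 ≤ ‖T y‖ * ‖w1 y‖)
          linarith
      have := mul_le_mul_of_nonneg_left k1 (norm_nonneg (rr V lam δ y))
      linarith)
  rw [J_add (by fun_prop) (by fun_prop), J_cmul, J_cmul] at e2
  have k1 := cs (f := rr V lam δ) (g := w) c1 c7
  have k2 := cs (f := rr V lam δ) (g := fun y => (T y : ℂ) * w1 y) c1 (by fun_prop)
  have k3 := mul_le_mul_of_nonneg_left k1 (by positivity : 0 ≤ t1 / c₀ + t * M / c₀ ^ 2)
  have k4 := mul_le_mul_of_nonneg_left k2 (by positivity : 0 ≤ c₀⁻¹)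
  have k5 := e2.trans (add_le_add k3 k4)
  have n0 := norm_nonneg (J (fun y => ((rr V lam δ y : ℝ) : ℂ) * (((T1 y * (V1 y)⁻¹ + T y * (-V2 y / V1 y ^ 2) : ℝ) : ℂ) * w y
          + ((T y * (V1 y)⁻¹ : ℝ) : ℂ) * w1 y)))
  have : ‖(1/2 : ℂ)‖ = 1/2 := by norm_num
  rw [this]
  refine le_trans ?_ (k5.trans (le_of_eq ?_))
  · linarith
  · rw [div_eq_mul_inv (n2 _) c₀]
    ring

/-- Part two of the test identity. -/
lemma test2 (hS : Shear c₀ M V V1 V2 V3) (hL : Loc M V lam δ a σ ε o w w1 w2 H H1) {T T1 : ℝ → ℝ} (hT : D1 T T1)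
    {t1 : ℝ} (hT1b : ∀ y ∈ Icc (0:ℝ) 1, |T1 y| ≤ t1) (hT0 : T 0 = 0) (hT1 : T 1 = 0) :
    δ ^ 3 * ‖J (fun y => ((T y * rr V lam δ y ^ 2 : ℝ) : ℂ) * w2 y)‖
      ≤ n2 (rr V lam δ) * (4 * M * n2 (fun y => (T y : ℂ) * w1 y) + t1 * (δ * n2 w1)) := by
  have hδ := hL.hδ
  have hM := hS.M1
  have ht : 0 ≤ t1 := (abs_nonneg _).trans (hT1b 0 ⟨le_rfl, zero_le_one⟩)
  have hρ := D1_rr (lam := lam) hS hδ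
  have hg := (hT.mul (hρ.mul hρ)).ofReal
  have hP := (hg.mul hL.dw1).ftc
  simp only [hT0, hT1, zero_mul, Complex.ofReal_zero, sub_zero] at hP
  have c1 := hρ.c
  have c2 := hρ.c'
  have c5 := hT.c
  have c6 := hT.c'
  have c8 := hL.dw.c'
  have c11 := hL.dw1.c'
  have c9 := hS.d0.c
  have c10 := hS.d0.c'
  have c12 := hg.c'
  rw [J_add (by fun_prop) (by fun_prop)] at hP
  have e1 : J (fun y => ((T y * rr V lam δ y ^ 2 : ℝ) : ℂ) * w2 y)
     = J (fun y => ((T y * (rr V lam δ y * rr V lam δ y) : ℝ) : ℂ) * w2 y) := by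
    apply J_congr; intro y _; push_cast; ring
  rw [e1, eq_neg_of_add_eq_zero_right hP, norm_neg]
  have e2 := norm_J_le_of (f := fun y => ((δ ^ 3 : ℝ) : ℂ) * (((T1 y * (rr V lam δ y * rr V lam δ y) + T y *
      (-(2 * (V y - lam) * V1 y) * rr V lam δ y ^ 2 * rr V lam δ y +
        rr V lam δ y * (-(2 * (V y - lam) * V1 y) * rr V lam δ y ^ 2)) : ℝ) : ℂ) * w1 y))
    (g := fun y => t1 * δ * (‖rr V lam δ y‖ * ‖w1 y‖) + 4 * M * (‖rr V lam δ y‖ * ‖(T y : ℂ) * w1 y‖))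
    (by fun_prop) (by fun_prop) (fun y hy => by
      have h2 := rr_le (V := V) (lam := lam) hδ y
      have h3 := rr_pos (V := V) (lam := lam) hδ y
      have h4 := mm_le (V := V) (lam := lam) hδ y
      have h5 := hT1b y hy
      have h6 := hS.b1 y
      rw [norm_mul, norm_mul, norm_mul, Complex.norm_real, Complex.norm_real, Complex.norm_real, Real.norm_of_nonneg h3.le,
        Real.norm_of_nonneg (by positivity : 0 ≤ δ ^ 3), Real.norm_eq_abs, Real.norm_eq_abs]
      have k1 : δ ^ 3 * |T1 y * (rr V lam δ y * rr V lam δ y) + T y *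
        (-(2 * (V y - lam) * V1 y) * rr V lam δ y ^ 2 * rr V lam δ y +
        rr V lam δ y * (-(2 * (V y - lam) * V1 y) * rr V lam δ y ^ 2))| ≤
          t1 * δ * rr V lam δ y + 4 * M * (rr V lam δ y * |T y|) := by
        have e : T1 y * (rr V lam δ y * rr V lam δ y) + T y *
          (-(2 * (V y - lam) * V1 y) * rr V lam δ y ^ 2 * rr V lam δ y +
          rr V lam δ y * (-(2 * (V y - lam) * V1 y) * rr V lam δ y ^ 2)) =
          T1 y * (rr V lam δ y * rr V lam δ y) + (-4) * (T y * (mm V lam δ y * (V1 y * rr V lam δ y ^ 2))) := by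
          unfold mm; ring
        rw [e]
        have a1 := abs_add_le (T1 y * (rr V lam δ y * rr V lam δ y)) ((-4) * (T y * (mm V lam δ y * (V1 y * rr V lam δ y ^ 2))))
        have a2 := mul_le_mul_of_nonneg_left a1 (by positivity : 0 ≤ δ ^ 3)
        refine a2.trans ?_
        rw [mul_add]
        refine add_le_add ?_ ?_
        · rw [abs_mul, abs_of_pos (by positivity : 0 < rr V lam δ y * rr V lam δ y)]
          calc δ ^ 3 * (|T1 y| * (rr V lam δ y * rr V lam δ y)) = |T1 y| * δ * (δ ^ 2 * rr V lam δ y) * rr V lam δ y := by ring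
            _ ≤ t1 * δ * 1 * rr V lam δ y := by gcongr
            _ = _ := by ring
        · rw [abs_mul, abs_mul, abs_mul, abs_mul, abs_of_pos (by positivity : 0 < rr V lam δ y ^ 2)]
          have : |(-4:ℝ)| = 4 := by norm_num
          rw [this]
          calc δ ^ 3 * (4 * (|T y| * (|mm V lam δ y| * (|V1 y| * rr V lam δ y ^ 2))))
              = 4 * |V1 y| * (rr V lam δ y * |T y|) * (δ * |mm V lam δ y|) * (δ ^ 2 * rr V lam δ y) := by ring
            _ ≤ 4 * M * (rr V lam δ y * |T y|) * 1 * 1 := by gcongr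
            _ = _ := by ring
      have := mul_le_mul_of_nonneg_right k1 (norm_nonneg (w1 y))
      linarith)
  rw [J_cmulC, norm_mul, Complex.norm_real, Real.norm_of_nonneg (by positivity : 0 ≤ δ ^ 3), J_add (by fun_prop) (by fun_prop), J_cmul, J_cmul] at e2
  have k1 := cs (f := rr V lam δ) (g := w1) c1 c8
  have k2 := cs (f := rr V lam δ) (g := fun y => (T y : ℂ) * w1 y) c1 (by fun_prop)
  have k3 := mul_le_mul_of_nonneg_left k1 (by positivity : 0 ≤ t1 * δ)
  have k4 := mul_le_mul_of_nonneg_left k2 (by positivity : 0 ≤ 4 * M)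
  refine (e2.trans (add_le_add k3 k4)).trans (le_of_eq (by ring))

/-- Part three. -/
lemma test3 (hS : Shear c₀ M V V1 V2 V3) (hL : Loc M V lam δ a σ ε o w w1 w2 H H1) {T : ℝ → ℝ} (hT : Continuous T)
    {t : ℝ} (hTb : ∀ y ∈ Icc (0:ℝ) 1, |T y| ≤ t) :
    δ ^ 2 * ‖J (fun y => ((T y * rr V lam δ y ^ 2 : ℝ) : ℂ) * w y)‖ ≤ n2 (rr V lam δ) * (t * n2 w) := by
  have hδ := hL.hδ
  have ht : 0 ≤ t := (abs_nonneg _).trans (hTb 0 ⟨le_rfl, zero_le_one⟩)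
  have c1 := (D1_rr (lam := lam) hS hδ).c
  have c7 := hL.dw.c
  have e2 := norm_J_le_of (f := fun y => ((δ ^ 2 : ℝ) : ℂ) * (((T y * rr V lam δ y ^ 2 : ℝ) : ℂ) * w y))
    (g := fun y => t * (‖rr V lam δ y‖ * ‖w y‖)) (by fun_prop) (by fun_prop) (fun y hy => by
      have h2 := rr_le (V := V) (lam := lam) hδ y
      have h3 := rr_pos (V := V) (lam := lam) hδ y
      have h5 := hTb y hy
      rw [norm_mul, norm_mul, Complex.norm_real, Complex.norm_real, Real.norm_of_nonneg (by positivity : 0 ≤ δ ^ 2),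
        Real.norm_of_nonneg h3.le, Real.norm_eq_abs, abs_mul, abs_of_pos (by positivity : 0 < rr V lam δ y ^ 2)]
      calc δ ^ 2 * (|T y| * rr V lam δ y ^ 2 * ‖w y‖) = |T y| * (δ ^ 2 * rr V lam δ y) * (rr V lam δ y * ‖w y‖) := by ring
        _ ≤ t * 1 * (rr V lam δ y * ‖w y‖) := by gcongr
        _ = _ := by ring)
  rw [J_cmulC, norm_mul, Complex.norm_real, Real.norm_of_nonneg (by positivity : 0 ≤ δ ^ 2), J_cmul] at e2
  have k1 := cs (f := rr V lam δ) (g := w) c1 c7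
  have k3 := mul_le_mul_of_nonneg_left k1 ht
  exact (e2.trans k3).trans (le_of_eq (by ring))

end test

end OSP

namespace OSP

/-- Constant. -/
def CB (c₀ M K CD : ℝ) : ℝ :=
  2 / c₀ * (M ^ 2 * (1 + CA c₀ M K CD) / c₀ + (4 * M ^ 2 / c₀ + M ^ 2 * M / c₀ ^ 2) * CD + 4 * M * (M ^ 2 * (1 + CA c₀ M K CD))
    + 4 * M ^ 2 * CD + K ^ 2 * M ^ 2 * CD + M ^ 2 * CD)

/-- Constant. -/
def CF (c₀ M K CD : ℝ) : ℝ := 2 * (1 + M ^ 2) ^ 2 * (CB c₀ M K CD + 136 * M ^ 3 / c₀ ^ 2)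

section test4
variable {V V1 V2 V3 : ℝ → ℝ} {c₀ M K CD r lam yc δ a σ ε : ℝ} {o : ℂ} {w w1 w2 φ φ1 G G1 : ℝ → ℂ}

lemma Nz.rs (h : Nz c₀ M K CD r V V1 V2 V3 lam yc δ a σ ε o w w1 w2 φ φ1 G G1) : r ≤ Real.sqrt r := by
  refine Real.le_sqrt_of_sq_le ?_
  have := h.r0
  have := h.r1
  nlinarith

lemma D1_T (hS : Shear c₀ M V V1 V2 V3) : D1 (fun y => th V2 y ^ 2) (fun y => 2 * (th V2 y * th1 V2 V3 y)) :=
  ((D1_th hS).mul (D1_th hS)).congr (fun y => by ring) (fun y => by ring)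

lemma T_le (hS : Shear c₀ M V V1 V2 V3) {y : ℝ} (hy : y ∈ Icc (0:ℝ) 1) : |th V2 y ^ 2| ≤ M ^ 2 := by
  rw [abs_pow]
  have := th_le hS hy
  gcongr

lemma T1_le (hS : Shear c₀ M V V1 V2 V3) {y : ℝ} (hy : y ∈ Icc (0:ℝ) 1) : |2 * (th V2 y * th1 V2 V3 y)| ≤ 4 * M ^ 2 := by
  have := mul_bd (th_le hS hy) (th1_le hS hy)
  rw [abs_mul, abs_of_pos (by norm_num : (0:ℝ) < 2)]
  linarith

set_option maxHeartbeats 400000 in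
lemma Nz.test4 (h : Nz c₀ M K CD r V V1 V2 V3 lam yc δ a σ ε o w w1 w2 φ φ1 G G1)
    (hsg : (∀ y ∈ Icc (0:ℝ) 1, 0 ≤ V2 y) ∨ (∀ y ∈ Icc (0:ℝ) 1, V2 y ≤ 0)) {z : ℝ} (hz : 0 < z) (hzr : z ≤ r)
    (hzδ : δ = z ^ 4) (hz2 : Real.sqrt δ = z ^ 2) :
    z ^ 12 * ‖J (fun y => ((th V2 y ^ 2 * rr V lam δ y ^ 2 : ℝ) : ℂ) * ((V2 y : ℂ) * φ y + G y))‖ ≤ CB c₀ M K CD * Real.sqrt r := by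
  have hS := h.sys.S
  have hL := h.sys.L
  have hδ := hL.hδ
  have hM := hS.M1
  have hc := hS.c0
  have hK := h.K1
  have hCD := h.CD0
  have hs := h.rs
  have hr0 := h.r0
  have hr1 := h.r1
  have n1 := test1 hS hL (D1_T hS) (by positivity : 0 ≤ 4 * M ^ 2) (fun y hy => T_le hS hy) (fun y hy => T1_le hS hy)
  have n2' := test2 hS hL (D1_T hS) (fun y hy => T1_le hS hy) (by simp [th]) (by simp [th])
  have n3 := test3 hS hL (D1_T hS).c (fun y hy => T_le hS hy)
  have bR := n2_rr (lam := lam) hS hδ hz hzδ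
  have bB := h.Tw1 hsg hz hzδ
  have hD := h.hD
  rw [hz2] at hD
  have c1 := (D1_rr (lam := lam) hS hδ).c
  have c2 := (D1_th hS).c
  have c3 := hL.dw.c
  have c4 := hL.dw1.c'
  have c5 := hL.dH.c
  have c6 := hS.d0.c
  have e1 : J (fun y => ((th V2 y ^ 2 * rr V lam δ y ^ 2 : ℝ) : ℂ) * ((V2 y : ℂ) * φ y + G y)) =
      J (fun y => ((th V2 y ^ 2 * ((V y - lam) * rr V lam δ y ^ 2) : ℝ) : ℂ) * w y)
      + Complex.I * σ * δ ^ 3 * J (fun y => ((th V2 y ^ 2 * rr V lam δ y ^ 2 : ℝ) : ℂ) * w2 y)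
      + (-(Complex.I * σ * δ ^ 3 * a ^ 2 + Complex.I * o)) * J (fun y => ((th V2 y ^ 2 * rr V lam δ y ^ 2 : ℝ) : ℂ) * w y) := by
    rw [← J_cmulC, ← J_cmulC, ← J_add (by fun_prop) (by fun_prop), ← J_add (by fun_prop) (by fun_prop)]
    apply J_congr
    intro y _
    have h1 := hL.eq y
    push_cast at h1 ⊢
    linear_combination (-((th V2 y : ℂ) ^ 2 * (rr V lam δ y : ℂ) ^ 2)) * h1
  rw [e1]
  set A1 := J (fun y => ((th V2 y ^ 2 * ((V y - lam) * rr V lam δ y ^ 2) : ℝ) : ℂ) * w y)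
  set A2 := J (fun y => ((th V2 y ^ 2 * rr V lam δ y ^ 2 : ℝ) : ℂ) * w2 y)
  set A3 := J (fun y => ((th V2 y ^ 2 * rr V lam δ y ^ 2 : ℝ) : ℂ) * w y)
  have R0 := n2_nonneg (rr V lam δ)
  have B0 := n2_nonneg (fun y => ((th V2 y ^ 2 : ℝ) : ℂ) * w1 y)
  have X0 := n2_nonneg w
  have Y0 : 0 ≤ δ * n2 w1 := mul_nonneg hδ.le (n2_nonneg w1)
  set R := n2 (rr V lam δ)
  set B := n2 (fun y => ((th V2 y ^ 2 : ℝ) : ℂ) * w1 y)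
  set X := n2 w
  set Y := δ * n2 w1
  have m2 : ‖Complex.I * σ * δ ^ 3 * A2‖ = δ ^ 3 * ‖A2‖ := by
    simp only [norm_mul, norm_pow, Complex.norm_I, Complex.norm_real, Real.norm_eq_abs, hL.hσ, abs_of_pos hδ]
    ring
  have m3 : ‖-(Complex.I * σ * δ ^ 3 * a ^ 2 + Complex.I * o)‖ ≤ δ ^ 3 * K ^ 2 + r ^ 4 * δ := by
    rw [norm_neg]
    refine (norm_add_le _ _).trans (add_le_add (le_of_eq_of_le (b := δ ^ 3 * a ^ 2) ?_ ?_) ?_)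
    · simp only [norm_mul, norm_pow, Complex.norm_I, Complex.norm_real, Real.norm_eq_abs, hL.hσ, abs_of_pos hδ, sq_abs]
      ring
    · have := h.aK
      have := hL.ha
      gcongr
    · rw [norm_mul, Complex.norm_I, one_mul]
      refine hL.ho.trans ?_
      have := h.εr
      gcongr
  set s := Real.sqrt r
  have hs0 : 0 ≤ s := Real.sqrt_nonneg r
  have hzs : z ≤ s := hzr.trans hs
  have hz1 : z ≤ 1 := hzr.trans hr1
  set b := M ^ 2 * (1 + CA c₀ M K CD)
  have hX : z ^ 2 * X ≤ CD := by
    have : 0 ≤ z ^ 2 * Y := by positivity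
    linarith
  have hY : z ^ 2 * Y ≤ CD := by
    have : 0 ≤ z ^ 2 * X := by positivity
    linarith
  have z4 : z ^ 4 ≤ s := (by simpa using pow_le_pow_of_le_one hz.le hz1 (show 1 ≤ 4 by norm_num) : z ^ 4 ≤ z).trans hzs
  have z8 : z ^ 8 ≤ s := (by simpa using pow_le_pow_of_le_one hz.le hz1 (show 1 ≤ 8 by norm_num) : z ^ 8 ≤ z).trans hzs
  have hX6 : z ^ 6 * X ≤ s * CD := by
    calc z ^ 6 * X = z ^ 4 * (z ^ 2 * X) := by ring
      _ ≤ s * CD := by gcongr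
  have hY6 : z ^ 6 * Y ≤ s * CD := by
    calc z ^ 6 * Y = z ^ 4 * (z ^ 2 * Y) := by ring
      _ ≤ s * CD := by gcongr
  have hX10 : z ^ 10 * X ≤ s * CD := by
    calc z ^ 10 * X = z ^ 8 * (z ^ 2 * X) := by ring
      _ ≤ s * CD := by gcongr
  have hr4 : r ^ 4 * (z ^ 2 * X) ≤ s * CD := by
    have := h.r4.trans hs
    gcongr
  set k := 4 * M ^ 2 / c₀ + M ^ 2 * M / c₀ ^ 2
  have k0 : 0 ≤ k := by positivity
  have hzR : 0 ≤ z ^ 6 * R := by positivity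
  have f1 : z ^ 12 * ‖A1‖ ≤ 2 / c₀ * ((b * s) / c₀ + k * (s * CD)) := by
    calc z ^ 12 * ‖A1‖ ≤ z ^ 12 * (R * (B / c₀ + k * X)) := by gcongr
      _ = (z ^ 6 * R) * ((z ^ 6 * B) / c₀ + k * (z ^ 6 * X)) := by ring
      _ ≤ _ := by gcongr
  have f2 : z ^ 12 * (δ ^ 3 * ‖A2‖) ≤ 2 / c₀ * (4 * M * (b * s) + 4 * M ^ 2 * (s * CD)) := by
    calc z ^ 12 * (δ ^ 3 * ‖A2‖) ≤ z ^ 12 * (R * (4 * M * B + 4 * M ^ 2 * Y)) := by gcongr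
      _ = (z ^ 6 * R) * (4 * M * (z ^ 6 * B) + 4 * M ^ 2 * (z ^ 6 * Y)) := by ring
      _ ≤ _ := by gcongr
  have f3 : z ^ 12 * ((δ ^ 3 * K ^ 2 + r ^ 4 * δ) * ‖A3‖) ≤ 2 / c₀ * (K ^ 2 * M ^ 2 * (s * CD) + M ^ 2 * (s * CD)) := by
    calc z ^ 12 * ((δ ^ 3 * K ^ 2 + r ^ 4 * δ) * ‖A3‖) = (z ^ 16 * K ^ 2 + r ^ 4 * z ^ 8) * (δ ^ 2 * ‖A3‖) := by
          rw [hzδ]; ring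
      _ ≤ (z ^ 16 * K ^ 2 + r ^ 4 * z ^ 8) * (R * (M ^ 2 * X)) := by gcongr
      _ = (z ^ 6 * R) * (K ^ 2 * M ^ 2 * (z ^ 10 * X) + M ^ 2 * (r ^ 4 * (z ^ 2 * X))) := by ring
      _ ≤ _ := by gcongr
  have t1 := norm_add_le (A1 + Complex.I * σ * δ ^ 3 * A2) (-(Complex.I * σ * δ ^ 3 * a ^ 2 + Complex.I * o) * A3)
  have t2 := norm_add_le A1 (Complex.I * σ * δ ^ 3 * A2)
  rw [norm_mul (-(Complex.I * σ * δ ^ 3 * a ^ 2 + Complex.I * o))] at t1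
  have t3 := mul_le_mul_of_nonneg_right m3 (norm_nonneg A3)
  have t4 : ‖A1 + Complex.I * σ * δ ^ 3 * A2 + -(Complex.I * σ * δ ^ 3 * a ^ 2 + Complex.I * o) * A3‖
     ≤ ‖A1‖ + δ ^ 3 * ‖A2‖ + (δ ^ 3 * K ^ 2 + r ^ 4 * δ) * ‖A3‖ := by linarith
  have t5 := mul_le_mul_of_nonneg_left t4 (by positivity : 0 ≤ z ^ 12)
  have t6 : CB c₀ M K CD * s = 2 / c₀ * ((b * s) / c₀ + k * (s * CD)) + 2 / c₀ * (4 * M * (b * s) + 4 * M ^ 2 * (s * CD))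
      + 2 / c₀ * (K ^ 2 * M ^ 2 * (s * CD) + M ^ 2 * (s * CD)) := by
    unfold CB
    ring
  rw [t6]
  linarith

lemma Nz.intA0 (h : Nz c₀ M K CD r V V1 V2 V3 lam yc δ a σ ε o w w1 w2 φ φ1 G G1)
    (hsg : (∀ y ∈ Icc (0:ℝ) 1, 0 ≤ V2 y) ∨ (∀ y ∈ Icc (0:ℝ) 1, V2 y ≤ 0)) (hV : V yc = lam) :
    th V2 yc ^ 2 * ‖(V2 yc : ℂ) * φ yc + G yc‖ ≤ CF c₀ M K CD * Real.sqrt r := by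
  obtain ⟨z, z0, zr, hz4, hz2⟩ := h.sqrt
  have hS := h.sys.S
  have hL := h.sys.L
  have hδ := hL.hδ
  have hM := hS.M1
  have hc := hS.c0
  have hyc := h.crit.mem
  have hδ1 : δ ≤ 1 := h.δr.trans (pow_le_one₀ h.r0.le h.r1)
  have hm := mass_rr hS hδ hδ1 hyc hV
  have ht := h.test4 hsg z0 zr hz4 hz2
  have dh := (D1_T hS).ofReal.mul hL.dH
  have c1 := (D1_rr (lam := lam) hS hδ).c
  have hn := n2_prod (A := M ^ 2) (A1 := 4 * M ^ 2) (D1_T hS).ofReal hL.dH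
    (fun y hy => by rw [Complex.norm_real]; exact T_le hS hy) (fun y hy => h.supH hy)
    (n2_le_const (D1_T hS).ofReal.c' (by positivity) fun y hy => by rw [Complex.norm_real]; exact T1_le hS hy) h.nH1
  set hc' : ℂ := ((th V2 yc ^ 2 : ℝ) : ℂ) * ((V2 yc : ℂ) * φ yc + G yc) with hhc
  have cf : Continuous (fun y => ((th V2 y ^ 2 : ℝ) : ℂ) * ((V2 y : ℂ) * φ y + G y) - hc') := dh.c.sub continuous_const
  have hf : ∀ y ∈ Icc (0:ℝ) 1, ‖((th V2 y ^ 2 : ℝ) : ℂ) * ((V2 y : ℂ) * φ y + G y) - hc'‖ ^ 2 ≤ 0 ^ 2 + (17 * M ^ 3) ^ 2 * |y - yc| := by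
    intro y hy
    refine (dh.holder hyc hy).trans ?_
    have n0 := n2_nonneg (fun y => ((2 * (th V2 y * th1 V2 V3 y) : ℝ) : ℂ) * ((V2 y : ℂ) * φ y + G y)
      + ((th V2 y ^ 2 : ℝ) : ℂ) * ((V3 y : ℂ) * φ y + (V2 y : ℂ) * φ1 y + G1 y))
    have n1 := hn.trans (le_of_eq (by ring : 4 * M ^ 2 * (3 * M) + M ^ 2 * (5 * M) = 17 * M ^ 3))
    have n3 := pow_le_pow_left₀ n0 n1 2
    have := mul_le_mul_of_nonneg_left n3 (abs_nonneg (y - yc))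
    linarith
  have hw := wA_holder hS hδ h.crit cf le_rfl (by positivity : 0 ≤ 17 * M ^ 3) hf z0 hz4
  have hg := n2_rr32 (lam := lam) hS hδ z0 hz4
  have hcs := cs_rr (lam := lam) hS hδ cf (g := fun y => ((rr V lam δ y * Real.sqrt (rr V lam δ y) : ℝ) : ℂ)) (by fun_prop)
  have hJ : ‖J (fun y => ((rr V lam δ y ^ 2 : ℝ) : ℂ) * (((th V2 y ^ 2 : ℝ) : ℂ) * ((V2 y : ℂ) * φ y + G y) - hc'))‖
     ≤ J (fun y => Real.sqrt (rr V lam δ y) * (‖((th V2 y ^ 2 : ℝ) : ℂ) * ((V2 y : ℂ) * φ y + G y) - hc'‖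
        * ‖((rr V lam δ y * Real.sqrt (rr V lam δ y) : ℝ) : ℂ)‖)) := by
    refine norm_J_le_of (by fun_prop) (by fun_prop) fun y hy => le_of_eq ?_
    have h3 := rr_pos (V := V) (lam := lam) hδ y
    rw [norm_mul, Complex.norm_real, Complex.norm_real, Real.norm_of_nonneg (by positivity), Real.norm_of_nonneg (by positivity)]
    have : rr V lam δ y ^ 2 = Real.sqrt (rr V lam δ y) * (rr V lam δ y * Real.sqrt (rr V lam δ y)) := by
      have := Real.mul_self_sqrt h3.le
      linear_combination (-(rr V lam δ y)) * this
    rw [this]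
    ring
  have hJ2 := hJ.trans hcs
  have e1 : J (fun y => ((th V2 y ^ 2 * rr V lam δ y ^ 2 : ℝ) : ℂ) * ((V2 y : ℂ) * φ y + G y)) =
      hc' * ((J (fun y => rr V lam δ y ^ 2) : ℝ) : ℂ) +
      J (fun y => ((rr V lam δ y ^ 2 : ℝ) : ℂ) * (((th V2 y ^ 2 : ℝ) : ℂ) * ((V2 y : ℂ) * φ y + G y) - hc')) := by
    rw [← J_ofReal, ← J_cmulC, ← J_add (by fun_prop) (by fun_prop)]
    apply J_congr
    intro y _
    push_cast
    ring
  rw [e1] at ht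
  set W := Real.sqrt (wA V lam δ (fun y => ((th V2 y ^ 2 : ℝ) : ℂ) * ((V2 y : ℂ) * φ y + G y) - hc'))
  set Q := n2 (fun y => ((rr V lam δ y * Real.sqrt (rr V lam δ y) : ℝ) : ℂ))
  set P := J (fun y => ((rr V lam δ y ^ 2 : ℝ) : ℂ) * (((th V2 y ^ 2 : ℝ) : ℂ) * ((V2 y : ℂ) * φ y + G y) - hc'))
  set m := J (fun y => rr V lam δ y ^ 2)
  have W0 : 0 ≤ W := Real.sqrt_nonneg _
  have Q0 : 0 ≤ Q := n2_nonneg _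
  have hs := h.rs
  have hs0 := Real.sqrt_nonneg r
  have p1 : z ^ 12 * ‖P‖ ≤ 136 * M ^ 3 / c₀ ^ 2 * Real.sqrt r := by
    calc z ^ 12 * ‖P‖ ≤ z ^ 12 * (W * Q) := by gcongr
      _ = (z ^ 2 * W) * (z ^ 10 * Q) := by ring
      _ ≤ (4 / c₀ * (0 + 17 * M ^ 3 * z)) * (2 / c₀) := by gcongr
      _ = 136 * M ^ 3 / c₀ ^ 2 * z := by field_simp; ring
      _ ≤ _ := by
        have := zr.trans hs
        gcongr
  have p2 : ‖hc' * (m : ℂ)‖ ≤ ‖hc' * (m : ℂ) + P‖ + ‖P‖ := by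
    have := norm_sub_le (hc' * (m : ℂ) + P) P
    rwa [add_sub_cancel_right] at this
  have m0 : 0 ≤ m := J_nonneg fun y _ => by positivity
  rw [norm_mul, Complex.norm_real, Real.norm_of_nonneg m0] at p2
  have p3 := mul_le_mul_of_nonneg_left p2 (by positivity : 0 ≤ z ^ 12)
  have p4 : z ^ 12 * m = δ ^ 3 * m := by rw [hz4]; ring
  have p5 : ‖hc'‖ * (1 / (2 * (1 + M ^ 2) ^ 2)) ≤ (CB c₀ M K CD + 136 * M ^ 3 / c₀ ^ 2) * Real.sqrt r := by
    have := mul_le_mul_of_nonneg_left hm (norm_nonneg hc')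
    rw [← p4] at this
    linarith
  have p6 : th V2 yc ^ 2 * ‖(V2 yc : ℂ) * φ yc + G yc‖ = ‖hc'‖ := by
    rw [hhc, norm_mul, Complex.norm_real, Real.norm_of_nonneg (by positivity)]
  rw [p6]
  rw [mul_one_div, div_le_iff₀ (by positivity)] at p5
  unfold CF
  linarith

lemma Nz.intA (h : Nz c₀ M K CD r V V1 V2 V3 lam yc δ a σ ε o w w1 w2 φ φ1 G G1)
    (hsg : (∀ y ∈ Icc (0:ℝ) 1, 0 ≤ V2 y) ∨ (∀ y ∈ Icc (0:ℝ) 1, V2 y ≤ 0)) (hV : V yc = lam)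
    {v b : ℝ} (hv : 0 < v) (hb : 0 < b) (hv1 : v ≤ |V2 yc|) (hb1 : b ≤ yc * (1 - yc)) :
    ‖φ yc‖ * v ≤ (CF c₀ M K CD / (v ^ 2 * b ^ 2) + 2) * Real.sqrt r := by
  have h1 := h.intA0 hsg hV
  have h2 := h.supG h.crit.mem
  have h3 := h.r4.trans h.rs
  have h4 : ‖(V2 yc : ℂ) * φ yc‖ ≤ ‖(V2 yc : ℂ) * φ yc + G yc‖ + ‖G yc‖ := by
    have := norm_sub_le ((V2 yc : ℂ) * φ yc + G yc) (G yc)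
    rwa [add_sub_cancel_right] at this
  rw [norm_mul, Complex.norm_real, Real.norm_eq_abs] at h4
  have h5 : (v * b) ^ 2 ≤ th V2 yc ^ 2 := by
    unfold th
    rw [← sq_abs (V2 yc * _), abs_mul, abs_of_nonneg (hb.le.trans hb1)]
    gcongr
  have h6 : ‖(V2 yc : ℂ) * φ yc + G yc‖ ≤ CF c₀ M K CD / (v ^ 2 * b ^ 2) * Real.sqrt r := by
    rw [div_mul_eq_mul_div, le_div_iff₀ (by positivity)]
    have := mul_le_mul_of_nonneg_right h5 (norm_nonneg ((V2 yc : ℂ) * φ yc + G yc))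
    linarith
  have h7 := mul_le_mul_of_nonneg_right hv1 (norm_nonneg (φ yc))
  linarith

end test4

end OSP

namespace OSP

section comb
variable {V V1 V2 V3 : ℝ → ℝ} {c₀ M K CD r lam yc δ a σ ε : ℝ} {o : ℂ} {w w1 w2 φ φ1 G G1 : ℝ → ℂ}

lemma cpt_min (hV : Continuous V2) (hsg : (∀ y ∈ Ioo (0:ℝ) 1, 0 < V2 y) ∨ (∀ y ∈ Ioo (0:ℝ) 1, V2 y < 0)) {η : ℝ} (hη : 0 < η) :
    ∃ v, 0 < v ∧ ∀ y ∈ Icc η (1 - η), v ≤ |V2 y| := by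
  rcases (Icc η (1 - η)).eq_empty_or_nonempty with h | h
  · exact ⟨1, one_pos, by simp [h]⟩
  · obtain ⟨x, hx, hm⟩ := isCompact_Icc.exists_isMinOn h (f := fun y => |V2 y|) (by fun_prop)
    refine ⟨|V2 x|, abs_pos.2 ?_, fun y hy => hm hy⟩
    have hx' : x ∈ Ioo (0:ℝ) 1 := ⟨by linarith [hx.1], by linarith [hx.2]⟩
    rcases hsg with hs | hs
    · exact (hs x hx').ne'
    · exact (hs x hx').ne

lemma weak_sign (hV : Continuous V2) (hsg : (∀ y ∈ Ioo (0:ℝ) 1, 0 < V2 y) ∨ (∀ y ∈ Ioo (0:ℝ) 1, V2 y < 0)) :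
    (∀ y ∈ Icc (0:ℝ) 1, 0 ≤ V2 y) ∨ (∀ y ∈ Icc (0:ℝ) 1, V2 y ≤ 0) := by
  have hcl : closure (Ioo (0:ℝ) 1) = Icc 0 1 := closure_Ioo (by norm_num)
  rcases hsg with hs | hs
  · left
    rw [← hcl]
    exact fun y hy => (isClosed_le continuous_const hV).closure_subset_iff.2 (fun x hx => (hs x hx).le) hy
  · right
    rw [← hcl]
    exact fun y hy => (isClosed_le hV continuous_const).closure_subset_iff.2 (fun x hx => (hs x hx).le) hy

lemma normalized (hS : Shear c₀ M V V1 V2 V3)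
    (hsg : (∀ y ∈ Ioo (0:ℝ) 1, 0 < V2 y) ∨ (∀ y ∈ Ioo (0:ℝ) 1, V2 y < 0)) (hCD : 0 ≤ CD) :
    ∃ r, 0 < r ∧ r ≤ 1 ∧ ∀ {lam yc δ a σ ε : ℝ} {o : ℂ} {w w1 w2 φ φ1 G G1 : ℝ → ℂ},
      Nz c₀ M K CD r V V1 V2 V3 lam yc δ a σ ε o w w1 w2 φ φ1 G G1 → nH a φ φ1 < 1 := by
  have hc := hS.c0
  have hM := hS.M1
  obtain ⟨κ, hκ, hfin⟩ := fin_lemma hc hM hCD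
  have hsg' := weak_sign hS.d2.c hsg
  have hCP := CP_nonneg hc hM
  have hCL : 0 ≤ CL c₀ M (c₀ / 2) := by unfold CL; positivity
  set Q := CL c₀ M (c₀ / 2) * (3 * M) + 1 with hQ
  have hQ0 : 0 < Q := by positivity
  set ρ := (κ / Q) ^ 4 / 2 with hρ
  have hρ0 : 0 < ρ := by positivity
  set τ := min (c₀ * κ ^ 2) ρ with hτ
  have hτ0 : 0 < τ := lt_min (by positivity) hρ0
  have hη : 0 < τ / M := by positivity
  obtain ⟨v, hv, hvm⟩ := cpt_min hS.d2.c hsg hη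
  set b := (τ / M) ^ 2 with hb
  have hb0 : 0 < b := by positivity
  set S := 3 + 12 * CP c₀ M * M with hSS
  have hS0 : 0 < S := by positivity
  set g := min 1 (min (κ / (2 * S)) (κ / b)) with hg
  have hg0 : 0 < g := lt_min one_pos (lt_min (by positivity) (by positivity))
  set P := |CF c₀ M K CD / (v ^ 2 * b ^ 2)| + 2 with hP
  have hP0 : 0 < P := by positivity
  set R := min (min 1 ρ) (min (min κ (κ / (2 * (64 * M / c₀ ^ 2)))) ((g * b * v / P) ^ 2)) with hR
  have hR0 : 0 < R := by
    refine lt_min (lt_min one_pos hρ0) (lt_min (lt_min hκ (by positivity)) (by positivity))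
  have R1 : R ≤ 1 := (min_le_left _ _).trans (min_le_left _ _)
  have R2 : R ≤ ρ := (min_le_left _ _).trans (min_le_right _ _)
  have R3 : R ≤ κ := (min_le_right _ _).trans ((min_le_left _ _).trans (min_le_left _ _))
  have R4 : R ≤ κ / (2 * (64 * M / c₀ ^ 2)) := (min_le_right _ _).trans ((min_le_left _ _).trans (min_le_right _ _))
  have R5 : R ≤ (g * b * v / P) ^ 2 := (min_le_right _ _).trans (min_le_right _ _)
  refine ⟨R, hR0, R1, ?_⟩
  intro lam yc δ a σ ε o w w1 w2 φ φ1 G G1 h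
  have hyc := h.crit.mem
  have hδ := h.sys.L.hδ
  have hn := h.phi1
  have hδρ : δ ≤ ρ := h.δr.trans (h.r4.trans R2)
  have hbd : CL c₀ M (c₀ / 2) * Real.sqrt (Real.sqrt (τ + δ)) * (3 * M) ≤ κ := by
    have h1 : Real.sqrt (Real.sqrt (τ + δ)) ≤ κ / Q := by
      rw [Real.sqrt_le_left (by positivity), Real.sqrt_le_left (by positivity)]
      have : τ ≤ ρ := min_le_right _ _
      have e : ((κ / Q) ^ 2) ^ 2 = ρ + ρ := by rw [hρ]; ring
      linarith
    calc CL c₀ M (c₀ / 2) * Real.sqrt (Real.sqrt (τ + δ)) * (3 * M) = (CL c₀ M (c₀ / 2) * (3 * M)) * Real.sqrt (Real.sqrt (τ + δ)) := by ring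
      _ ≤ Q * (κ / Q) := by
        gcongr
        linarith
      _ = κ := by field_simp
  have hτκ : τ ≤ c₀ * κ ^ 2 := min_le_left _ _
  have hn1 : n2 φ1 ^ 2 ≤ 1 := pow_le_one₀ (n2_nonneg _) hn
  by_cases hl : lam ≤ V 0 + τ
  · have hb1 := bdry_left h.sys.S hδ h.crit h.sys.dφ h.sys.φ0 h.sys.φ1' hn hτ0.le hl
    refine hfin h ?_ (by linarith) R3
    have h1 : c₀ * yc ≤ τ := by
      rcases le_total lam (V 0) with h2 | h2
      · rw [h.crit.left h2]; linarith
      · have := h.crit.lo 0 ⟨le_rfl, zero_le_one⟩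
        rw [zero_sub, abs_neg, abs_of_nonneg hyc.1, abs_of_nonpos (by linarith)] at this
        linarith
    have h2 : yc ≤ κ ^ 2 := le_of_mul_le_mul_left (h1.trans hτκ) hc
    have h3 := h.sys.dφ.holder ⟨le_rfl, zero_le_one⟩ hyc
    rw [h.sys.φ0, sub_zero, sub_zero, abs_of_nonneg hyc.1] at h3
    refine le_sq ?_ hκ.le
    nlinarith [hyc.1]
  by_cases hl2 : V 1 - τ ≤ lam
  · have hb1 := bdry_right h.sys.S hδ h.crit h.sys.dφ h.sys.φ0 h.sys.φ1' hn hτ0.le hl2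
    refine hfin h ?_ (by linarith) R3
    have hy1 := hyc.2
    have h1 : c₀ * (1 - yc) ≤ τ := by
      rcases le_total (V 1) lam with h2 | h2
      · rw [h.crit.right h2]; linarith
      · have := h.crit.lo 1 ⟨zero_le_one, le_rfl⟩
        rw [abs_of_nonneg (by linarith), abs_of_nonneg (by linarith)] at this
        linarith
    have h2 : 1 - yc ≤ κ ^ 2 := le_of_mul_le_mul_left (h1.trans hτκ) hc
    have h3 := h.sys.dφ.holder ⟨zero_le_one, le_rfl⟩ hyc
    rw [h.sys.φ1', sub_zero, abs_sub_comm, abs_of_nonneg (by linarith)] at h3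
    refine le_sq ?_ hκ.le
    nlinarith
  · push Not at hl hl2
    have hV := h.crit.mid (by linarith) (by linarith)
    have g1 := hS.lip0 le_rfl hyc.1 hyc.2
    have g2 := hS.lip0 hyc.1 hyc.2 le_rfl
    have y1 : τ / M ≤ yc := by
      rw [div_le_iff₀ (by linarith)]
      have := le_abs_self (V yc - V 0)
      linarith
    have y2 : τ / M ≤ 1 - yc := by
      rw [div_le_iff₀ (by linarith)]
      have := le_abs_self (V 1 - V yc)
      linarith
    have hby : b ≤ yc * (1 - yc) := by
      rw [hb, sq]
      exact mul_le_mul y1 y2 hη.le (by linarith [hyc.1])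
    have hA := h.intA hsg' hV hv hb0 (hvm yc ⟨y1, by linarith⟩) hby
    have hsq : Real.sqrt R ≤ g * b * v / P := by
      rw [Real.sqrt_le_left (by positivity)]
      exact R5
    have hφ : ‖φ yc‖ ≤ g * b := by
      have h1 : (CF c₀ M K CD / (v ^ 2 * b ^ 2) + 2) * Real.sqrt R ≤ P * (g * b * v / P) := by
        have : CF c₀ M K CD / (v ^ 2 * b ^ 2) + 2 ≤ P := by
          rw [hP]; linarith [le_abs_self (CF c₀ M K CD / (v ^ 2 * b ^ 2))]
        gcongr
      have h2 : P * (g * b * v / P) = g * b * v := by field_simp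
      rw [h2] at h1
      exact le_of_mul_le_mul_right (hA.trans h1) hv
    have hB := h.intB hV hb0 hby (min_le_left _ _) hφ
    refine hfin h (hφ.trans ?_) ?_ R3
    · have : g ≤ κ / b := (min_le_right _ _).trans (min_le_right _ _)
      rwa [le_div_iff₀ hb0] at this
    · have e1 : g ≤ κ / (2 * S) := (min_le_right _ _).trans (min_le_left _ _)
      rw [le_div_iff₀ (by positivity)] at e1 R4
      linarith

end comb

section scale
variable {V V1 V2 V3 : ℝ → ℝ} {c₀ M lam δ a σ ε : ℝ} {o : ℂ} {w w1 w2 φ φ1 G G1 : ℝ → ℂ}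

lemma D1.smul {f f1 : ℝ → ℂ} (hf : D1 f f1) (c : ℂ) : D1 (fun y => c * f y) (fun y => c * f1 y) :=
  ((D1.const c).mul hf).congr' (fun y => by simp)

lemma n2_smul (c : ℝ) (hc : 0 ≤ c) (f : ℝ → ℂ) : n2 (fun y => (c : ℂ) * f y) = c * n2 f := by
  have : J (fun y => ‖(c : ℂ) * f y‖ ^ 2) = c ^ 2 * J (fun y => ‖f y‖ ^ 2) := by
    rw [← J_cmul]
    apply J_congr
    intro y _
    rw [norm_mul, Complex.norm_real, Real.norm_of_nonneg hc, mul_pow]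
  unfold n2
  rw [this, Real.sqrt_mul (sq_nonneg c), Real.sqrt_sq hc]

lemma nH_smul (c : ℝ) (hc : 0 ≤ c) (f f1 : ℝ → ℂ) :
    nH a (fun y => (c : ℂ) * f y) (fun y => (c : ℂ) * f1 y) = c * nH a f f1 := by
  unfold nH
  rw [n2_smul c hc, n2_smul c hc]
  rw [show (c * n2 f1) ^ 2 + a ^ 2 * (c * n2 f) ^ 2 = c ^ 2 * (n2 f1 ^ 2 + a ^ 2 * n2 f ^ 2) by ring,
    Real.sqrt_mul (sq_nonneg c), Real.sqrt_sq hc]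

lemma Sys.smul (h : Sys c₀ M V V1 V2 V3 lam δ a σ ε o w w1 w2 φ φ1 G G1) (c : ℂ) :
    Sys c₀ M V V1 V2 V3 lam δ a σ ε o (fun y => c * w y) (fun y => c * w1 y) (fun y => c * w2 y)
      (fun y => c * φ y) (fun y => c * φ1 y) (fun y => c * G y) (fun y => c * G1 y) := by
  have hL := h.L
  refine ⟨h.S, ⟨hL.hδ, hL.ha, hL.hκ, hL.hσ, hL.hε0, hL.hε1, hL.ho, hL.dw.smul c, hL.dw1.smul c, ?_, by simp [hL.w0],
    by simp [hL.w1], ?_⟩, h.dφ.smul c, ?_, h.dG.smul c, by simp [h.φ0], by simp [h.φ1']⟩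
  · exact (hL.dH.smul c).congr (fun y => by ring) (fun y => by ring)
  · intro y
    have := hL.eq y
    linear_combination c * this
  · exact (h.dφ1.smul c).congr' (fun y => by ring)

lemma nonlocal (hS : Shear c₀ M V V1 V2 V3)
    (hsg : (∀ y ∈ Ioo (0:ℝ) 1, 0 < V2 y) ∨ (∀ y ∈ Ioo (0:ℝ) 1, V2 y < 0)) :
    ∃ C ε₁ δ₀ : ℝ, 0 < C ∧ 0 < ε₁ ∧ 0 < δ₀ ∧
      ∀ {lam δ a σ ε : ℝ} {o : ℂ} {w w1 w2 φ φ1 G G1 : ℝ → ℂ},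
      Sys c₀ M V V1 V2 V3 lam δ a σ ε o w w1 w2 φ φ1 G G1 → ε ≤ ε₁ → δ ≤ δ₀ → nH a φ φ1 ≤ C * nH a G G1 := by
  have hc := hS.c0
  have hM := hS.M1
  obtain ⟨K, Cl, εl, hK, hCl, hεl, hlarge⟩ := large_a hc hM
  obtain ⟨CD, εD, hCD, hεD, -, hD⟩ := local_D hc hM
  obtain ⟨r, hr0, hr1, hnz⟩ := normalized (K := K) hS hsg (by positivity : 0 ≤ CD * (3 * M + 2))
  refine ⟨Cl + 1 / r ^ 4, min (min εl εD) (r ^ 4), r ^ 4, by positivity, lt_min (lt_min hεl hεD) (by positivity),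
    by positivity, ?_⟩
  intro lam δ a σ ε o w w1 w2 φ φ1 G G1 h hε hδr
  have N0 := nH_nonneg a G G1
  have e0 := nH_nonneg a φ φ1
  have ε1 : ε ≤ εl := hε.trans ((min_le_left _ _).trans (min_le_left _ _))
  have ε2 : ε ≤ εD := hε.trans ((min_le_left _ _).trans (min_le_right _ _))
  have ε3 : ε ≤ r ^ 4 := hε.trans (min_le_right _ _)
  rcases le_total K a with ha | ha
  · have := hlarge h ε1 ha
    have h2 : 0 ≤ 1 / r ^ 4 * nH a G G1 := by positivity
    linarith
  · by_contra hcon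
    push Not at hcon
    have h1 : 1 / r ^ 4 * nH a G G1 < nH a φ φ1 := by
      have : 0 ≤ Cl * nH a G G1 := by positivity
      linarith
    have ep : 0 < nH a φ φ1 := lt_of_le_of_lt (by positivity) h1
    set e := nH a φ φ1 with he
    have hs := h.smul ((e⁻¹ : ℝ) : ℂ)
    have i0 : 0 ≤ e⁻¹ := by positivity
    have n1 : nH a (fun y => ((e⁻¹ : ℝ) : ℂ) * φ y) (fun y => ((e⁻¹ : ℝ) : ℂ) * φ1 y) = 1 := by
      rw [nH_smul _ i0, ← he]; field_simp
    have n2' : nH a (fun y => ((e⁻¹ : ℝ) : ℂ) * G y) (fun y => ((e⁻¹ : ℝ) : ℂ) * G1 y) ≤ r ^ 4 := by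
      rw [nH_smul _ i0, inv_mul_le_iff₀ ep]
      rw [one_div, inv_mul_lt_iff₀ (by positivity)] at h1
      linarith
    obtain ⟨yc, hyc⟩ := exists_crit hS lam
    have := hnz (lam := lam) (yc := yc) ⟨hs, hyc, hK, by positivity, ha, hr0, hr1, hδr, ε3, n2', n1.le, ?_⟩
    · linarith
    · have d1 := hD hs.S hs.L ε2
      have d2 := hs.nH_le
      rw [n1] at d2
      have hδ := h.L.hδ
      have sa : 1 ≤ Real.sqrt a := Real.one_le_sqrt.2 h.L.ha
      have sδ := Real.sqrt_pos.2 hδ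
      have hr4 : r ^ 4 ≤ 1 := pow_le_one₀ hr0.le hr1
      rw [← mul_div_assoc, le_div_iff₀ (by positivity)] at d1
      set D := n2 (fun y => ((e⁻¹ : ℝ) : ℂ) * w y) + δ * n2 (fun y => ((e⁻¹ : ℝ) : ℂ) * w1 y)
      have D0 : 0 ≤ D := add_nonneg (n2_nonneg _) (mul_nonneg hδ.le (n2_nonneg _))
      have d3 := mul_le_mul_of_nonneg_left (d2.trans (by linarith : _ ≤ 3 * M + 2)) hCD.le
      have d4 : Real.sqrt δ * D * 1 ≤ Real.sqrt δ * D * Real.sqrt a := by gcongr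
      linarith

end scale

end OSP

namespace OSP

section final
variable {V V1 V2 V3 : ℝ → ℝ} {c₀ M lam δ a σ ε : ℝ} {o : ℂ} {w w1 w2 φ φ1 G G1 : ℝ → ℂ}

lemma coef_bound {ψ : ℝ → ℝ} {v B K L : ℝ} (ha : 1 ≤ a) (hV : Continuous V) (hw : Continuous w)
    (hψ : Continuous ψ) (hψ0 : ∀ y ∈ Icc (0:ℝ) 1, 0 ≤ ψ y) (hψ1 : ∀ y ∈ Icc (0:ℝ) 1, ψ y ≤ 1)
    (hn : √a * n2 ψ ≤ 1) (hd : ∀ y ∈ Icc (0:ℝ) 1, a * |V y - v| * ψ y ≤ B)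
    (h1 : a * n2 (fun y => (V y - lam) * ‖w y‖) ≤ K) (h2 : J (fun y => ‖w y‖) ≤ L) (hB : 0 ≤ B) :
    (1 + a * |lam - v|) * ‖J (fun y => (ψ y : ℂ) * w y)‖ ≤ (1 + B) * L + K / √a := by
  have ha0 : 0 < a := by linarith
  have hs : 0 < √a := Real.sqrt_pos.2 ha0
  have hψc : Continuous fun y => (ψ y : ℂ) := Complex.continuous_ofReal.comp hψ
  have A1 : ‖J (fun y => (ψ y : ℂ) * w y)‖ ≤ L := by
    refine le_trans (norm_J_le_of (hψc.mul hw) hw.norm fun y hy => ?_) h2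
    rw [norm_mul, Complex.norm_real, Real.norm_of_nonneg (hψ0 y hy)]
    exact mul_le_of_le_one_left (norm_nonneg _) (hψ1 y hy)
  have A2 : a * |lam - v| * ‖J (fun y => (ψ y : ℂ) * w y)‖ ≤ B * L + K / √a := by
    have e : ((a * (lam - v) : ℝ) : ℂ) * J (fun y => (ψ y : ℂ) * w y)
        = J (fun y => ((a * (V y - v) * ψ y : ℝ) : ℂ) * w y)
          - J (fun y => ((a * ψ y * (V y - lam) : ℝ) : ℂ) * w y) := by
      rw [← J_cmulC, ← J_sub]
      · apply J_congr
        intro y _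
        push_cast
        ring
      · exact (Complex.continuous_ofReal.comp (by fun_prop)).mul hw
      · exact (Complex.continuous_ofReal.comp (by fun_prop)).mul hw
    have e1 : a * |lam - v| * ‖J (fun y => (ψ y : ℂ) * w y)‖
        = ‖((a * (lam - v) : ℝ) : ℂ) * J (fun y => (ψ y : ℂ) * w y)‖ := by
      rw [norm_mul, Complex.norm_real, Real.norm_eq_abs, abs_mul, abs_of_pos ha0]
    rw [e1, e]
    refine (norm_sub_le _ _).trans (add_le_add ?_ ?_)
    · calc _ ≤ J (fun y => B * ‖w y‖) := by
            refine norm_J_le_of ((Complex.continuous_ofReal.comp (by fun_prop)).mul hw) (by fun_prop) fun y hy => ?_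
            rw [norm_mul, Complex.norm_real, Real.norm_eq_abs, abs_mul, abs_mul, abs_of_pos ha0,
              abs_of_nonneg (hψ0 y hy)]
            exact mul_le_mul_of_nonneg_right (hd y hy) (norm_nonneg _)
        _ = B * J (fun y => ‖w y‖) := J_cmul _ _
        _ ≤ _ := by gcongr
    · have hc : Continuous fun y => (V y - lam) * ‖w y‖ := by fun_prop
      calc _ ≤ J (fun y => a * (‖ψ y‖ * ‖(V y - lam) * ‖w y‖‖)) := by
            refine norm_J_le_of ((Complex.continuous_ofReal.comp (by fun_prop)).mul hw) (by fun_prop) fun y hy => ?_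
            rw [norm_mul, Complex.norm_real, norm_mul, norm_mul, norm_mul, norm_norm,
              Real.norm_of_nonneg ha0.le]
            apply le_of_eq
            ring
        _ = a * J (fun y => ‖ψ y‖ * ‖(V y - lam) * ‖w y‖‖) := J_cmul _ _
        _ ≤ a * (n2 ψ * n2 (fun y => (V y - lam) * ‖w y‖)) :=
            mul_le_mul_of_nonneg_left (cs hψ hc) ha0.le
        _ = n2 ψ * (a * n2 (fun y => (V y - lam) * ‖w y‖)) := by ring
        _ ≤ (1 / √a) * K := by
            have : n2 ψ ≤ 1 / √a := by rw [le_div_iff₀ hs]; linarith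
            exact mul_le_mul this h1 (mul_nonneg ha0.le (n2_nonneg _)) (by positivity)
        _ = _ := by ring
  linarith

lemma psi_facts {b : ℝ} (hb : 0 < b) {x : ℝ} (hx : x ∈ Icc (0:ℝ) 1) :
    0 ≤ Real.sinh (b * (1 - x)) / Real.sinh b ∧
      Real.sinh (b * (1 - x)) / Real.sinh b ≤ Real.exp (-(b * x)) := by
  have h1 : 0 ≤ b * (1 - x) := mul_nonneg hb.le (by linarith [hx.2])
  have h2 : 0 ≤ b * x := mul_nonneg hb.le hx.1
  have hs : 0 < Real.sinh b := Real.sinh_pos_iff.2 hb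
  have h3 : 0 ≤ Real.sinh (b * (1 - x)) := Real.sinh_nonneg_iff.2 h1
  refine ⟨div_nonneg h3 hs.le, ?_⟩
  rw [div_le_iff₀ hs]
  have e : Real.sinh b = Real.sinh (b * (1 - x)) * Real.cosh (b * x)
      + Real.cosh (b * (1 - x)) * Real.sinh (b * x) := by
    rw [← Real.sinh_add]
    congr 1
    ring
  have h4 : Real.sinh (b * (1 - x)) * Real.exp (b * x) ≤ Real.sinh b := by
    rw [e, ← Real.cosh_add_sinh (b * x), mul_add]
    have h5 : 0 ≤ Real.sinh (b * x) := Real.sinh_nonneg_iff.2 h2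
    have h6 := (Real.sinh_lt_cosh (b * (1 - x))).le
    nlinarith
  calc _ = Real.exp (-(b * x)) * (Real.sinh (b * (1 - x)) * Real.exp (b * x)) := by
        rw [mul_left_comm, ← Real.exp_add]; simp
    _ ≤ _ := by gcongr

lemma J_exp_le (b : ℝ) : b * J (fun y => Real.exp (-(b * y))) ≤ 1 := by
  have hd : D1 (fun y => -Real.exp (-(b * y))) (fun y => b * Real.exp (-(b * y))) := by
    refine ⟨by fun_prop, by fun_prop, fun x _ => ?_⟩
    have h := (((hasDerivAt_id x).const_mul b).neg.exp).neg
    refine h.congr_deriv ?_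
    simp only [Pi.neg_apply, id]
    ring
  rw [← J_cmul, hd.ftc]
  simp only [mul_zero, neg_zero, Real.exp_zero]
  linarith [Real.exp_pos (-(b * 1))]

lemma J_refl (f : ℝ → ℝ) : J (fun y => f (1 - y)) = J f := by
  unfold J
  rw [intervalIntegral.integral_comp_sub_left]
  simp

lemma psi_n2 {b : ℝ} (hb : 0 < b) :
    √b * n2 (fun x => Real.sinh (b * (1 - x)) / Real.sinh b) ≤ 1 := by
  refine le_sq ?_ zero_le_one
  rw [mul_pow, Real.sq_sqrt hb.le, n2_sq, one_pow]
  refine le_trans (mul_le_mul_of_nonneg_left ?_ hb.le) (J_exp_le b)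
  have hc : Continuous fun x => Real.sinh (b * (1 - x)) / Real.sinh b := by
    simp only [div_eq_mul_inv]
    exact (Real.continuous_sinh.comp (by fun_prop)).mul continuous_const
  refine J_mono (hc.norm.pow 2) (by fun_prop) fun y hy => ?_
  obtain ⟨p0, p1⟩ := psi_facts hb hy
  rw [Real.norm_of_nonneg p0]
  have : Real.exp (-(b * y)) ≤ 1 := Real.exp_le_one_iff.2 (by nlinarith [hy.1])
  nlinarith

lemma psi_n2' {b : ℝ} (hb : 0 < b) :
    √b * n2 (fun x => Real.sinh (b * x) / Real.sinh b) ≤ 1 := by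
  refine le_of_eq_of_le ?_ (psi_n2 hb)
  unfold n2
  rw [← J_refl]

lemma xexp (t : ℝ) : t * Real.exp (-t) ≤ 1 := by
  have h := Real.add_one_le_exp t
  have h0 := Real.exp_pos (-t)
  calc t * Real.exp (-t) ≤ Real.exp t * Real.exp (-t) := by
        apply mul_le_mul_of_nonneg_right _ h0.le; linarith
    _ = 1 := by rw [← Real.exp_add]; simp

theorem abstract_final (hS : Shear c₀ M V V1 V2 V3)
    (hsg : (∀ y ∈ Ioo (0:ℝ) 1, 0 < V2 y) ∨ (∀ y ∈ Ioo (0:ℝ) 1, V2 y < 0)) :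
    ∃ C ε₁ δ₀, 0 < C ∧ 0 < ε₁ ∧ ε₁ ≤ 1 ∧ 0 < δ₀ ∧
      ∀ {lam δ a σ ε : ℝ} {o : ℂ} {w w1 w2 φ φ1 G G1 : ℝ → ℂ},
        Sys c₀ M V V1 V2 V3 lam δ a σ ε o w w1 w2 φ φ1 G G1 → ε ≤ ε₁ → δ ≤ δ₀ →
        (1 + a * |lam - V 0|) * ‖J (fun y => ((Real.sinh (a * (1 - y)) / Real.sinh a : ℝ) : ℂ) * w y)‖
        + (1 + a * |lam - V 1|) * ‖J (fun y => ((Real.sinh (a * y) / Real.sinh a : ℝ) : ℂ) * w y)‖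
        ≤ C * (nH a G G1 / (√a * √(√(a * δ)))) := by
  obtain ⟨C1, ε1, hC1, hε1, hε1', H1⟩ := local_Z hS.c0 hS.M1
  obtain ⟨C2, ε2, δ2, hC2, hε2, hδ2, H2⟩ := nonlocal hS hsg
  have hM := hS.M1
  have hM0 : 0 < M := by linarith
  refine ⟨2 * ((1 + M) * (C1 * (3 * M * C2 + 2)) + √(√M) * (C1 * (3 * M * C2 + 2))),
    min ε1 ε2, δ2, by positivity, lt_min hε1 hε2, (min_le_left _ _).trans (by linarith), hδ2, ?_⟩
  intro lam δ a σ ε o w w1 w2 φ φ1 G G1 h hε hδ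
  have ha := h.L.ha
  have ha0 : 0 < a := by linarith
  have hδ0 := h.L.hδ
  obtain ⟨l1, l2⟩ := H1 hS h.L (hε.trans (min_le_left _ _))
  have n1 := H2 h (hε.trans (min_le_right _ _)) hδ
  have n2' := h.nH_le
  set N := nH a G G1 with hN
  have hN0 : 0 ≤ N := nH_nonneg _ _ _
  set NH := nH a (fun y => (V2 y : ℂ) * φ y + G y)
    (fun y => (V3 y : ℂ) * φ y + (V2 y : ℂ) * φ1 y + G1 y) with hNH
  have n3 : NH ≤ (3 * M * C2 + 2) * N := by
    have : 3 * M * nH a φ φ1 ≤ 3 * M * (C2 * N) := by gcongr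
    linarith
  set D := √a * √(√(a * δ)) with hD
  have hsa : 0 < √a := Real.sqrt_pos.2 ha0
  have hD0 : 0 < D := by positivity
  have hDle : D ≤ √a * √(√M) := by
    rw [hD]
    exact mul_le_mul_of_nonneg_left (Real.sqrt_le_sqrt (Real.sqrt_le_sqrt h.L.hκ)) hsa.le
  set K := C1 * (3 * M * C2 + 2) with hK
  have hK0 : 0 < K := by positivity
  have k1 : a * n2 (fun y => (V y - lam) * ‖w y‖) ≤ K * N :=
    l1.trans (by rw [hK, mul_assoc]; gcongr)
  have k2 : J (fun y => ‖w y‖) ≤ K * (N / D) := by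
    refine l2.trans ?_
    rw [hK, mul_assoc C1, ← mul_div_assoc (3 * M * C2 + 2)]
    exact mul_le_mul_of_nonneg_left (div_le_div_of_nonneg_right n3 hD0.le) hC1.le
  have k3 : K * N / √a ≤ √(√M) * K * (N / D) := by
    rw [← mul_div_assoc, div_le_div_iff₀ hsa hD0]
    calc K * N * D ≤ K * N * (√a * √(√M)) := by gcongr
      _ = _ := by ring
  have hw := h.L.dw.c
  have hV := hS.d0.c
  have cψ1 : Continuous fun x => Real.sinh (a * (1 - x)) / Real.sinh a := by
    simp only [div_eq_mul_inv]
    exact (Real.continuous_sinh.comp (by fun_prop)).mul continuous_const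
  have cψ2 : Continuous fun x => Real.sinh (a * x) / Real.sinh a := by
    simp only [div_eq_mul_inv]
    exact (Real.continuous_sinh.comp (by fun_prop)).mul continuous_const
  have ex1 : ∀ x : ℝ, 0 ≤ x → Real.exp (-(a * x)) ≤ 1 := fun x hx =>
    Real.exp_le_one_iff.2 (by nlinarith)
  have dist : ∀ x t d : ℝ, 0 ≤ x → |d| ≤ M * x → 0 ≤ t → t ≤ Real.exp (-(a * x)) →
      a * |d| * t ≤ M := by
    intro x t d hx hd ht hte
    calc a * |d| * t ≤ a * (M * x) * Real.exp (-(a * x)) := by gcongr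
      _ = M * (a * x * Real.exp (-(a * x))) := by ring
      _ ≤ M * 1 := by gcongr; exact xexp _
      _ = M := mul_one M
  have refl : ∀ y ∈ Icc (0:ℝ) 1, (1 - y) ∈ Icc (0:ℝ) 1 := fun y hy =>
    ⟨by linarith [hy.2], by linarith [hy.1]⟩
  have pf2 : ∀ y ∈ Icc (0:ℝ) 1, 0 ≤ Real.sinh (a * y) / Real.sinh a ∧
      Real.sinh (a * y) / Real.sinh a ≤ Real.exp (-(a * (1 - y))) := by
    intro y hy
    have := psi_facts ha0 (refl y hy)
    simpa using this
  have r1 := coef_bound (lam := lam) (v := V 0) (B := M) ha hV hw cψ1 (fun y hy => (psi_facts ha0 hy).1)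
    (fun y hy => (psi_facts ha0 hy).2.trans (ex1 y hy.1)) (psi_n2 ha0)
    (fun y hy => dist y _ _ hy.1 (by rw [abs_of_nonneg (by linarith [hS.vlo y])]; have := hS.lip0 le_rfl hy.1 hy.2; linarith)
      (psi_facts ha0 hy).1 (psi_facts ha0 hy).2) k1 k2 hM0.le
  have r2 := coef_bound (lam := lam) (v := V 1) (B := M) ha hV hw cψ2 (fun y hy => (pf2 y hy).1)
    (fun y hy => (pf2 y hy).2.trans (ex1 _ (refl y hy).1)) (psi_n2' ha0)
    (fun y hy => dist (1 - y) _ _ (refl y hy).1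
      (by rw [abs_sub_comm, abs_of_nonneg (by linarith [hS.vhi y])]; have := hS.lip0 hy.1 hy.2 le_rfl; linarith)
      (pf2 y hy).1 (pf2 y hy).2) k1 k2 hM0.le
  calc _ ≤ ((1 + M) * (K * (N / D)) + K * N / √a) + ((1 + M) * (K * (N / D)) + K * N / √a) :=
        add_le_add r1 r2
    _ ≤ ((1 + M) * (K * (N / D)) + √(√M) * K * (N / D)) + ((1 + M) * (K * (N / D)) + √(√M) * K * (N / D)) := by
        gcongr
    _ = _ := by ring

end final

end OSP

namespace OSP

/-- Clamp to `[0,1]`. -/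
def cl (y : ℝ) : ℝ := max 0 (min y 1)

lemma cl_mem (y : ℝ) : cl y ∈ Icc (0:ℝ) 1 :=
  ⟨le_max_left _ _, max_le zero_le_one (min_le_right _ _)⟩

lemma cl_eq {y : ℝ} (hy : y ∈ Icc (0:ℝ) 1) : cl y = y := by
  unfold cl
  rw [min_eq_left hy.2, max_eq_right hy.1]

lemma cl_cont : Continuous cl := by unfold cl; fun_prop

section ext
variable {E : Type*} [NormedAddCommGroup E] [NormedSpace ℝ E]

lemma ext_cont {f : ℝ → E} (hf : ContinuousOn f (Icc 0 1)) : Continuous fun y => f (cl y) :=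
  hf.comp_continuous cl_cont cl_mem

lemma cdo_deriv {f : ℝ → E} {n : ℕ} (hf : ContDiffOn ℝ (n + 1 : ℕ) f (Icc 0 1)) :
    ContDiffOn ℝ n (derivWithin f (Icc 0 1)) (Icc 0 1) := by
  have h := (contDiffOn_succ_iff_derivWithin (n := (n : WithTop ℕ∞)) (uniqueDiffOn_Icc (zero_lt_one (α := ℝ)))).1
    (by exact_mod_cast hf)
  exact h.2.2

lemma ext_D1 {f : ℝ → E} (hf : ContDiffOn ℝ 1 f (Icc 0 1)) :
    D1 (fun y => f (cl y)) (fun y => derivWithin f (Icc 0 1) (cl y)) := by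
  refine ⟨ext_cont hf.continuousOn, ext_cont (cdo_deriv (n := 0) (by exact_mod_cast hf)).continuousOn, ?_⟩
  intro x hx
  have hx' : x ∈ Icc (0:ℝ) 1 := Ioo_subset_Icc_self hx
  have h1 := ((hf.differentiableOn one_ne_zero) x hx').hasDerivWithinAt.hasDerivAt (Icc_mem_nhds hx.1 hx.2)
  rw [cl_eq hx']
  refine h1.congr_of_eventuallyEq ?_
  filter_upwards [Icc_mem_nhds hx.1 hx.2] with y hy
  rw [cl_eq hy]

lemma eqOn_Icc {f g : ℝ → E} (hf : ContinuousOn f (Icc 0 1)) (hg : ContinuousOn g (Icc 0 1))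
    (h : ∀ y ∈ Ioo (0:ℝ) 1, f y = g y) : ∀ y ∈ Icc (0:ℝ) 1, f y = g y := by
  have hcl : closure (Ioo (0:ℝ) 1) = Icc 0 1 := closure_Ioo (by norm_num)
  exact Set.EqOn.of_subset_closure (s := Ioo (0:ℝ) 1) (fun y hy => h y hy) hf hg Ioo_subset_Icc_self hcl.ge

lemma int_Ioo (f : ℝ → E) : ∫ y in Ioo (0:ℝ) 1, f y = J f := by
  unfold J
  rw [intervalIntegral.integral_of_le zero_le_one, integral_Ioc_eq_integral_Ioo]

lemma bdd_Icc {f : ℝ → ℝ} (hf : ContinuousOn f (Icc 0 1)) : ∃ M, ∀ y ∈ Icc (0:ℝ) 1, |f y| ≤ M := by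
  obtain ⟨M, hM⟩ := isCompact_Icc.exists_bound_of_continuousOn hf
  exact ⟨M, hM⟩

end ext

lemma shear_of_good {V : ℝ → ℝ} (hV : GoodShear V) :
    ∃ c₀ M, supDV V ≤ M ∧ Shear c₀ M (fun y => V (cl y)) (fun y => dIR V (cl y))
      (fun y => dIR (dIR V) (cl y)) (fun y => dIR (dIR (dIR V)) (cl y)) := by
  obtain ⟨h4, ⟨c, hc, hlo⟩, -⟩ := hV
  have d1 : ContDiffOn ℝ 3 (dIR V) (Icc 0 1) := by
    have := cdo_deriv (n := 3) (f := V) (by exact_mod_cast h4)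
    exact_mod_cast this
  have d2 : ContDiffOn ℝ 2 (dIR (dIR V)) (Icc 0 1) := by
    have := cdo_deriv (n := 2) (f := dIR V) (by exact_mod_cast d1)
    exact_mod_cast this
  have d3 : ContDiffOn ℝ 1 (dIR (dIR (dIR V))) (Icc 0 1) := by
    have := cdo_deriv (n := 1) (f := dIR (dIR V)) (by exact_mod_cast d2)
    exact_mod_cast this
  obtain ⟨M1, b1⟩ := bdd_Icc d1.continuousOn
  obtain ⟨M2, b2⟩ := bdd_Icc d2.continuousOn
  obtain ⟨M3, b3⟩ := bdd_Icc d3.continuousOn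
  have hmono : MonotoneOn V (Icc 0 1) := by
    refine monotoneOn_of_deriv_nonneg (convex_Icc 0 1) h4.continuousOn ?_ ?_
    · exact (h4.differentiableOn (by norm_num)).mono interior_subset
    · intro x hx
      rw [interior_Icc] at hx
      rw [← derivWithin_of_mem_nhds (Icc_mem_nhds hx.1 hx.2)]
      exact hc.le.trans (hlo x (Ioo_subset_Icc_self hx))
  have z0 : (0:ℝ) ∈ Icc (0:ℝ) 1 := ⟨le_rfl, zero_le_one⟩
  have z1 : (1:ℝ) ∈ Icc (0:ℝ) 1 := ⟨zero_le_one, le_rfl⟩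
  refine ⟨min c 1, max 1 (max M1 (max M2 M3)), ?_, ?_⟩
  · unfold supDV
    apply csSup_le (Set.Nonempty.image _ ⟨0, z0⟩)
    rintro _ ⟨y, hy, rfl⟩
    exact (le_abs_self _).trans ((b1 y hy).trans ((le_max_left _ _).trans (le_max_right _ _)))
  · exact {
      c0 := lt_min hc one_pos
      c1 := min_le_right _ _
      M1 := le_max_left _ _
      d0 := ext_D1 (h4.of_le (by norm_num))
      d1 := ext_D1 (d1.of_le (by norm_num))
      d2 := ext_D1 (d2.of_le (by norm_num))
      lo := fun y => (min_le_left _ _).trans (hlo _ (cl_mem y))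
      b1 := fun y => (b1 _ (cl_mem y)).trans ((le_max_left _ _).trans (le_max_right _ _))
      b2 := fun y => (b2 _ (cl_mem y)).trans
        ((le_max_left _ _).trans ((le_max_right _ _).trans (le_max_right _ _)))
      b3 := fun y => (b3 _ (cl_mem y)).trans
        ((le_max_right _ _).trans ((le_max_right _ _).trans (le_max_right _ _)))
      vlo := fun y => by
        simp only [cl_eq z0]
        exact hmono z0 (cl_mem y) (cl_mem y).1
      vhi := fun y => by
        simp only [cl_eq z1]
        exact hmono (cl_mem y) z1 (cl_mem y).2 }

lemma H1k_eq (k : ℤ) (hk : k ≠ 0) {F : ℝ → ℂ} (hF : ContDiffOn ℝ 1 F (Icc 0 1)) :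
    nH |(k:ℝ)| (fun y => -(Complex.I / k) * F (cl y)) (fun y => -(Complex.I / k) * dI F (cl y))
      = H1k k F / |(k:ℝ)| := by
  have hk' : (0:ℝ) < |(k:ℝ)| := abs_pos.2 (by exact_mod_cast hk)
  have hd := ext_D1 hF
  have hn : ‖-(Complex.I / (k:ℂ))‖ = |(k:ℝ)|⁻¹ := by
    rw [norm_neg, norm_div, Complex.norm_I, one_div, Complex.norm_intCast]
  have e : H1k k F = nH |(k:ℝ)| (fun y => F (cl y)) (fun y => dI F (cl y)) := by
    unfold H1k nH
    rw [int_Ioo, n2_sq, n2_sq, ← J_cmul, ← J_add (f := fun y => ‖dI F (cl y)‖ ^ 2)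
      (g := fun y => |(k:ℝ)| ^ 2 * ‖F (cl y)‖ ^ 2) (hd.c'.norm.pow 2)
      (continuous_const.mul (hd.c.norm.pow 2))]
    congr 1
    apply J_congr
    intro y hy
    simp only [cl_eq hy, sq_abs]
  rw [e]
  unfold nH
  have s1 : ∀ f : ℝ → ℂ, n2 (fun y => -(Complex.I / (k:ℂ)) * f y) ^ 2 = (|(k:ℝ)|⁻¹) ^ 2 * n2 f ^ 2 := by
    intro f
    rw [n2_sq, n2_sq, ← J_cmul]
    apply J_congr
    intro y _
    rw [norm_mul, hn, mul_pow]
  rw [s1 (fun y => F (cl y)), s1 (fun y => dI F (cl y))]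
  rw [show ∀ X Y : ℝ, (|(k:ℝ)|⁻¹) ^ 2 * X + |(k:ℝ)| ^ 2 * ((|(k:ℝ)|⁻¹) ^ 2 * Y)
    = (|(k:ℝ)|⁻¹) ^ 2 * (X + |(k:ℝ)| ^ 2 * Y) from fun X Y => by ring]
  rw [Real.sqrt_mul (by positivity), Real.sqrt_sq (by positivity)]
  ring

lemma sinh_abs_div (k x : ℝ) : Real.sinh (|k| * x) / Real.sinh |k| = Real.sinh (k * x) / Real.sinh k := by
  rcases abs_choice k with h | h
  · rw [h]
  · rw [h, neg_mul, Real.sinh_neg, Real.sinh_neg, neg_div_neg_eq]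

lemma pow_final {ν a δ : ℝ} (hν : 0 < ν) (ha : 0 < a) (hδ : 0 < δ) (h : δ ^ 3 = ν / a) (X : ℝ) :
    (X / a) / (√a * √(√(a * δ))) = ν ^ (-(1:ℝ)/12) * a ^ (-(5:ℝ)/3) * X := by
  have e1 : δ = (ν / a) ^ ((1:ℝ)/3) := by
    rw [← h, ← Real.rpow_natCast, ← Real.rpow_mul hδ.le]
    norm_num
  have e2 : δ = ν ^ ((1:ℝ)/3) * a ^ (-(1:ℝ)/3) := by
    rw [e1, Real.div_rpow hν.le ha.le, div_eq_mul_inv, ← Real.rpow_neg ha.le]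
    norm_num
  have e3 : a * δ = ν ^ ((1:ℝ)/3) * a ^ ((2:ℝ)/3) := by
    rw [e2]
    have : a ^ ((2:ℝ)/3) = a * a ^ (-(1:ℝ)/3) := by
      nth_rewrite 2 [← Real.rpow_one a]
      rw [← Real.rpow_add ha]; norm_num
    rw [this]; ring
  have e4 : √(√(a * δ)) = ν ^ ((1:ℝ)/12) * a ^ ((1:ℝ)/6) := by
    rw [e3, Real.sqrt_eq_rpow, Real.sqrt_eq_rpow, Real.mul_rpow (by positivity) (by positivity),
      Real.mul_rpow (by positivity) (by positivity), ← Real.rpow_mul hν.le, ← Real.rpow_mul hν.le,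
      ← Real.rpow_mul ha.le, ← Real.rpow_mul ha.le]
    norm_num
  have e5 : ν ^ (-(1:ℝ)/12) = (ν ^ ((1:ℝ)/12))⁻¹ := by
    rw [← Real.rpow_neg hν.le]; norm_num
  have e6 : a ^ (-(5:ℝ)/3) = (a * (√a * a ^ ((1:ℝ)/6)))⁻¹ := by
    rw [Real.sqrt_eq_rpow]
    nth_rewrite 2 [← Real.rpow_one a]
    rw [← Real.rpow_add ha, ← Real.rpow_add ha, ← Real.rpow_neg ha.le]; norm_num
  rw [e4, e5, e6]
  have := Real.rpow_pos_of_pos hν ((1:ℝ)/12)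
  have := Real.rpow_pos_of_pos ha ((1:ℝ)/6)
  have := Real.sqrt_pos.2 ha
  field_simp

end OSP

/-- Refined coefficient estimate (Lemma 2.4, estimate (2.26)): `H¹_k` forcing. -/
theorem stmt_8 (V : ℝ → ℝ) (hV : GoodShear V) :
    ∃ C ν₀ ε₁ : ℝ, 0 < C ∧ 0 < ν₀ ∧ 0 < ε₁ ∧
      ∀ (ν lam : ℝ) (k : ℤ) (o : ℂ) (wNa φNa F : ℝ → ℂ),
        0 < ν → ν ≤ ν₀ → k ≠ 0 →
        ν * (k : ℝ) ^ 2 ≤ supDV V →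
        ‖o‖ ≤ ε₁ * (ν * (k : ℝ) ^ 2) ^ ((1:ℝ)/3) →
        ContDiffOn ℝ 1 F (Set.Icc 0 1) →
        OSNavier ν lam k o V wNa φNa F →
        (1 + |(k : ℝ) * (lam - V 0)|) * ‖coefA k wNa‖
            + (1 + |(k : ℝ) * (lam - V 1)|) * ‖coefB k wNa‖
          ≤ C * ν ^ (-(1:ℝ)/12) * (|k| : ℝ) ^ (-(5:ℝ)/3) * H1k k F := by
  obtain ⟨c₀, M, hsup, hS⟩ := OSP.shear_of_good hV
  have hM1 := hS.M1
  have hsg : (∀ y ∈ Ioo (0:ℝ) 1, 0 < dIR (dIR V) (OSP.cl y)) ∨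
      (∀ y ∈ Ioo (0:ℝ) 1, dIR (dIR V) (OSP.cl y) < 0) := by
    rcases hV.2.2 with h | h
    · left; intro y hy; rw [OSP.cl_eq (Ioo_subset_Icc_self hy)]; exact h y hy
    · right; intro y hy; rw [OSP.cl_eq (Ioo_subset_Icc_self hy)]; exact h y hy
  obtain ⟨C, ε₁, δ₀, hC, hε, hε1, hδ₀, H⟩ := OSP.abstract_final hS hsg
  refine ⟨C, δ₀ ^ 3, ε₁, hC, by positivity, hε, ?_⟩
  intro ν lam k o w φ F hν hν0 hk hkν ho hF ⟨hw, hφ, heq, heq2, φ0, φ1, w0, w1⟩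
  have hkR : (k:ℝ) ≠ 0 := by exact_mod_cast hk
  have hkC : (k:ℂ) ≠ 0 := by exact_mod_cast hk
  set a : ℝ := |(k:ℝ)| with ha
  have ha1 : 1 ≤ a := by
    have : (1:ℤ) ≤ |k| := Int.one_le_abs hk
    rw [ha]
    exact_mod_cast this
  have ha0 : 0 < a := by linarith
  have ha2 : a ^ 2 = (k:ℝ) ^ 2 := sq_abs _
  set δ : ℝ := (ν / a) ^ ((1:ℝ)/3) with hδ
  have hδ0 : 0 < δ := by positivity
  have hδ3 : δ ^ 3 = ν / a := by
    rw [hδ, ← Real.rpow_natCast, ← Real.rpow_mul (by positivity)]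
    norm_num
  have ht3 : (a * δ) ^ 3 = ν * (k:ℝ) ^ 2 := by
    rw [mul_pow, hδ3, ← ha2]
    field_simp
  have ht : (ν * (k:ℝ) ^ 2) ^ ((1:ℝ)/3) = a * δ := by
    rw [← ht3, ← Real.rpow_natCast, ← Real.rpow_mul (by positivity)]
    norm_num
  have hκ : a * δ ≤ M := by
    refine le_of_pow_le_pow_left₀ (n := 3) (by norm_num) (by linarith) ?_
    rw [ht3]
    exact (hkν.trans hsup).trans (le_self_pow₀ hM1 (by norm_num))
  have hδδ : δ ≤ δ₀ := by
    refine le_of_pow_le_pow_left₀ (n := 3) (by norm_num) hδ₀.le ?_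
    rw [hδ3]
    exact (div_le_self hν.le ha1).trans hν0
  have z0 : (0:ℝ) ∈ Icc (0:ℝ) 1 := ⟨le_rfl, zero_le_one⟩
  have z1 : (1:ℝ) ∈ Icc (0:ℝ) 1 := ⟨zero_le_one, le_rfl⟩
  have dw1 : ContDiffOn ℝ 1 (dI w) (Icc 0 1) := by
    have := OSP.cdo_deriv (n := 1) (f := w) (by exact_mod_cast hw)
    exact_mod_cast this
  have dφ1 : ContDiffOn ℝ 1 (dI φ) (Icc 0 1) := by
    have := OSP.cdo_deriv (n := 1) (f := φ) (by exact_mod_cast hφ)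
    exact_mod_cast this
  have cw2 : ContinuousOn (dI (dI w)) (Icc 0 1) :=
    (OSP.cdo_deriv (n := 0) (f := dI w) (by exact_mod_cast dw1)).continuousOn
  have cφ2 : ContinuousOn (dI (dI φ)) (Icc 0 1) :=
    (OSP.cdo_deriv (n := 0) (f := dI φ) (by exact_mod_cast dφ1)).continuousOn
  have cw := hw.continuousOn
  have cφ := hφ.continuousOn
  have cF := hF.continuousOn
  have hV1 : ContDiffOn ℝ 3 (dIR V) (Icc 0 1) := by
    have := OSP.cdo_deriv (n := 3) (f := V) (by exact_mod_cast hV.1)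
    exact_mod_cast this
  have hV2 : ContDiffOn ℝ 2 (dIR (dIR V)) (Icc 0 1) := by
    have := OSP.cdo_deriv (n := 2) (f := dIR V) (by exact_mod_cast hV1)
    exact_mod_cast this
  have cV : ContinuousOn (fun y => ((V y - lam : ℝ) : ℂ)) (Icc 0 1) :=
    Complex.continuous_ofReal.comp_continuousOn (hV.1.continuousOn.sub continuousOn_const)
  have cV2 : ContinuousOn (fun y => ((dIR (dIR V) y : ℝ) : ℂ)) (Icc 0 1) :=
    Complex.continuous_ofReal.comp_continuousOn hV2.continuousOn
  have E1 := OSP.eqOn_Icc (f := fun y => -(ν : ℂ) * (dI (dI w) y - (k : ℂ) ^ 2 * w y)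
      + Complex.I * (k : ℂ) * ((V y - lam : ℝ) : ℂ) * w y
      - Complex.I * (k : ℂ) * ((dIR (dIR V) y : ℝ) : ℂ) * φ y
      + o * w y) (g := F)
      (((((continuousOn_const.mul (cw2.sub (continuousOn_const.mul cw))).add
        ((continuousOn_const.mul cV).mul cw)).sub ((continuousOn_const.mul cV2).mul cφ))).add
        (continuousOn_const.mul cw)) cF heq
  have E2 := OSP.eqOn_Icc (f := fun y => dI (dI φ) y - (k : ℂ) ^ 2 * φ y) (g := w)
    (cφ2.sub (continuousOn_const.mul cφ)) cw heq2
  have haC : ((a:ℝ):ℂ) ^ 2 = (k:ℂ) ^ 2 := by exact_mod_cast congrArg (fun x : ℝ => (x:ℂ)) ha2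
  have haC0 : ((a:ℝ):ℂ) ≠ 0 := by exact_mod_cast ha0.ne'
  have hδC : ((δ:ℝ):ℂ) ^ 3 = (ν:ℂ) / (a:ℂ) := by exact_mod_cast congrArg (fun x : ℝ => (x:ℂ)) hδ3
  have hdφ := OSP.ext_D1 (hφ.of_le (by norm_num))
  have hdG : OSP.D1 (fun y => -(Complex.I / k) * F (OSP.cl y))
      (fun y => -(Complex.I / k) * dI F (OSP.cl y)) := by
    have := (OSP.D1.const (-(Complex.I / (k:ℂ)))).mul (OSP.ext_D1 hF)
    exact this.congr' fun y => by simp [dI]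
  have sys : OSP.Sys c₀ M (fun y => V (OSP.cl y)) (fun y => dIR V (OSP.cl y))
      (fun y => dIR (dIR V) (OSP.cl y)) (fun y => dIR (dIR (dIR V)) (OSP.cl y)) lam δ a ((k:ℝ) / a) ε₁
      (o / k) (fun y => w (OSP.cl y)) (fun y => dI w (OSP.cl y)) (fun y => dI (dI w) (OSP.cl y))
      (fun y => φ (OSP.cl y)) (fun y => dI φ (OSP.cl y))
      (fun y => -(Complex.I / k) * F (OSP.cl y)) (fun y => -(Complex.I / k) * dI F (OSP.cl y)) := {
    S := hS
    L := {
      hδ := hδ0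
      ha := ha1
      hκ := hκ
      hσ := by rw [abs_div, abs_of_pos ha0, ← ha, div_self ha0.ne']
      hε0 := hε.le
      hε1 := hε1
      ho := by
        rw [norm_div, Complex.norm_intCast, ← ha, div_le_iff₀ ha0]
        rw [ht] at ho
        linarith
      dw := OSP.ext_D1 (hw.of_le (by norm_num))
      dw1 := OSP.ext_D1 dw1
      dH := ((hS.d2.ofReal.mul hdφ).add hdG).congr' fun y => by simp only [dI]
      w0 := by simp only [OSP.cl_eq z0]; exact w0
      w1 := by simp only [OSP.cl_eq z1]; exact w1
      eq := by
        intro y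
        have h1 := E1 _ (OSP.cl_mem y)
        rw [← h1, hδC, haC]
        have hI := Complex.I_sq
        have h2 : ((a:ℝ):ℂ) * (a:ℂ) = (k:ℂ) ^ 2 := by rw [← haC]; ring
        have h3 : Complex.I * (((k:ℝ) / a : ℝ) : ℂ) * ((ν:ℂ) / (a:ℂ)) = Complex.I / k * ν := by
          push_cast
          field_simp
          rw [← haC]
        rw [h3]
        field_simp
        ring_nf
        rw [hI]
        ring }
    dφ := hdφ
    dφ1 := (OSP.ext_D1 dφ1).congr' fun y => by
      have := E2 _ (OSP.cl_mem y)
      rw [haC, ← this]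
      simp only [dI]
      ring
    dG := hdG
    φ0 := by simp only [OSP.cl_eq z0]; exact φ0
    φ1' := by simp only [OSP.cl_eq z1]; exact φ1 }
  have fin := H sys le_rfl hδδ
  rw [OSP.H1k_eq k hk hF, OSP.pow_final hν ha0 hδ0 hδ3] at fin
  simp only [OSP.cl_eq z0, OSP.cl_eq z1] at fin
  have A : coefA k w = OSP.J (fun y => ((Real.sinh (a * (1 - y)) / Real.sinh a : ℝ) : ℂ) * w (OSP.cl y)) := by
    unfold coefA
    rw [OSP.int_Ioo]
    apply OSP.J_congr
    intro y hy
    rw [OSP.cl_eq hy, ha, OSP.sinh_abs_div]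
  have B : coefB k w = OSP.J (fun y => ((Real.sinh (a * y) / Real.sinh a : ℝ) : ℂ) * w (OSP.cl y)) := by
    unfold coefB
    rw [OSP.int_Ioo]
    apply OSP.J_congr
    intro y hy
    rw [OSP.cl_eq hy, ha, OSP.sinh_abs_div]
  rw [A, B, abs_mul, abs_mul, ← ha]
  refine fin.trans (le_of_eq ?_)
  ring
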